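/- Let k be an algebraically closed field, S a polynomial ring over k, and I ⊆ S a homogeneous ideal generated by n quadrics. If I has an associated prime p with height(p) = 3 and Hilbert–Samuel multiplicity e(S/p) = 2, then pd_S(S/I) ≤ max{3n−4, 4n−10}. -/

import Mathlib

open CategoryTheory Opposite

universe u

/-- The height of an ideal: the infimum of the heights (in the prime spectrum,
ordered by inclusion) of the primes containing it. -/
noncomputable def Ideal.heightENat {R : Type u} [CommRing R] (I : Ideal R) : ℕ∞ :=
  ⨅ (p : PrimeSpectrum R) (_ : I ≤ p.asIdeal), Order.height p

/-- The projective dimension of an `R`-module `M`: the least `n` such that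
`Ext^i(M, N) = 0` for all `i > n` and all modules `N` (and `⊤` if no such `n` exists). -/
noncomputable def projDim (R : Type u) [CommRing R] (M : Type u) [AddCommGroup M]
    [Module R M] : ℕ∞ :=
  sInf ((↑) '' {n : ℕ | ∀ i : ℕ, n < i → ∀ N : ModuleCat.{u} R,
    Subsingleton (((Ext R (ModuleCat.{u} R) i).obj (op (ModuleCat.of R M))).obj N)})

/-- The Hilbert function of the standard graded ring `S/J`, where
`S = k[x_1, ..., x_N]`: the `k`-dimension of the degree-`d` graded piece of `S/J`. -/
noncomputable def hilbertFunction (k : Type u) [Field k] {N : ℕ}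
    (J : Ideal (MvPolynomial (Fin N) k)) (d : ℕ) : ℕ :=
  Module.finrank k (Submodule.map (Ideal.Quotient.mkₐ k J).toLinearMap
    (MvPolynomial.homogeneousSubmodule (Fin N) k d))

open scoped Classical in
/-- The Hilbert–Samuel multiplicity `e(S/J)` of the graded ring `S/J`:
`(deg P)!` times the leading coefficient of the Hilbert polynomial `P` of `S/J`,
i.e. of the polynomial agreeing with the Hilbert function in all large degrees
(the degree of the Hilbert polynomial being `dim(S/J) - 1`). -/
noncomputable def hilbertSamuelMultiplicity (k : Type u) [Field k] {N : ℕ}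
    (J : Ideal (MvPolynomial (Fin N) k)) : ℚ :=
  if h : ∃ P : Polynomial ℚ, ∀ᶠ d : ℕ in Filter.atTop,
      (hilbertFunction k J d : ℚ) = P.eval (d : ℚ)
  then (h.choose.natDegree).factorial * h.choose.leadingCoeff
  else 0


namespace QPD

/-- projective dimension at most `d`. -/
def PD (R : Type u) [CommRing R] (M : Type u) [AddCommGroup M] [Module R M] (d : ℕ) : Prop :=
  HasProjectiveDimensionLE (ModuleCat.of R M) d

section
variable {R : Type u} [CommRing R] {M N Q : Type u} [AddCommGroup M] [Module R M]
  [AddCommGroup N] [Module R N] [AddCommGroup Q] [Module R Q]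

theorem PD.of_equiv {d : ℕ} (h : PD R M d) (e : M ≃ₗ[R] N) : PD R N d :=
  have : HasProjectiveDimensionLT (ModuleCat.of R M) (d+1) := h
  hasProjectiveDimensionLT_of_iso (e.toModuleIso) (d+1)

theorem PD.mono {d e : ℕ} (h : PD R M d) (hde : d ≤ e) : PD R M e :=
  have : HasProjectiveDimensionLT (ModuleCat.of R M) (d+1) := h
  hasProjectiveDimensionLT_of_ge _ (d+1) (e+1) (by omega)

theorem PD.of_projective [Module.Projective R M] (d : ℕ) : PD R M d := by
  have : PD R M 0 := by
    have : Projective (ModuleCat.of R M) := inferInstance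
    exact (projective_iff_hasProjectiveDimensionLE_zero _).1 this
  exact this.mono (Nat.zero_le _)

theorem PD.projective (h : PD R M 0) : Module.Projective R M := by
  have : Projective (ModuleCat.of R M) := (projective_iff_hasProjectiveDimensionLE_zero _).2 h
  exact (IsProjective.iff_projective M).2 this

theorem shortExact (f : N →ₗ[R] M) (g : M →ₗ[R] Q) (hf : Function.Injective f)
    (hg : Function.Surjective g) (h : Function.Exact f g) :
    (ShortComplex.mk (ModuleCat.ofHom f) (ModuleCat.ofHom g)
      (by ext x; exact h.apply_apply_eq_zero x)).ShortExact where
  exact := (ShortComplex.ShortExact.moduleCat_exact_iff_function_exact _).2 h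
  mono_f := (ModuleCat.mono_iff_injective _).2 hf
  epi_g := (ModuleCat.epi_iff_surjective _).2 hg

theorem PD.mid (f : N →ₗ[R] M) (g : M →ₗ[R] Q) (hf : Function.Injective f)
    (hg : Function.Surjective g) (h : Function.Exact f g) {d : ℕ} (h1 : PD R N d) (h3 : PD R Q d) :
    PD R M d :=
  (shortExact f g hf hg h).hasProjectiveDimensionLT_X₂ (d+1) h1 h3

theorem PD.right (f : N →ₗ[R] M) (g : M →ₗ[R] Q) (hf : Function.Injective f)
    (hg : Function.Surjective g) (h : Function.Exact f g) {d : ℕ} (h1 : PD R N d)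
    (h2 : PD R M (d+1)) : PD R Q (d+1) :=
  (shortExact f g hf hg h).hasProjectiveDimensionLT_X₃ (d+1) h1 h2

theorem PD.left (f : N →ₗ[R] M) (g : M →ₗ[R] Q) (hf : Function.Injective f)
    (hg : Function.Surjective g) (h : Function.Exact f g) {d : ℕ} (h2 : PD R M d)
    (h3 : PD R Q (d+1)) : PD R N d :=
  (shortExact f g hf hg h).hasProjectiveDimensionLT_X₁ (d+1) h2 h3

/-- `A : v`. -/
def col (A : Submodule R M) (v : M) : Ideal R := A.comap (LinearMap.toSpanSingleton R M v)

@[simp] theorem mem_col {A : Submodule R M} {v : M} {f : R} : f ∈ col A v ↔ f • v ∈ A := by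
  simp [col]

/-- the map `R / (A : v) → M / A`. -/
def colMap (A : Submodule R M) (v : M) : (R ⧸ col A v) →ₗ[R] (M ⧸ A) :=
  Submodule.mapQ (col A v) A (LinearMap.toSpanSingleton R M v) le_rfl

theorem colMap_inj (A : Submodule R M) (v : M) : Function.Injective (colMap A v) := by
  rw [injective_iff_map_eq_zero]
  intro y hy
  obtain ⟨x, rfl⟩ := Submodule.Quotient.mk_surjective _ y
  change Submodule.Quotient.mk (x • v) = _ at hy
  rw [Submodule.Quotient.mk_eq_zero] at hy ⊢
  exact mem_col.2 hy

def colQ (A : Submodule R M) (v : M) : (M ⧸ A) →ₗ[R] (M ⧸ (A ⊔ R ∙ v)) :=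
  Submodule.mapQ A (A ⊔ R ∙ v) LinearMap.id le_sup_left

theorem colQ_surj (A : Submodule R M) (v : M) : Function.Surjective (colQ A v) := by
  intro y
  obtain ⟨x, rfl⟩ := Submodule.Quotient.mk_surjective _ y
  exact ⟨Submodule.Quotient.mk x, rfl⟩

theorem col_exact (A : Submodule R M) (v : M) : Function.Exact (colMap A v) (colQ A v) := by
  intro y
  obtain ⟨x, rfl⟩ := Submodule.Quotient.mk_surjective _ y
  have : colQ A v (Submodule.Quotient.mk x) = Submodule.Quotient.mk x := rfl
  rw [this, Submodule.Quotient.mk_eq_zero, Submodule.mem_sup]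
  constructor
  · rintro ⟨a, ha, b, hb, rfl⟩
    obtain ⟨c, rfl⟩ := Submodule.mem_span_singleton.1 hb
    refine ⟨Submodule.Quotient.mk c, ?_⟩
    change Submodule.Quotient.mk (c • v) = _
    rw [Submodule.Quotient.eq]
    simpa using ha
  · rintro ⟨c, hc⟩
    obtain ⟨c, rfl⟩ := Submodule.Quotient.mk_surjective _ c
    change Submodule.Quotient.mk (c • v) = _ at hc
    rw [eq_comm, Submodule.Quotient.eq] at hc
    exact ⟨x - c • v, hc, c • v, Submodule.mem_span_singleton.2 ⟨c, rfl⟩, by simp⟩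

theorem cyc_mid (A : Submodule R M) (v : M) {d : ℕ} (h1 : PD R (R ⧸ col A v) d)
    (h2 : PD R (M ⧸ (A ⊔ R ∙ v)) d) : PD R (M ⧸ A) d :=
  PD.mid _ _ (colMap_inj A v) (colQ_surj A v) (col_exact A v) h1 h2

theorem cyc_right (A : Submodule R M) (v : M) {d : ℕ} (h1 : PD R (R ⧸ col A v) d)
    (h2 : PD R (M ⧸ A) (d+1)) : PD R (M ⧸ (A ⊔ R ∙ v)) (d+1) :=
  PD.right _ _ (colMap_inj A v) (colQ_surj A v) (col_exact A v) h1 h2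

theorem cyc_left (A : Submodule R M) (v : M) {d : ℕ} (h1 : PD R (M ⧸ A) d)
    (h2 : PD R (M ⧸ (A ⊔ R ∙ v)) (d+1)) : PD R (R ⧸ col A v) d :=
  PD.left _ _ (colMap_inj A v) (colQ_surj A v) (col_exact A v) h1 h2

theorem PD.of_eq {A B : Submodule R M} {d : ℕ} (h : PD R (M ⧸ A) d) (e : A = B) :
    PD R (M ⧸ B) d := e ▸ h

theorem PD.of_subsingleton [Subsingleton M] (d : ℕ) : PD R M d :=
  have : Module.Projective R M := inferInstance
  PD.of_projective d

/-- `q` regular on `M / A`. -/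
theorem PD.nzd (A : Submodule R M) (q : R) (hq : ∀ e, q • e ∈ A → e ∈ A) {d : ℕ}
    (h : PD R (M ⧸ A) d) : PD R (M ⧸ (A ⊔ (⊤ : Submodule R M).map (LinearMap.lsmul R M q))) (d+1) := by
  refine PD.right (LinearMap.lsmul R (M ⧸ A) q) (Submodule.mapQ A
    (A ⊔ (⊤ : Submodule R M).map (LinearMap.lsmul R M q)) LinearMap.id le_sup_left) ?_ ?_ ?_ h
    (h.mono (Nat.le_succ d))
  · rw [injective_iff_map_eq_zero]
    intro y hy
    obtain ⟨x, rfl⟩ := Submodule.Quotient.mk_surjective _ y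
    change Submodule.Quotient.mk (q • x) = _ at hy
    rw [Submodule.Quotient.mk_eq_zero] at hy ⊢
    exact hq x hy
  · intro y
    obtain ⟨x, rfl⟩ := Submodule.Quotient.mk_surjective _ y
    exact ⟨Submodule.Quotient.mk x, rfl⟩
  · intro y
    obtain ⟨x, rfl⟩ := Submodule.Quotient.mk_surjective _ y
    change Submodule.Quotient.mk x = _ ↔ _
    rw [Submodule.Quotient.mk_eq_zero, Submodule.mem_sup]
    constructor
    · rintro ⟨a, ha, b, ⟨c, -, rfl⟩, rfl⟩
      refine ⟨Submodule.Quotient.mk c, ?_⟩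
      change Submodule.Quotient.mk (q • c) = _
      rw [Submodule.Quotient.eq]
      simpa using ha
    · rintro ⟨c, hc⟩
      obtain ⟨c, rfl⟩ := Submodule.Quotient.mk_surjective _ c
      change Submodule.Quotient.mk (q • c) = _ at hc
      rw [eq_comm, Submodule.Quotient.eq] at hc
      exact ⟨x - q • c, hc, q • c, ⟨c, trivial, rfl⟩, by simp⟩

end
end QPD

namespace QPD
theorem ext_subsingleton {R : Type u} [CommRing R] {M : Type u} [AddCommGroup M] [Module R M]
    {d : ℕ} (h : PD R M d) (i : ℕ) (hi : d < i) (N : ModuleCat.{u} R) :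
    Subsingleton (((Ext R (ModuleCat.{u} R) i).obj (op (ModuleCat.of R M))).obj N) := by
  obtain ⟨j, rfl⟩ : ∃ j, i = j + 1 := ⟨i - 1, by omega⟩
  let P := projectiveResolution (ModuleCat.of R M)
  rw [← ModuleCat.isZero_iff_subsingleton]
  refine Limits.IsZero.of_iso ?_ (P.isoExt (j+1) N)
  rw [← HomologicalComplex.exactAt_iff_isZero_homology,
    HomologicalComplex.exactAt_iff' _ j (j+1) (j+1+1) (by simp) (by simp)]
  rw [ShortComplex.moduleCat_exact_iff]
  intro (x : P.complex.X (j+1) ⟶ N) hx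
  have hx' : P.complex.d (j+1+1) (j+1) ≫ x = 0 := hx
  have h0 : HasProjectiveDimensionLT (ModuleCat.of R M) (d+1) := h
  have h1 : P.extMk x (j+1+1) rfl hx' = 0 :=
    Abelian.Ext.eq_zero_of_hasProjectiveDimensionLT _ (d+1) (by omega)
  rw [ProjectiveResolution.extMk_eq_zero_iff _ _ _ _ _ j rfl] at h1
  obtain ⟨g, hg⟩ := h1
  exact ⟨g, hg⟩

theorem projDim_le {R : Type u} [CommRing R] {M : Type u} [AddCommGroup M] [Module R M]
    {d : ℕ} (h : PD R M d) : projDim R M ≤ (d : ℕ) := by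
  refine sInf_le ⟨d, fun i hi N => ext_subsingleton h i hi N, rfl⟩
end QPD

namespace QPD
open TensorProduct

theorem PD.baseChange {R : Type u} [CommRing R] (S : Type u) [CommRing S] [Algebra R S]
    [Module.Flat R S] (d : ℕ) : ∀ {M : Type u} [AddCommGroup M] [Module R M], PD R M d →
      PD S (S ⊗[R] M) d := by
  induction d with
  | zero =>
    intro M _ _ h
    have := h.projective
    exact PD.of_projective 0
  | succ d ih =>
    intro M _ _ h
    let g : (M →₀ R) →ₗ[R] M := Finsupp.linearCombination R id
    have hg : Function.Surjective g := Finsupp.linearCombination_id_surjective R M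
    have hex : Function.Exact (LinearMap.ker g).subtype g := LinearMap.exact_subtype_ker_map g
    have hK : PD R (LinearMap.ker g) d :=
      PD.left _ g (Submodule.injective_subtype _) hg hex (PD.of_projective d) h
    refine PD.right ((LinearMap.ker g).subtype.baseChange S) (g.baseChange S) ?_ ?_ ?_ (ih hK)
      (PD.of_projective _)
    · exact Module.Flat.lTensor_preserves_injective_linearMap _ (Submodule.injective_subtype _)
    · exact LinearMap.lTensor_surjective S hg
    · have := lTensor_exact (R := R) (M := ↥(LinearMap.ker g)) (N := M →₀ R) (P := M) S (f := (LinearMap.ker g).subtype) (g := g) hex hg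
      exact fun x => this x

/-- all modules have pd at most `d`. -/
def GD (R : Type u) [CommRing R] (d : ℕ) : Prop :=
  ∀ (M : Type u) [AddCommGroup M] [Module R M], PD R M d

theorem GD.of_ringEquiv {R S : Type u} [CommRing R] [CommRing S] (e : R ≃+* S) {d : ℕ}
    (h : GD R d) : GD S d := by
  intro M _ _
  letI : Module R M := Module.compHom M e.toRingHom
  have h1 : HasProjectiveDimensionLE (ModuleCat.of R M) d := h M
  letI := RingHomInvPair.of_ringEquiv e
  letI := RingHomInvPair.symm (e : R →+* S) (e.symm : S →+* R)
  let e' : M ≃ₛₗ[RingHomClass.toRingHom e] M :=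
    { toFun := id, invFun := id, map_add' := fun _ _ => rfl, map_smul' := fun _ _ => rfl,
      left_inv := fun _ => rfl, right_inv := fun _ => rfl }
  exact ModuleCat.hasProjectiveDimensionLE_of_semiLinearEquiv (M := ModuleCat.of R M) (N := ModuleCat.of S M) e e' d

theorem GD.field (k : Type u) [Field k] : GD k 0 := fun _ _ _ => PD.of_projective 0

section poly
open Polynomial
variable {A : Type u} [CommRing A] {M : Type u} [AddCommGroup M] [Module A M] [Module A[X] M]
  [IsScalarTower A A[X] M]

variable (A M) in
noncomputable def mulT : M →ₗ[A] M :=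
  { toFun := fun m => (X : A[X]) • m
    map_add' := smul_add _
    map_smul' := fun a m => by
      simp only [RingHom.id_apply]
      rw [← algebraMap_smul A[X] a m, ← algebraMap_smul A[X] a, smul_comm] }

variable (A M) in
noncomputable def ff : A[X] ⊗[A] M →ₗ[A[X]] A[X] ⊗[A] M :=
  LinearMap.lsmul A[X] _ X - (mulT A M).baseChange A[X]

variable (A M) in
noncomputable def gg : A[X] ⊗[A] M →ₗ[A[X]] M :=
  TensorProduct.AlgebraTensorModule.lift (LinearMap.toSpanSingleton A[X] _ LinearMap.id)

theorem gg_tmul (p : A[X]) (m : M) : gg A M (p ⊗ₜ m) = p • m := by simp [gg]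
theorem ff_tmul (p : A[X]) (m : M) : ff A M (p ⊗ₜ m) = (X * p) ⊗ₜ m - p ⊗ₜ ((X : A[X]) • m) := by
  simp [ff, mulT, smul_tmul']

variable (A M) in
noncomputable def hh : A[X] ⊗[A] M →ₗ[A] A[X] ⊗[A] M :=
  TensorProduct.lift ((basisMonomials A).constr A (fun n =>
    ∑ i ∈ Finset.range n, (TensorProduct.mk A A[X] M (X ^ i)) ∘ₗ ((mulT A M) ^ (n - 1 - i))))

theorem mulT_pow (n : ℕ) (m : M) : (mulT A M ^ n) m = (X : A[X]) ^ n • m := by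
  induction n with
  | zero => simp
  | succ n ih =>
    rw [pow_succ', Module.End.mul_apply, ih, pow_succ', mul_smul]; rfl

theorem hh_tmul (n : ℕ) (m : M) : hh A M ((X ^ n) ⊗ₜ m) =
    ∑ i ∈ Finset.range n, (X ^ i : A[X]) ⊗ₜ[A] ((X : A[X]) ^ (n - 1 - i) • m) := by
  have : (X ^ n : A[X]) = basisMonomials A n := by simp [X_pow_eq_monomial]
  rw [hh, TensorProduct.lift.tmul, this, Module.Basis.constr_basis]
  simp [mulT_pow]

theorem hh_ff (x : A[X] ⊗[A] M) : hh A M (ff A M x) = x := by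
  have : (hh A M) ∘ₗ (ff A M).restrictScalars A = LinearMap.id := by
    apply TensorProduct.ext
    refine (basisMonomials A).ext fun n => ?_
    ext m
    have : (basisMonomials A n : A[X]) = X ^ n := by simp [X_pow_eq_monomial]
    change hh A M (ff A M ((basisMonomials A n) ⊗ₜ m)) = (basisMonomials A n) ⊗ₜ m
    rw [this, ff_tmul, map_sub, ← pow_succ', hh_tmul, hh_tmul]
    rw [Finset.sum_range_succ, add_sub_assoc, add_comm, sub_add_eq_add_sub]
    simp only [add_tsub_cancel_right, tsub_self, pow_zero, one_smul]
    rw [add_sub_assoc, ← Finset.sum_sub_distrib, Finset.sum_eq_zero, add_zero]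
    intro i hi
    rw [Finset.mem_range] at hi
    rw [smul_smul, ← pow_succ, show n - 1 - i + 1 = n - i by omega, sub_self]
  exact LinearMap.congr_fun this x

theorem gg_ff (x : A[X] ⊗[A] M) : gg A M (ff A M x) = 0 := by
  induction x with
  | zero => simp
  | add x y hx hy => simp [hx, hy]
  | tmul p m => rw [ff_tmul, map_sub, gg_tmul, gg_tmul, mul_comm, mul_smul, sub_self]

theorem ffgg_sub_mem (x : A[X] ⊗[A] M) : x - 1 ⊗ₜ gg A M x ∈ LinearMap.range (ff A M) := by
  induction x with
  | zero => simp
  | add x y hx hy =>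
    have := Submodule.add_mem _ hx hy
    rwa [map_add, tmul_add, add_sub_add_comm]
  | tmul p m =>
    rw [gg_tmul]
    induction p using Polynomial.induction_on' generalizing m with
    | add p q hp hq =>
      have := Submodule.add_mem _ (hp m) (hq m)
      rwa [add_tmul, add_smul, tmul_add, add_sub_add_comm]
    | monomial n a =>
      induction n generalizing m with
      | zero =>
        rw [monomial_zero_left, ← Polynomial.algebraMap_eq, algebraMap_smul,
          ← smul_tmul, Algebra.algebraMap_eq_smul_one, sub_self]
        exact zero_mem _
      | succ n ih =>
        have h1 := ih ((X : A[X]) • m)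
        have h2 : ff A M ((monomial n a) ⊗ₜ m) ∈ LinearMap.range (ff A M) := ⟨_, rfl⟩
        have := Submodule.add_mem _ h1 h2
        rw [ff_tmul, X_mul_monomial, smul_smul, monomial_mul_X] at this
        simpa using this

theorem GD.poly {r : ℕ} (h : GD A r) : GD A[X] (r+1) := by
  intro M _ _
  letI : Module A M := Module.compHom M (algebraMap A A[X])
  haveI : IsScalarTower A A[X] M := IsScalarTower.of_algebraMap_smul fun _ _ => rfl
  have h1 : PD A[X] (A[X] ⊗[A] M) r := PD.baseChange A[X] r (h M)
  refine PD.right (ff A M) (gg A M) (fun x y hxy => ?_) (fun m => ⟨1 ⊗ₜ m, by simp [gg_tmul]⟩)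
    (fun x => ⟨fun hx => ?_, ?_⟩) h1 (h1.mono (Nat.le_succ r))
  · rw [← hh_ff x, hxy, hh_ff]
  · have := ffgg_sub_mem x
    rw [hx, tmul_zero, sub_zero] at this
    exact this
  · rintro ⟨y, rfl⟩
    exact gg_ff y
end poly

theorem GD.mvPoly (k : Type u) [Field k] (r : ℕ) : GD (MvPolynomial (Fin r) k) r := by
  induction r with
  | zero => exact GD.of_ringEquiv (MvPolynomial.isEmptyAlgEquiv k (Fin 0)).symm.toRingEquiv (GD.field k)
  | succ r ih =>
    exact GD.of_ringEquiv (MvPolynomial.finSuccEquiv k r).symm.toRingEquiv ih.poly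
end QPD

namespace QPD
open TensorProduct

section
variable {R S : Type u} [CommRing R] [CommRing S] [Algebra R S] {M₀ M : Type u} [AddCommGroup M₀]
  [Module R M₀] [AddCommGroup M] [Module R M] [Module S M] [IsScalarTower R S M]

noncomputable def bcQuot {f : M₀ →ₗ[R] M} (hf : IsBaseChange S f) (A₀ : Submodule R M₀) :
    (S ⊗[R] (M₀ ⧸ A₀)) ≃ₗ[S] (M ⧸ Submodule.span S (f '' A₀)) := by
  refine LinearEquiv.ofLinear
    (TensorProduct.AlgebraTensorModule.lift (LinearMap.toSpanSingleton S _
      (A₀.liftQ (((Submodule.span S (f '' A₀)).mkQ.restrictScalars R) ∘ₗ f) ?_)))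
    (Submodule.liftQ _ (hf.lift ((TensorProduct.mk R S (M₀ ⧸ A₀) 1) ∘ₗ A₀.mkQ)) ?_) ?_ ?_
  · intro a ha
    rw [LinearMap.mem_ker]
    change Submodule.Quotient.mk (f a) = _
    rw [Submodule.Quotient.mk_eq_zero]
    exact Submodule.subset_span ⟨a, ha, rfl⟩
  · rw [Submodule.span_le]
    rintro _ ⟨a, ha, rfl⟩
    rw [SetLike.mem_coe, LinearMap.mem_ker, hf.lift_eq]
    have : A₀.mkQ a = 0 := by simpa using ha
    simp only [LinearMap.comp_apply, this, map_zero]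
  · apply Submodule.linearMap_qext
    refine hf.algHom_ext _ _ fun x => ?_
    simp only [LinearMap.comp_apply, Submodule.mkQ_apply, Submodule.liftQ_apply, hf.lift_eq]
    simp
  · apply TensorProduct.AlgebraTensorModule.ext
    intro s y
    obtain ⟨x, rfl⟩ := Submodule.Quotient.mk_surjective _ y
    simp [hf.lift_eq, smul_tmul']

theorem GD.bc [Module.Flat R S] {f : M₀ →ₗ[R] M} (hf : IsBaseChange S f) (A₀ : Submodule R M₀)
    {r : ℕ} (h : GD R r) : PD S (M ⧸ Submodule.span S (f '' A₀)) r :=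
  (PD.baseChange S r (h (M₀ ⧸ A₀))).of_equiv (bcQuot hf A₀)

theorem isBaseChange_prod : IsBaseChange S
    ((Algebra.linearMap R S).prodMap (Algebra.linearMap R S)) := by
  refine IsBaseChange.of_equiv (TensorProduct.prodRight R S S R R ≪≫ₗ
    LinearEquiv.prodCongr (AlgebraTensorModule.rid R S S) (AlgebraTensorModule.rid R S S)) ?_
  rintro ⟨a, b⟩
  simp [Algebra.algebraMap_eq_smul_one]
end

/-! ### linear forms -/
open MvPolynomial
section lf
variable {K : Type u} [CommRing K] {N : ℕ}

/-- the linear form with given coefficients. -/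
noncomputable def lf : (Fin N → K) →ₗ[K] MvPolynomial (Fin N) K :=
  Fintype.linearCombination K (fun i => (X i : MvPolynomial (Fin N) K))

theorem lf_apply (v : Fin N → K) : lf v = ∑ i, C (v i) * X i := by
  simp [lf, Fintype.linearCombination_apply, smul_eq_C_mul]

@[simp] theorem lf_single (i : Fin N) : lf (Pi.single i (1:K)) = X i := by
  simp [lf]

theorem lf_homog (v : Fin N → K) : (lf v).IsHomogeneous 1 := by
  rw [lf_apply]
  exact IsHomogeneous.sum _ _ _ fun i _ => by
    simpa using (isHomogeneous_C (Fin N) (v i)).mul (isHomogeneous_X K i)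

theorem coeff_lf (v : Fin N → K) (i : Fin N) : coeff (Finsupp.single i 1) (lf v) = v i := by
  rw [lf_apply, coeff_sum, Finset.sum_eq_single i]
  · simp [coeff_C_mul]
  · intro j _ hj
    rw [coeff_C_mul, coeff_X', if_neg, mul_zero]
    rw [Finsupp.single_left_inj one_ne_zero]; exact hj
  · simp

theorem lf_injective : Function.Injective (lf : (Fin N → K) →ₗ[K] _) := by
  intro v w h
  ext i
  rw [← coeff_lf v i, h, coeff_lf]

/-- linear substitution. -/
noncomputable def lsub (π : (Fin N → K) →ₗ[K] (Fin N → K)) :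
    MvPolynomial (Fin N) K →ₐ[K] MvPolynomial (Fin N) K :=
  aeval fun i => lf (π (Pi.single i 1))

@[simp] theorem lsub_lf (π : (Fin N → K) →ₗ[K] (Fin N → K)) (v) : lsub π (lf v) = lf (π v) := by
  have : (lsub π).toLinearMap ∘ₗ lf = lf ∘ₗ π := by
    refine LinearMap.pi_ext' fun i => LinearMap.ext_ring ?_
    simp [lsub, LinearMap.single_apply]
  exact LinearMap.congr_fun this v

theorem lsub_homog (π : (Fin N → K) →ₗ[K] (Fin N → K)) {f} {d : ℕ} (hf : f.IsHomogeneous d) :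
    (lsub π f).IsHomogeneous d := by
  have := hf.aeval (fun i => lf (π (Pi.single i (1:K)))) (fun i => lf_homog _)
  rw [one_mul] at this
  exact this

/-- ideal generated by linear forms. -/
noncomputable def lid (W : Submodule K (Fin N → K)) : Ideal (MvPolynomial (Fin N) K) :=
  Ideal.span (lf '' W)

theorem lf_mem_lid {W : Submodule K (Fin N → K)} {v} (h : v ∈ W) : lf v ∈ lid W :=
  Ideal.subset_span ⟨v, h, rfl⟩

theorem lid_mono {W W' : Submodule K (Fin N → K)} (h : W ≤ W') : lid W ≤ lid W' :=
  Ideal.span_mono (Set.image_mono h)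

theorem lid_sup (W W' : Submodule K (Fin N → K)) : lid (W ⊔ W') = lid W ⊔ lid W' := by
  apply le_antisymm
  · rw [lid, Ideal.span_le]
    rintro _ ⟨v, hv, rfl⟩
    obtain ⟨a, ha, b, hb, rfl⟩ := Submodule.mem_sup.1 hv
    rw [map_add]
    exact add_mem (Ideal.mem_sup_left (lf_mem_lid ha)) (Ideal.mem_sup_right (lf_mem_lid hb))
  · exact sup_le (lid_mono le_sup_left) (lid_mono le_sup_right)

theorem lid_span (s : Set (Fin N → K)) : lid (Submodule.span K s) = Ideal.span (lf '' s) := by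
  apply le_antisymm
  · rw [lid, Ideal.span_le]
    rintro _ ⟨v, hv, rfl⟩
    induction hv using Submodule.span_induction with
    | mem x hx => exact Ideal.subset_span ⟨x, hx, rfl⟩
    | zero => simp
    | add x y _ _ hx hy => rw [map_add]; exact add_mem hx hy
    | smul a x _ hx => rw [map_smul, smul_eq_C_mul]; exact Ideal.mul_mem_left _ _ hx
  · exact Ideal.span_mono (Set.image_mono Submodule.subset_span)

@[simp] theorem lid_bot : lid (⊥ : Submodule K (Fin N → K)) = ⊥ := by
  simp [lid]

structure IsPr (π : (Fin N → K) →ₗ[K] (Fin N → K)) (W : Submodule K (Fin N → K)) : Prop where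
  zero : ∀ v ∈ W, π v = 0
  sub : ∀ v, v - π v ∈ W

variable {π : (Fin N → K) →ₗ[K] (Fin N → K)} {W : Submodule K (Fin N → K)}

theorem sub_lsub_mem (h : ∀ v, v - π v ∈ W) (f) : f - lsub π f ∈ lid W := by
  induction f using MvPolynomial.induction_on with
  | C a => simp [lsub]
  | add p q hp hq => rw [map_add, add_sub_add_comm]; exact add_mem hp hq
  | mul_X p i hp =>
    rw [map_mul]
    have h2 : X i - lsub π (X i) ∈ lid W := by
      have := lf_mem_lid (h (Pi.single i 1))
      rw [← lf_single (K := K) i, lsub_lf, ← map_sub]; exact this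
    have : p * X i - lsub π p * lsub π (X i) = (p - lsub π p) * X i + lsub π p * (X i - lsub π (X i)) := by ring
    rw [this]
    exact add_mem (Ideal.mul_mem_right _ _ hp) (Ideal.mul_mem_left _ _ h2)

theorem lsub_eq_zero (h : ∀ v ∈ W, π v = 0) {f} (hf : f ∈ lid W) : lsub π f = 0 := by
  have : lid W ≤ RingHom.ker (lsub π) := by
    rw [lid, Ideal.span_le]
    rintro _ ⟨v, hv, rfl⟩
    simp [RingHom.mem_ker, h v hv]
  exact this hf

theorem IsPr.mem_iff (h : IsPr π W) {f} : f ∈ lid W ↔ lsub π f = 0 := by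
  refine ⟨lsub_eq_zero h.zero, fun hf => ?_⟩
  have := sub_lsub_mem h.sub f
  rwa [hf, sub_zero] at this

theorem IsPr.prime [IsDomain K] (h : IsPr π W) : (lid W).IsPrime := by
  have : lid W = RingHom.ker (lsub π) := by
    ext f; rw [h.mem_iff, RingHom.mem_ker]
  rw [this]
  exact RingHom.ker_isPrime _

theorem IsPr.lf_mem (h : IsPr π W) {v} : lf v ∈ lid W ↔ v ∈ W := by
  refine ⟨fun hv => ?_, lf_mem_lid⟩
  rw [h.mem_iff, lsub_lf] at hv
  have h2 := lf_injective (hv.trans (map_zero _).symm)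
  have := h.sub v
  rwa [h2, sub_zero] at this

theorem IsPr.idem (h : IsPr π W) (v) : π (π v) = π v := by
  have := h.zero _ (h.sub v)
  rw [map_sub, sub_eq_zero] at this
  exact this.symm

theorem IsPr.lsub_idem (h : IsPr π W) (f) : lsub π (lsub π f) = lsub π f := by
  have := lsub_eq_zero h.zero (sub_lsub_mem h.sub f)
  rw [map_sub, sub_eq_zero] at this
  exact this.symm
end lf

section field
variable {k : Type u} [Field k] {N : ℕ}

theorem exists_pr {W W' : Submodule k (Fin N → k)} (h : Disjoint W W') :
    ∃ π, IsPr π W ∧ ∀ v ∈ W', π v = v := by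
  obtain ⟨U, hU, hc⟩ := h.symm.exists_isCompl
  refine ⟨U.projection W hc, ⟨fun v hv => ?_, fun v => ?_⟩, fun v hv => ?_⟩
  · exact (Submodule.projection_apply_eq_zero_iff hc).2 hv
  · have := Submodule.projection_add_projection_eq_self hc v
    nth_rw 1 [← this]
    simp
  · exact Submodule.projection_apply_left hc ⟨v, hU hv⟩

theorem exists_pr' (W : Submodule k (Fin N → k)) : ∃ π, IsPr π W :=
  let ⟨π, h, _⟩ := exists_pr (W := W) (W' := ⊥) disjoint_bot_right; ⟨π, h⟩

theorem lid_prime (W : Submodule k (Fin N → k)) : (lid W).IsPrime :=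
  let ⟨_, h⟩ := exists_pr' W; h.prime

theorem lf_mem_lid_iff {W : Submodule k (Fin N → k)} {v} : lf v ∈ lid W ↔ v ∈ W :=
  let ⟨_, h⟩ := exists_pr' W; h.lf_mem
end field
end QPD

namespace QPD
open TensorProduct MvPolynomial
section field
variable {k : Type u} [Field k] {N : ℕ}

theorem basis_bij {σ : Type*} (B : Module.Basis σ k (Fin N → k)) :
    Function.Bijective (aeval (R := k) (fun i => lf (B i)) : MvPolynomial σ k →ₐ[k] MvPolynomial (Fin N) k) := by
  let ψ : MvPolynomial (Fin N) k →ₐ[k] MvPolynomial σ k :=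
    aeval fun i => Finsupp.linearCombination k (fun j => (X j : MvPolynomial σ k)) (B.repr (Pi.single i 1))
  let φ : MvPolynomial σ k →ₐ[k] MvPolynomial (Fin N) k := aeval (R := k) (fun i => lf (B i))
  have hψ : ∀ v, ψ (lf v) = Finsupp.linearCombination k (fun j => (X j : MvPolynomial σ k)) (B.repr v) := by
    intro v
    have : ψ.toLinearMap ∘ₗ lf = Finsupp.linearCombination k (fun j => (X j : MvPolynomial σ k)) ∘ₗ B.repr.toLinearMap := by
      refine LinearMap.pi_ext' fun i => LinearMap.ext_ring ?_
      simp [ψ]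
    exact LinearMap.congr_fun this v
  have h1 : ψ.comp φ = AlgHom.id _ _ := by
    apply MvPolynomial.algHom_ext
    intro i
    simp [φ, hψ]
  have h2 : φ.comp ψ = AlgHom.id _ _ := by
    apply MvPolynomial.algHom_ext
    intro i
    simp only [AlgHom.comp_apply, AlgHom.id_apply]
    rw [← lf_single, hψ]
    have : φ.toLinearMap ∘ₗ Finsupp.linearCombination k (fun j => (X j : MvPolynomial σ k)) = lf ∘ₗ (Finsupp.linearCombination k B) := by
      ext j; simp [φ]
    have := LinearMap.congr_fun this (B.repr (Pi.single i 1))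
    simpa using this
  exact ⟨fun x y h => by
      have := congrArg ψ h
      have e := fun x => DFunLike.congr_fun h1 x
      simp only [AlgHom.comp_apply, AlgHom.id_apply] at e
      change ψ (φ x) = ψ (φ y) at this
      rwa [e, e] at this, fun y => ⟨ψ y, DFunLike.congr_fun h2 y⟩⟩

/-- polynomials in the linear forms in `U`. -/
noncomputable def kU (U : Submodule k (Fin N → k)) : Subalgebra k (MvPolynomial (Fin N) k) :=
  Algebra.adjoin k (lf '' U)

theorem lf_mem_kU {U : Submodule k (Fin N → k)} {v} (h : v ∈ U) : lf v ∈ kU U :=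
  Algebra.subset_adjoin ⟨v, h, rfl⟩

theorem kU_mono {U U' : Submodule k (Fin N → k)} (h : U ≤ U') : kU U ≤ kU U' :=
  Algebra.adjoin_mono (Set.image_mono h)

theorem kU_range {U : Submodule k (Fin N → k)} {r : ℕ} (b : Module.Basis (Fin r) k U) :
    kU U ≤ (aeval (R := k) (fun i => lf (b i : Fin N → k))).range := by
  rw [kU, Algebra.adjoin_le_iff]
  rintro _ ⟨v, hv, rfl⟩
  have : v = ∑ i, b.repr ⟨v, hv⟩ i • (b i : Fin N → k) := by
    have := congrArg Subtype.val (b.sum_repr ⟨v, hv⟩)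
    rw [Submodule.coe_sum] at this
    exact this.symm
  rw [this, map_sum]
  refine sum_mem fun i _ => ?_
  rw [map_smul]
  have h1 : lf (b i : Fin N → k) ∈ (aeval (R := k) (fun i => lf (b i : Fin N → k))).range :=
    ⟨X i, by simp⟩
  exact Subalgebra.smul_mem _ h1 _

theorem flat_aux {U : Submodule k (Fin N → k)} {r : ℕ} (b : Module.Basis (Fin r) k U) :
    letI : Algebra (MvPolynomial (Fin r) k) (MvPolynomial (Fin N) k) :=
      (aeval (R := k) (fun i => lf (b i : Fin N → k))).toAlgebra
    Module.Flat (MvPolynomial (Fin r) k) (MvPolynomial (Fin N) k) := by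
  letI : Algebra (MvPolynomial (Fin r) k) (MvPolynomial (Fin N) k) :=
      (aeval (R := k) (fun i => lf (b i : Fin N → k))).toAlgebra
  have hli : LinearIndependent k (fun i => (b i : Fin N → k)) :=
    b.linearIndependent.map' U.subtype (Submodule.ker_subtype _)
  let B := Module.Basis.sumExtend hli
  let ι := Module.Basis.sumExtendIndex hli
  let e : MvPolynomial ι (MvPolynomial (Fin r) k) ≃ₐ[k] MvPolynomial (Fin N) k :=
    (sumAlgEquiv k ι (Fin r)).symm.trans ((renameEquiv k (Equiv.sumComm ι (Fin r))).trans
      (AlgEquiv.ofBijective _ (basis_bij B)))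
  have he : ∀ p, e (C p) = algebraMap (MvPolynomial (Fin r) k) (MvPolynomial (Fin N) k) p := by
    have : e.toAlgHom.comp (Algebra.ofId (MvPolynomial (Fin r) k) (MvPolynomial ι (MvPolynomial (Fin r) k)) |>.restrictScalars k)
      = aeval (R := k) (fun i => lf (b i : Fin N → k)) := by
      apply MvPolynomial.algHom_ext
      intro i
      have hB : B (Sum.inl i) = (b i : Fin N → k) := by
        simp [B, Module.Basis.sumExtend, Module.Basis.reindex_apply, Equiv.ofInjective, Equiv.Set.sumDiffSubset]
        rfl
      simp [e, Algebra.ofId_apply, MvPolynomial.algebraMap_eq, hB]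
    intro p
    exact DFunLike.congr_fun this p
  let e' : MvPolynomial ι (MvPolynomial (Fin r) k) ≃ₗ[MvPolynomial (Fin r) k] MvPolynomial (Fin N) k :=
    { e with
      map_smul' := fun p x => by
        change e (p • x) = p • e x
        rw [smul_eq_C_mul, map_mul, he, Algebra.smul_def] }
  exact Module.Flat.of_linearEquiv e'.symm

theorem var2 (U : Submodule k (Fin N → k)) (T : Set (MvPolynomial (Fin N) k × MvPolynomial (Fin N) k))
    (hT : ∀ t ∈ T, t.1 ∈ kU U ∧ t.2 ∈ kU U) :
    PD (MvPolynomial (Fin N) k) ((MvPolynomial (Fin N) k × MvPolynomial (Fin N) k) ⧸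
      Submodule.span (MvPolynomial (Fin N) k) T) (Module.finrank k U) := by
  let b := Module.finBasis k U
  letI : Algebra (MvPolynomial (Fin (Module.finrank k U)) k) (MvPolynomial (Fin N) k) :=
      (aeval (R := k) (fun i => lf (b i : Fin N → k))).toAlgebra
  have := flat_aux b
  have h := GD.bc (S := MvPolynomial (Fin N) k) isBaseChange_prod (Submodule.span _
    (((Algebra.linearMap _ _).prodMap (Algebra.linearMap _ _)) ⁻¹' T)) (GD.mvPoly k (Module.finrank k U))
  refine h.of_eq (le_antisymm ?_ ?_)
  · rw [Submodule.span_le]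
    rintro _ ⟨a, ha, rfl⟩
    induction ha using Submodule.span_induction with
    | mem x hx => exact Submodule.subset_span hx
    | zero => rw [map_zero]; exact zero_mem _
    | add x y _ _ hx hy => rw [map_add]; exact add_mem hx hy
    | smul a x _ hx =>
      rw [map_smul, ← algebraMap_smul (MvPolynomial (Fin N) k) a]; exact Submodule.smul_mem _ _ hx
  · rw [Submodule.span_le]
    rintro ⟨t1, t2⟩ ht
    obtain ⟨h1, h2⟩ := hT _ ht
    obtain ⟨a1, rfl⟩ := kU_range b h1
    obtain ⟨a2, rfl⟩ := kU_range b h2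
    exact Submodule.subset_span ⟨(a1, a2), Submodule.subset_span ht, rfl⟩

theorem var1 (U : Submodule k (Fin N → k)) (T : Set (MvPolynomial (Fin N) k))
    (hT : ∀ t ∈ T, t ∈ kU U) :
    PD (MvPolynomial (Fin N) k) (MvPolynomial (Fin N) k ⧸ Ideal.span T) (Module.finrank k U) := by
  let b := Module.finBasis k U
  letI : Algebra (MvPolynomial (Fin (Module.finrank k U)) k) (MvPolynomial (Fin N) k) :=
      (aeval (R := k) (fun i => lf (b i : Fin N → k))).toAlgebra
  have := flat_aux b
  have h := GD.bc (S := MvPolynomial (Fin N) k) (IsBaseChange.linearMap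
    (MvPolynomial (Fin (Module.finrank k U)) k) (MvPolynomial (Fin N) k)) (Submodule.span _
    ((Algebra.linearMap _ _) ⁻¹' T)) (GD.mvPoly k (Module.finrank k U))
  refine h.of_eq (le_antisymm ?_ ?_)
  · rw [Submodule.span_le]
    rintro _ ⟨a, ha, rfl⟩
    induction ha using Submodule.span_induction with
    | mem x hx => exact Submodule.subset_span hx
    | zero => rw [map_zero]; exact zero_mem _
    | add x y _ _ hx hy => rw [map_add]; exact add_mem hx hy
    | smul a x _ hx =>
      rw [map_smul, ← algebraMap_smul (MvPolynomial (Fin N) k) a]; exact Submodule.smul_mem _ _ hx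
  · rw [Ideal.span_le]
    intro t ht
    obtain ⟨a1, rfl⟩ := kU_range b (hT _ ht)
    exact Submodule.subset_span ⟨a1, Submodule.subset_span ht, rfl⟩

theorem pd_lid (W : Submodule k (Fin N → k)) :
    PD (MvPolynomial (Fin N) k) (MvPolynomial (Fin N) k ⧸ lid W) (Module.finrank k W) :=
  var1 W _ (by rintro _ ⟨v, hv, rfl⟩; exact lf_mem_kU hv)

end field
end QPD

namespace QPD
open MvPolynomial

/-- the polynomial ring. -/
abbrev Pol (k : Type u) [CommRing k] (N : ℕ) := MvPolynomial (Fin N) k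
/-- coefficient vectors of linear forms. -/
abbrev Vec (k : Type u) (N : ℕ) := Fin N → k
/-- the free module of rank two. -/
abbrev M2 (k : Type u) [CommRing k] (N : ℕ) := Pol k N × Pol k N

section field
variable {k : Type u} [Field k] {N : ℕ}

theorem hcomp_mul {a b : Pol k N} {i : ℕ} (ha : a.IsHomogeneous i) (n : ℕ) :
    homogeneousComponent (i + n) (a * b) = a * homogeneousComponent n b := by
  letI := MvPolynomial.gradedAlgebra (σ := Fin N) (R := k)
  have := DirectSum.coe_decompose_mul_add_of_left_mem (homogeneousSubmodule (Fin N) k) (i := i) (j := n) (a := a) (b := b) ha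
  have e := fun (φ : Pol k N) (i : ℕ) => decomposition.decompose'_apply (σ := Fin N) (R := k) φ i
  rw [← e, ← e]
  exact this

theorem hcomp_mul' {a b : Pol k N} {i n : ℕ} (ha : a.IsHomogeneous i) (h : i ≤ n) :
    homogeneousComponent n (a * b) = a * homogeneousComponent (n - i) b := by
  obtain ⟨m, rfl⟩ := Nat.exists_eq_add_of_le h
  rw [hcomp_mul ha, Nat.add_sub_cancel_left]

theorem hcomp_self {a : Pol k N} {i : ℕ} (ha : a.IsHomogeneous i) : homogeneousComponent i a = a :=
  homogeneousComponent_eq_self ha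

theorem mem_lid_basis {W : Submodule k (Vec k N)} {r : ℕ} (b : Module.Basis (Fin r) k W) {f : Pol k N}
    (hf : f ∈ lid W) : ∃ g : Fin r → Pol k N, f = ∑ i, g i * lf (b i : Vec k N) := by
  have h1 : lid W = Ideal.span (Set.range fun i => lf (b i : Vec k N)) := by
    have : W = Submodule.span k (Set.range fun i => (b i : Vec k N)) := by
      have := b.span_eq
      apply_fun Submodule.map W.subtype at this
      rw [Submodule.map_span, ← Set.range_comp] at this
      simp only [Submodule.map_top, Submodule.range_subtype] at this
      exact this.symm
    conv_lhs => rw [this]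
    rw [lid_span, ← Set.range_comp]; rfl
  rw [h1] at hf
  obtain ⟨g, hg⟩ := (Ideal.mem_span_range_iff_exists_fun).1 hf
  exact ⟨g, hg.symm⟩

theorem hdecomp {W : Submodule k (Vec k N)} {r : ℕ} (b : Module.Basis (Fin r) k W) {f : Pol k N} {d : ℕ}
    (hf : f ∈ lid W) (hd : f.IsHomogeneous (d+1)) :
    ∃ g : Fin r → Pol k N, (∀ i, (g i).IsHomogeneous d) ∧ f = ∑ i, g i * lf (b i : Vec k N) := by
  obtain ⟨g, hg⟩ := mem_lid_basis b hf
  refine ⟨fun i => homogeneousComponent d (g i), fun i => homogeneousComponent_isHomogeneous _ _, ?_⟩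
  have := congrArg (homogeneousComponent (d+1)) hg
  rw [hcomp_self hd, map_sum] at this
  rw [this]
  refine Finset.sum_congr rfl fun i _ => ?_
  rw [mul_comm, add_comm, hcomp_mul (lf_homog _), mul_comm]

theorem mem_lid_top {f : Pol k N} {d : ℕ} (hd : f.IsHomogeneous (d+1)) : f ∈ lid (⊤ : Submodule k (Vec k N)) := by
  have h := sub_lsub_mem (π := (0 : Vec k N →ₗ[k] Vec k N)) (W := ⊤) (fun _ => trivial) f
  have h0 : lsub (0 : Vec k N →ₗ[k] Vec k N) f = 0 := by
    have : lsub (0 : Vec k N →ₗ[k] Vec k N) f = C (constantCoeff f) := by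
      have h2 : (fun i : Fin N => lf ((0 : Vec k N →ₗ[k] Vec k N) (Pi.single i 1))) = fun _ => 0 := by
        ext i; simp
      rw [lsub, h2]
      exact aeval_zero' f
    rw [this]
    have : constantCoeff f = 0 := by
      rw [constantCoeff_eq]
      by_contra hne
      have := hd hne
      simp at this
    rw [this, map_zero]
  rwa [h0, sub_zero] at h

theorem homog_zero_eq {f : Pol k N} (hd : f.IsHomogeneous 0) : ∃ a, f = C a :=
  ⟨_, (totalDegree_eq_zero_iff_eq_C.1 (Nat.le_zero.1 hd.totalDegree_le))⟩

theorem homog_one_eq {f : Pol k N} (hd : f.IsHomogeneous 1) : ∃ v, f = lf v := by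
  obtain ⟨g, hg, h⟩ := hdecomp (Module.finBasis k (⊤ : Submodule k (Vec k N))) (mem_lid_top hd) hd
  choose a ha using fun i => homog_zero_eq (hg i)
  refine ⟨∑ i, a i • (Module.finBasis k (⊤ : Submodule k (Vec k N)) i : Vec k N), ?_⟩
  rw [h, map_sum]
  refine Finset.sum_congr rfl fun i _ => ?_
  rw [map_smul, ha, smul_eq_C_mul]

/-- A quadric in `(W)`. -/
theorem quad_decomp {W : Submodule k (Vec k N)} {r : ℕ} (b : Module.Basis (Fin r) k W) {f : Pol k N}
    (hf : f ∈ lid W) (hd : f.IsHomogeneous 2) :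
    ∃ u : Fin r → Vec k N, f = ∑ i, lf (u i) * lf (b i : Vec k N) := by
  obtain ⟨g, hg, h⟩ := hdecomp b hf hd
  choose u hu using fun i => homog_one_eq (hg i)
  exact ⟨u, by rw [h]; simp [hu]⟩

theorem quad_decomp_top {f : Pol k N} (hd : f.IsHomogeneous 2) :
    ∃ (r : ℕ) (u w : Fin r → Vec k N), f = ∑ i, lf (u i) * lf (w i) := by
  obtain ⟨u, hu⟩ := quad_decomp (Module.finBasis k (⊤ : Submodule k (Vec k N))) (mem_lid_top hd) hd
  exact ⟨_, u, _, hu⟩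

/-- translation. -/
noncomputable def tr (c : Vec k N) : Pol k N →ₐ[k] Polynomial (Pol k N) :=
  aeval fun i => Polynomial.C (X i) + Polynomial.X * Polynomial.C (C (c i))

theorem tr_lf (c v : Vec k N) : tr c (lf v) = Polynomial.C (lf v) + Polynomial.X * Polynomial.C (C (v ⬝ᵥ c)) := by
  rw [lf_apply, map_sum, map_sum, dotProduct, map_sum, map_sum, Finset.mul_sum, ← Finset.sum_add_distrib]
  refine Finset.sum_congr rfl fun i _ => ?_
  rw [map_mul, ← algebraMap_eq, AlgHom.commutes]
  simp only [tr, aeval_X, algebraMap_eq, map_mul]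
  rw [Polynomial.algebraMap_apply, algebraMap_eq]
  ring

theorem tr_lf_fix {c v : Vec k N} (h : v ⬝ᵥ c = 0) : tr c (lf v) = Polynomial.C (lf v) := by
  simp [tr_lf, h]

theorem tr_kU_fix {c : Vec k N} {U : Submodule k (Vec k N)} (h : ∀ v ∈ U, v ⬝ᵥ c = 0) {f} (hf : f ∈ kU U) :
    tr c f = Polynomial.C f := by
  induction hf using Algebra.adjoin_induction with
  | mem x hx => obtain ⟨v, hv, rfl⟩ := hx; exact tr_lf_fix (h v hv)
  | algebraMap r => rw [AlgHom.commutes, Polynomial.algebraMap_apply]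
  | add x y _ _ hx hy => simp [hx, hy]
  | mul x y _ _ hx hy => simp [hx, hy]

theorem tr_coeff_zero (c : Vec k N) (f) : (tr c f).coeff 0 = f := by
  have : (Polynomial.constantCoeff (R := Pol k N)).comp (tr c : Pol k N →+* _) = RingHom.id _ := by
    apply MvPolynomial.ringHom_ext
    · intro r
      have : tr c (C r) = Polynomial.C (C r) := by
        rw [← algebraMap_eq, AlgHom.commutes, Polynomial.algebraMap_apply]
      simp [this]
    · intro i
      simp [tr]
  exact RingHom.congr_fun this f

theorem smul_coeff_mem {A : Submodule (Pol k N) (M2 k N)} (p : Polynomial (Pol k N))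
    {a b : Polynomial (Pol k N)} (h : ∀ n, (a.coeff n, b.coeff n) ∈ A) (n : ℕ) :
    ((p * a).coeff n, (p * b).coeff n) ∈ A := by
  have : ((p * a).coeff n, (p * b).coeff n) =
      ∑ x ∈ Finset.HasAntidiagonal.antidiagonal n, p.coeff x.1 • (a.coeff x.2, b.coeff x.2) := by
    rw [Polynomial.coeff_mul, Polynomial.coeff_mul, ← prod_mk_sum]
    rfl
  rw [this]
  exact sum_mem fun x _ => A.smul_mem _ (h _)

theorem span_coeff (T : Set (M2 k N)) (c : Vec k N)
    (hT : ∀ t ∈ T, tr c t.1 = Polynomial.C t.1 ∧ tr c t.2 = Polynomial.C t.2) {e : M2 k N}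
    (he : e ∈ Submodule.span (Pol k N) T) : ∀ (n : ℕ),
    ((tr c e.1).coeff n, (tr c e.2).coeff n) ∈ Submodule.span (Pol k N) T := by
  induction he using Submodule.span_induction with
  | mem x hx =>
    intro n
    rw [(hT x hx).1, (hT x hx).2]
    by_cases h : n = 0
    · subst h; simpa using Submodule.subset_span hx
    · simp only [Polynomial.coeff_C, h, if_false]; exact zero_mem _
  | zero =>
    intro n
    simp only [Prod.fst_zero, Prod.snd_zero, map_zero, Polynomial.coeff_zero]; exact zero_mem _
  | add x y _ _ hx hy =>
    intro n
    have := add_mem (hx n) (hy n)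
    simpa using this
  | smul a x _ hx =>
    intro n
    have := smul_coeff_mem (tr c a) hx n
    simpa using this

/-- translation criterion for non-zero-divisors. -/
theorem nzd_tr (T : Set (M2 k N)) (c : Vec k N)
    (hT : ∀ t ∈ T, tr c t.1 = Polynomial.C t.1 ∧ tr c t.2 = Polynomial.C t.2) {q : Pol k N} {d : ℕ}
    (hq1 : IsUnit ((tr c q).coeff d)) (hq2 : (tr c q).natDegree ≤ d) {e : M2 k N}
    (he : q • e ∈ Submodule.span (Pol k N) T) : e ∈ Submodule.span (Pol k N) T := by
  set A := Submodule.span (Pol k N) T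
  set B := (tr c e.1).natDegree + (tr c e.2).natDegree + 1
  have key : ∀ j n, B ≤ n + j → ((tr c e.1).coeff n, (tr c e.2).coeff n) ∈ A := by
    intro j
    induction j with
    | zero =>
      intro n hn
      rw [Polynomial.coeff_eq_zero_of_natDegree_lt, Polynomial.coeff_eq_zero_of_natDegree_lt]
      · exact zero_mem _
      · omega
      · omega
    | succ j ih =>
      intro n hn
      have h1 := span_coeff T c hT he (d + n)
      simp only [Prod.smul_fst, Prod.smul_snd, smul_eq_mul, map_mul] at h1
      have : ((tr c q * tr c e.1).coeff (d+n), (tr c q * tr c e.2).coeff (d+n)) =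
          ∑ x ∈ Finset.HasAntidiagonal.antidiagonal (d+n), (tr c q).coeff x.1 • ((tr c e.1).coeff x.2, (tr c e.2).coeff x.2) := by
        rw [Polynomial.coeff_mul, Polynomial.coeff_mul, ← prod_mk_sum]
        rfl
      rw [this, ← Finset.add_sum_erase _ _ (a := (d, n)) (by simp)] at h1
      have h2 : (∑ x ∈ (Finset.HasAntidiagonal.antidiagonal (d+n)).erase (d, n),
          (tr c q).coeff x.1 • ((tr c e.1).coeff x.2, (tr c e.2).coeff x.2)) ∈ A := by
        refine sum_mem fun x hx => ?_
        obtain ⟨i, m⟩ := x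
        rw [Finset.mem_erase, Finset.HasAntidiagonal.mem_antidiagonal] at hx
        simp only [ne_eq, Prod.mk.injEq, not_and] at hx
        by_cases hi : d < i
        · rw [Polynomial.coeff_eq_zero_of_natDegree_lt (lt_of_le_of_lt hq2 hi), zero_smul]
          exact zero_mem _
        · refine A.smul_mem _ (ih m ?_)
          have : i ≠ d := fun h => hx.1 h (by omega)
          omega
      have h3 := (Submodule.add_mem_iff_left A h2).1 h1
      obtain ⟨w, hw⟩ := hq1
      have h4 := A.smul_mem (↑w⁻¹ : Pol k N) h3
      rw [← hw, smul_smul, Units.inv_mul, one_smul] at h4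
      exact h4
  have := key B 0 (by omega)
  rwa [tr_coeff_zero, tr_coeff_zero] at this

theorem nzd_tr1 (T : Set (Pol k N)) (c : Vec k N)
    (hT : ∀ t ∈ T, tr c t = Polynomial.C t) {q : Pol k N} {d : ℕ}
    (hq1 : IsUnit ((tr c q).coeff d)) (hq2 : (tr c q).natDegree ≤ d) {e : Pol k N}
    (he : q * e ∈ Ideal.span T) : e ∈ Ideal.span T := by
  have h1 : ∀ f, f ∈ Ideal.span T ↔ (f, (0 : Pol k N)) ∈ Submodule.span (Pol k N) ((fun t => (t, (0 : Pol k N))) '' T) := by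
    intro f
    have : (fun t => (t, (0 : Pol k N))) = LinearMap.inl (Pol k N) (Pol k N) (Pol k N) := by
      ext t <;> simp
    rw [this, ← Submodule.map_span, ← Ideal.submodule_span_eq]
    simp
  rw [h1] at he ⊢
  refine nzd_tr _ c ?_ hq1 hq2 (q := q) ?_
  · rintro _ ⟨t, ht, rfl⟩
    exact ⟨hT t ht, by simp⟩
  · simpa using he

theorem exists_dual {W : Submodule k (Vec k N)} {v : Vec k N} (hv : v ∉ W) :
    ∃ c : Vec k N, v ⬝ᵥ c = 1 ∧ ∀ w ∈ W, w ⬝ᵥ c = 0 := by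
  obtain ⟨f, hf, hW⟩ := Submodule.exists_dual_map_eq_bot_of_notMem hv inferInstance
  have hrep : ∀ w, f w = w ⬝ᵥ (fun i => f (Pi.single i 1)) := by
    intro w
    conv_lhs => rw [← Finset.univ_sum_single w, map_sum]
    refine Finset.sum_congr rfl fun i _ => ?_
    have : (Pi.single i (w i) : Vec k N) = w i • Pi.single i 1 := by simp [← Pi.single_smul]
    rw [this, map_smul, smul_eq_mul]
  refine ⟨(f v)⁻¹ • fun i => f (Pi.single i 1), ?_, fun w hw => ?_⟩
  · rw [dotProduct_smul, ← hrep, smul_eq_mul, inv_mul_cancel₀ hf]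
  · rw [dotProduct_smul, ← hrep]
    have : f w ∈ W.map f := ⟨w, hw, rfl⟩
    rw [hW, Submodule.mem_bot] at this
    rw [this, smul_zero]

/-- a linear form outside `U` is regular modulo anything generated in `k[U]`. -/
theorem nzd_lf {U : Submodule k (Vec k N)} {T : Set (Pol k N)} (hT : ∀ t ∈ T, t ∈ kU U) {v : Vec k N}
    (hv : v ∉ U) {e : Pol k N} (he : lf v * e ∈ Ideal.span T) : e ∈ Ideal.span T := by
  obtain ⟨c, hc, hU⟩ := exists_dual hv
  have htr : tr c (lf v) = Polynomial.X + Polynomial.C (lf v) := by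
    rw [tr_lf, hc]; simp [add_comm]
  refine nzd_tr1 T c (fun t ht => tr_kU_fix hU (hT t ht)) (d := 1) (q := lf v) ?_ ?_ he
  · rw [htr]; simp
  · rw [htr, Polynomial.natDegree_X_add_C]

theorem nzd_quad {U : Submodule k (Vec k N)} {T : Set (M2 k N)} (hT : ∀ t ∈ T, t.1 ∈ kU U ∧ t.2 ∈ kU U)
    {q : Pol k N} (hq : q.IsHomogeneous 2) {c : Vec k N} (hU : ∀ v ∈ U, v ⬝ᵥ c = 0) (hc : eval c q ≠ 0)
    {e : M2 k N} (he : q • e ∈ Submodule.span (Pol k N) T) : e ∈ Submodule.span (Pol k N) T := by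
  obtain ⟨r, u, w, hq'⟩ := quad_decomp_top hq
  have hev : ∀ v : Vec k N, eval c (lf v) = v ⬝ᵥ c := by
    intro v; simp [lf_apply, dotProduct]
  have htr : tr c q = ∑ i, (Polynomial.C (lf (u i) * lf (w i)) + Polynomial.X *
      Polynomial.C (lf (u i) * C (w i ⬝ᵥ c) + lf (w i) * C (u i ⬝ᵥ c)) + Polynomial.X ^ 2 *
      Polynomial.C (C ((u i ⬝ᵥ c) * (w i ⬝ᵥ c)))) := by
    rw [hq', map_sum]
    refine Finset.sum_congr rfl fun i _ => ?_
    rw [map_mul, tr_lf, tr_lf]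
    simp only [map_mul, map_add]
    ring
  refine nzd_tr T c (fun t ht => ⟨tr_kU_fix hU (hT t ht).1, tr_kU_fix hU (hT t ht).2⟩) (d := 2) (q := q) ?_ ?_ he
  · have : (tr c q).coeff 2 = C (eval c q) := by
      rw [htr, Polynomial.finsetSum_coeff]
      conv_rhs => rw [hq', map_sum, map_sum]
      refine Finset.sum_congr rfl fun i _ => ?_
      rw [map_mul (MvPolynomial.eval c), hev, hev]
      rw [Polynomial.coeff_add, Polynomial.coeff_add, Polynomial.coeff_C, if_neg (by norm_num),
        Polynomial.coeff_X_mul, Polynomial.coeff_C, if_neg (by norm_num), Polynomial.coeff_X_pow_mul', if_pos le_rfl]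
      simp
    rw [this]
    exact (isUnit_iff_ne_zero.2 hc).map C
  · rw [htr]
    refine Polynomial.natDegree_sum_le_of_forall_le _ _ fun i _ => ?_
    compute_degree

theorem exists_hyper {E : Type*} [AddCommGroup E] [Module k E] [FiniteDimensional k E]
    {Z Λ : Submodule k E} (hZ : Z ≤ Λ) {v : E} (hv : v ∈ Λ) (hvZ : v ∉ Z) :
    ∃ Λ' : Submodule k E, Z ≤ Λ' ∧ Λ' ≤ Λ ∧ v ∉ Λ' ∧ Λ' ⊔ Submodule.span k {v} = Λ ∧
      Module.finrank k Λ = Module.finrank k Λ' + 1 := by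
  obtain ⟨f, hf, hW⟩ := Submodule.exists_dual_map_eq_bot_of_notMem hvZ inferInstance
  have h5 : Λ ⊓ LinearMap.ker f ⊔ Submodule.span k {v} = Λ := by
    apply le_antisymm
    · exact sup_le inf_le_left ((Submodule.span_singleton_le_iff_mem _ _).2 hv)
    · intro x hx
      refine Submodule.mem_sup.2 ⟨x - (f x * (f v)⁻¹) • v, ⟨Λ.sub_mem hx (Λ.smul_mem _ hv), ?_⟩,
        (f x * (f v)⁻¹) • v, Submodule.smul_mem _ _ (Submodule.mem_span_singleton_self v), by abel⟩
      simp [hf]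
  have h6 : v ∉ Λ ⊓ LinearMap.ker f := fun h => hf h.2
  refine ⟨Λ ⊓ LinearMap.ker f, fun z hz => ⟨hZ hz, ?_⟩, inf_le_left, h6, h5, ?_⟩
  · have : f z ∈ Z.map f := ⟨z, hz, rfl⟩
    rw [hW, Submodule.mem_bot] at this
    exact this
  · have h7 := Submodule.finrank_sup_add_finrank_inf_eq (Λ ⊓ LinearMap.ker f) (Submodule.span k {v})
    have h8 : (Λ ⊓ LinearMap.ker f) ⊓ Submodule.span k {v} = ⊥ := by
      rw [eq_bot_iff]
      rintro x ⟨hx, hx'⟩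
      obtain ⟨a, rfl⟩ := Submodule.mem_span_singleton.1 hx'
      by_cases ha : a = 0
      · simp [ha]
      · exact absurd ((Submodule.smul_mem_iff _ ha).1 hx) h6
    have hv0 : v ≠ 0 := fun h => h6 (h ▸ zero_mem _)
    rw [h5, h8, finrank_bot, finrank_span_singleton hv0, add_zero] at h7
    exact h7

theorem PD.nzd1 {R : Type u} [CommRing R] (J : Ideal R) (q : R) (hq : ∀ e, q * e ∈ J → e ∈ J) {d : ℕ}
    (h : PD R (R ⧸ J) d) : PD R (R ⧸ (J ⊔ Ideal.span {q})) (d+1) := by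
  refine (PD.nzd J q hq h).of_eq ?_
  congr 1
  ext x
  rw [Ideal.mem_span_singleton']
  simp [mul_comm]

theorem pd_span_single {R : Type u} [CommRing R] [IsDomain R] (q : R) : PD R (R ⧸ Ideal.span {q}) 1 := by
  by_cases hq : q = 0
  · subst hq
    refine (PD.of_eq (A := (⊥ : Ideal R)) ?_ (by simp))
    exact (PD.of_projective (M := R) 1).of_equiv (Submodule.quotEquivOfEqBot (⊥ : Ideal R) rfl).symm
  · refine (PD.nzd1 (⊥ : Ideal R) q ?_ (d := 0) ?_).of_eq (by simp)
    · intro e he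
      simpa [hq] using he
    · exact (PD.of_projective (M := R) 0).of_equiv (Submodule.quotEquivOfEqBot (⊥ : Ideal R) rfl).symm

/-- Lemma Add. -/
theorem pd_add {W' : Submodule k (Vec k N)} {T : Set (Pol k N)} (hT : ∀ t ∈ T, t ∈ kU W') {d : ℕ}
    (h : PD (Pol k N) (Pol k N ⧸ Ideal.span T) d) :
    ∀ (r : ℕ) (Λ : Submodule k (Vec k N)), Module.finrank k Λ = r → Disjoint Λ W' →
      PD (Pol k N) (Pol k N ⧸ (lid Λ ⊔ Ideal.span T)) (d + r) := by
  intro r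
  induction r with
  | zero =>
    intro Λ hr _
    have : Λ = ⊥ := Submodule.finrank_eq_zero.1 hr
    subst this
    exact h.of_eq (by simp)
  | succ r ih =>
    intro Λ hr hd
    obtain ⟨v, hv, hv0⟩ : ∃ v ∈ Λ, v ≠ 0 := by
      rw [← Submodule.ne_bot_iff]
      rintro rfl; simp at hr
    obtain ⟨Λ', -, hle, hv', hsup, hdim⟩ := exists_hyper (bot_le : ⊥ ≤ Λ) hv (by simpa using hv0)
    have h1 := ih Λ' (by omega) (hd.mono_left hle)
    have e : lid Λ' ⊔ Ideal.span T = Ideal.span (lf '' Λ' ∪ T) := by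
      rw [Ideal.span_union, lid]
    have h2 := PD.nzd1 _ (lf v) (fun e' he' => ?_) h1
    · refine h2.of_eq ?_
      rw [← hsup, lid_sup, lid_span, Set.image_singleton]
      exact sup_right_comm _ _ _
    · rw [e] at he' ⊢
      refine nzd_lf (U := Λ' ⊔ W') ?_ ?_ he'
      · rintro t (⟨w, hw, rfl⟩ | ht)
        · exact lf_mem_kU (Submodule.mem_sup_left hw)
        · exact kU_mono le_sup_right (hT t ht)
      · intro hvm
        obtain ⟨a, ha, w, hw, h3⟩ := Submodule.mem_sup.1 hvm
        have : w = v - a := by rw [← h3]; abel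
        have h4 : w ∈ Λ := this ▸ Λ.sub_mem hv (hle ha)
        have h5 : w = 0 := Submodule.disjoint_def.1 hd w h4 hw
        rw [h5, add_zero] at h3
        exact hv' (h3 ▸ ha)

theorem lsub_mem_kU {π : Vec k N →ₗ[k] Vec k N} (f : Pol k N) : lsub π f ∈ kU (LinearMap.range π) := by
  induction f using MvPolynomial.induction_on with
  | C a => rw [← algebraMap_eq, AlgHom.commutes]; exact Subalgebra.algebraMap_mem _ _
  | add p q hp hq => rw [map_add]; exact add_mem hp hq
  | mul_X p i hp =>
    rw [map_mul]
    refine mul_mem hp ?_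
    rw [← lf_single, lsub_lf]
    exact lf_mem_kU ⟨_, rfl⟩

theorem IsPr.disjoint {π : Vec k N →ₗ[k] Vec k N} {W : Submodule k (Vec k N)} (h : IsPr π W) :
    Disjoint W (LinearMap.range π) := by
  rw [Submodule.disjoint_def]
  rintro _ hx ⟨y, rfl⟩
  rw [← h.idem y, h.zero _ hx]

/-- Add, general form: adding a linear ideal to an arbitrary ideal, after projection. -/
theorem pd_lid_sup {π : Vec k N →ₗ[k] Vec k N} {W : Submodule k (Vec k N)} (h : IsPr π W)
    (T : Set (Pol k N)) {d : ℕ} (hT : PD (Pol k N) (Pol k N ⧸ Ideal.span (lsub π '' T)) d) :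
    PD (Pol k N) (Pol k N ⧸ (lid W ⊔ Ideal.span T)) (d + Module.finrank k W) := by
  have h1 := pd_add (W' := LinearMap.range π) (T := lsub π '' T)
    (by rintro _ ⟨t, -, rfl⟩; exact lsub_mem_kU t) hT _ W rfl h.disjoint
  refine h1.of_eq (le_antisymm (sup_le le_sup_left ?_) (sup_le le_sup_left ?_))
  · rw [Ideal.span_le]
    rintro _ ⟨t, ht, rfl⟩
    have := Ideal.sub_mem _ (Ideal.mem_sup_right (Ideal.subset_span ht) : t ∈ lid W ⊔ Ideal.span T)
      (Ideal.mem_sup_left (sub_lsub_mem h.sub t))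
    rwa [sub_sub_cancel] at this
  · rw [Ideal.span_le]
    intro t ht
    have := Ideal.add_mem _ (Ideal.mem_sup_left (sub_lsub_mem h.sub t) : _ ∈ lid W ⊔ Ideal.span (lsub π '' T))
      (Ideal.mem_sup_right (Ideal.subset_span ⟨t, ht, rfl⟩))
    rwa [sub_add_cancel] at this

theorem pd_one (W : Submodule k (Vec k N)) (f : Pol k N) :
    PD (Pol k N) (Pol k N ⧸ (lid W ⊔ Ideal.span {f})) (1 + Module.finrank k W) := by
  obtain ⟨π, hπ⟩ := exists_pr' W
  refine pd_lid_sup hπ _ ?_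
  rw [Set.image_singleton]
  exact pd_span_single _

theorem pd_pair {R : Type u} [CommRing R] [IsDomain R] [UniqueFactorizationMonoid R] (f g : R) :
    PD R (R ⧸ Ideal.span {f, g}) 2 := by
  by_cases hf : f = 0
  · subst hf
    refine ((pd_span_single g).mono (by norm_num : 1 ≤ 2)).of_eq ?_
    rw [Ideal.span_insert_zero]
  obtain ⟨a, b, c, hab, rfl, rfl⟩ := UniqueFactorizationMonoid.exists_reduced_factors f hf g
  have hc : c ≠ 0 := left_ne_zero_of_mul hf
  have e : Ideal.span {c * a, c * b} = (Ideal.span {c * a} : Ideal R) ⊔ Submodule.span R {c * b} := by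
    exact Ideal.span_insert _ _
  rw [e]
  refine cyc_right (d := 1) _ _ ?_ ((pd_span_single _).mono (by norm_num))
  refine (pd_span_single a).of_eq ?_
  ext x
  rw [Ideal.mem_span_singleton, mem_col, Ideal.mem_span_singleton, smul_eq_mul]
  rw [show x * (c * b) = c * (x * b) by ring, mul_dvd_mul_iff_left hc]
  exact ⟨fun h => h.mul_right b, fun h => hab.dvd_of_dvd_mul_right h⟩

theorem pd_two (W : Submodule k (Vec k N)) (f g : Pol k N) :
    PD (Pol k N) (Pol k N ⧸ (lid W ⊔ Ideal.span {f, g})) (2 + Module.finrank k W) := by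
  obtain ⟨π, hπ⟩ := exists_pr' W
  refine pd_lid_sup hπ _ ?_
  rw [Set.image_pair]
  exact pd_pair _ _
end field
end QPD

namespace QPD
open MvPolynomial

section field
variable {k : Type u} [Field k] {N : ℕ}

/-- pairs of linear forms. -/
abbrev VV (k : Type u) (N : ℕ) := Vec k N × Vec k N

/-- pair of linear forms as an element of the free module. -/
noncomputable def vl : VV k N →ₗ[k] M2 k N := LinearMap.prodMap lf lf

theorem vl_apply (v : VV k N) : vl v = (lf v.1, lf v.2) := rfl

/-- the submodule generated by `C`. -/
noncomputable def SC (C : Submodule k (VV k N)) : Submodule (Pol k N) (M2 k N) :=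
  Submodule.span (Pol k N) (vl '' (C : Set (VV k N)))

theorem vl_mem_SC {C : Submodule k (VV k N)} {v : VV k N} (h : v ∈ C) : vl v ∈ SC C :=
  Submodule.subset_span ⟨v, h, rfl⟩

theorem SC_mono {C C' : Submodule k (VV k N)} (h : C ≤ C') : SC C ≤ SC C' :=
  Submodule.span_mono (Set.image_mono h)

theorem SC_sup (C C' : Submodule k (VV k N)) : SC (C ⊔ C') = SC C ⊔ SC C' := by
  apply le_antisymm
  · refine Submodule.span_le.2 ?_
    rintro _ ⟨v, hv, rfl⟩
    obtain ⟨a, ha, b, hb, rfl⟩ := Submodule.mem_sup.1 hv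
    rw [map_add]
    exact Submodule.add_mem_sup (vl_mem_SC ha) (vl_mem_SC hb)
  · exact sup_le (SC_mono le_sup_left) (SC_mono le_sup_right)

theorem smul_vl (a : k) (v : VV k N) : vl (a • v) = (C a : Pol k N) • vl v := by
  rw [map_smul]
  ext <;> simp [MvPolynomial.smul_eq_C_mul]

theorem SC_span (T : Set (VV k N)) : SC (Submodule.span k T) = Submodule.span (Pol k N) (vl '' T) := by
  apply le_antisymm
  · refine Submodule.span_le.2 ?_
    rintro _ ⟨v, hv, rfl⟩
    induction hv using Submodule.span_induction with
    | mem x h => exact Submodule.subset_span ⟨x, h, rfl⟩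
    | zero => rw [map_zero]; exact Submodule.zero_mem _
    | add x y _ _ hx hy => rw [map_add]; exact Submodule.add_mem _ hx hy
    | smul a x _ hx => rw [smul_vl]; exact Submodule.smul_mem _ _ hx
  · exact Submodule.span_mono (Set.image_mono Submodule.subset_span)

/-- linear coefficients. -/
noncomputable def lc : M2 k N →ₗ[k] VV k N where
  toFun m := (fun i => coeff (Finsupp.single i 1) m.1, fun i => coeff (Finsupp.single i 1) m.2)
  map_add' x y := by ext <;> simp
  map_smul' x y := by ext <;> simp

theorem coeff_mul_lf (r : Pol k N) (a : Vec k N) (i : Fin N) :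
    coeff (Finsupp.single i 1) (r * lf a) = coeff 0 r * a i := by
  have : ∀ v : Vec k N, lf v = ∑ j, X j * C (v j) := by
    intro v; rw [lf_apply]; exact Finset.sum_congr rfl fun j _ => by first | rfl | (rw [mul_comm]) | (rw [MvPolynomial.smul_eq_C_mul, mul_comm])
  rw [this, Finset.mul_sum, coeff_sum]
  rw [Finset.sum_eq_single i]
  · rw [← mul_assoc, mul_comm _ (C _), coeff_C_mul, coeff_mul_X', if_pos (by simp), tsub_self, mul_comm]
  · intro j _ hj
    rw [← mul_assoc, mul_comm _ (C _), coeff_C_mul, coeff_mul_X', if_neg, mul_zero]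
    simp [hj]
  · simp

theorem lc_smul_vl (r : Pol k N) (v : VV k N) : lc (r • vl v) = coeff 0 r • v := by
  ext i
  · exact coeff_mul_lf r v.1 i
  · exact coeff_mul_lf r v.2 i

theorem vl_mem_SC_iff {C : Submodule k (VV k N)} {v : VV k N} : vl v ∈ SC C ↔ v ∈ C := by
  refine ⟨fun h => ?_, vl_mem_SC⟩
  have key : ∀ m ∈ SC C, ∀ a : Pol k N, lc (a • m) ∈ C := by
    intro m hm
    induction hm using Submodule.span_induction with
    | mem x h =>
      obtain ⟨v, hv, rfl⟩ := h
      intro a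
      rw [lc_smul_vl]; exact C.smul_mem _ hv
    | zero => intro a; rw [smul_zero, map_zero]; exact Submodule.zero_mem _
    | add x y _ _ hx hy => intro a; rw [smul_add, map_add]; exact Submodule.add_mem _ (hx a) (hy a)
    | smul b x _ hx => intro a; rw [smul_smul]; exact hx _
  have h1 := key _ h 1
  rw [lc_smul_vl] at h1
  simpa using h1

/-- minors. -/
noncomputable def mn (u v : VV k N) : Pol k N := lf u.1 * lf v.2 - lf u.2 * lf v.1

/-- ideal of minors. -/
noncomputable def I2 (C : Submodule k (VV k N)) : Ideal (Pol k N) :=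
  Ideal.span {f | ∃ u ∈ C, ∃ v ∈ C, f = mn u v}

theorem mn_mem {C : Submodule k (VV k N)} {u v : VV k N} (hu : u ∈ C) (hv : v ∈ C) : mn u v ∈ I2 C :=
  Ideal.subset_span ⟨u, hu, v, hv, rfl⟩

theorem mn_homog (u v : VV k N) : (mn u v).IsHomogeneous 2 :=
  ((lf_homog _).mul (lf_homog _)).sub ((lf_homog _).mul (lf_homog _))

theorem I2_mono {C C' : Submodule k (VV k N)} (h : C ≤ C') : I2 C ≤ I2 C' :=
  Ideal.span_mono fun _ ⟨u, hu, v, hv, e⟩ => ⟨u, h hu, v, h hv, e⟩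

/-- `x₂v₁-x₁v₂`. -/
def ph (x : k × k) : VV k N →ₗ[k] Vec k N :=
  x.2 • LinearMap.fst k _ _ - x.1 • LinearMap.snd k _ _

theorem ph_apply (x : k × k) (v : VV k N) : ph x v = x.2 • v.1 - x.1 • v.2 := rfl

/-- `w ↦ wX`. -/
def em (x : k × k) : Vec k N →ₗ[k] VV k N :=
  LinearMap.prod (x.1 • LinearMap.id) (x.2 • LinearMap.id)

theorem em_apply (x : k × k) (w : Vec k N) : em x w = (x.1 • w, x.2 • w) := rfl

/-- as `ph` on the free module. -/
noncomputable def Ph (x : k × k) : M2 k N →ₗ[Pol k N] Pol k N :=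
  (C x.2 : Pol k N) • LinearMap.fst (Pol k N) _ _ - (C x.1 : Pol k N) • LinearMap.snd (Pol k N) _ _

theorem Ph_apply (x : k × k) (v : M2 k N) : Ph x v = C x.2 * v.1 - C x.1 * v.2 := rfl

/-- as `em` on the free module. -/
noncomputable def Em (x : k × k) : Pol k N →ₗ[Pol k N] M2 k N :=
  LinearMap.prod ((C x.1 : Pol k N) • LinearMap.id) ((C x.2 : Pol k N) • LinearMap.id)

theorem Em_apply (x : k × k) (f : Pol k N) : Em x f = (C x.1 * f, C x.2 * f) := rfl

theorem lf_smul (a : k) (v : Vec k N) : lf (a • v) = (C a : Pol k N) * lf v := by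
  rw [map_smul, MvPolynomial.smul_eq_C_mul]

theorem Ph_vl (x : k × k) (v : VV k N) : Ph x (vl v) = lf (ph x v) := by
  rw [Ph_apply, ph_apply, map_sub, lf_smul, lf_smul]; rfl

theorem vl_em (x : k × k) (w : Vec k N) : vl (em x w) = Em x (lf w) := by
  rw [Em_apply, em_apply, vl_apply, lf_smul, lf_smul]

theorem Ph_Em (x : k × k) (f : Pol k N) : Ph x (Em x f) = 0 := by
  rw [Ph_apply, Em_apply]; ring

theorem ph_em (x : k × k) (w : Vec k N) : ph x (em x w) = 0 := by
  rw [ph_apply, em_apply]; simp only [smul_smul]; rw [mul_comm, sub_self]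

/-- determinant. -/
def dt (x y : k × k) : k := x.1 * y.2 - x.2 * y.1

theorem exists_dt {x : k × k} (hx : x ≠ 0) : ∃ y, dt x y = 1 := by
  by_cases h : x.1 = 0
  · have h2 : x.2 ≠ 0 := fun h2 => hx (Prod.ext h h2)
    exact ⟨(-(x.2)⁻¹, 0), by simp [dt, h2]⟩
  · exact ⟨(0, (x.1)⁻¹), by simp [dt, h]⟩

theorem Ph_Em' (x y : k × k) (f : Pol k N) : Ph x (Em y f) = C (-dt x y) * f := by
  rw [Ph_apply, Em_apply, dt]; simp only [map_neg, map_sub, map_mul]; ring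

theorem ph_em' (x y : k × k) (f : Vec k N) : ph x (em y f) = -dt x y • f := by
  rw [ph_apply, em_apply, dt]; simp only [smul_smul, ← sub_smul]; congr 1; ring

theorem M2_decomp {x y : k × k} (h : dt x y = 1) (m : M2 k N) : m = Em x (Ph y m) - Em y (Ph x m) := by
  have h' : (C x.1 * C y.2 - C x.2 * C y.1 : Pol k N) = 1 := by
    rw [← map_mul, ← map_mul, ← map_sub]; rw [dt] at h; rw [h, map_one]
  ext1
  · simp only [Em_apply, Ph_apply, Prod.fst_sub]; linear_combination (-m.1) * h'
  · simp only [Em_apply, Ph_apply, Prod.snd_sub]; linear_combination (-m.2) * h'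

theorem VV_decomp {x y : k × k} (h : dt x y = 1) (m : VV k N) : m = em x (ph y m) - em y (ph x m) := by
  rw [dt] at h
  ext i
  · simp only [em_apply, ph_apply, Prod.fst_sub, Pi.sub_apply, Pi.smul_apply, smul_eq_mul]; linear_combination (-m.1 i) * h
  · simp only [em_apply, ph_apply, Prod.snd_sub, Pi.sub_apply, Pi.smul_apply, smul_eq_mul]; linear_combination (-m.2 i) * h

theorem Em_inj {x : k × k} (hx : x ≠ 0) : Function.Injective (Em x : Pol k N → M2 k N) := by
  obtain ⟨y, hy⟩ := exists_dt hx
  intro a b hab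
  have := congrArg (Ph y) hab
  rw [Ph_Em', Ph_Em'] at this
  have e : dt y x = -1 := by rw [← hy, dt, dt]; ring
  rw [e] at this; simpa using this

theorem em_inj {x : k × k} (hx : x ≠ 0) : Function.Injective (em x : Vec k N → VV k N) := by
  obtain ⟨y, hy⟩ := exists_dt hx
  intro a b hab
  have := congrArg (ph y) hab
  rw [ph_em', ph_em'] at this
  have e : dt y x = -1 := by rw [← hy, dt, dt]; ring
  rw [e] at this; simpa using this

theorem ker_ph {x : k × k} (hx : x ≠ 0) {v : VV k N} (h : ph x v = 0) : ∃ w, v = em x w := by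
  obtain ⟨y, hy⟩ := exists_dt hx
  refine ⟨ph y v, ?_⟩
  conv_lhs => rw [VV_decomp hy v, h]
  simp

theorem ker_Ph {x : k × k} (hx : x ≠ 0) {v : M2 k N} (h : Ph x v = 0) : ∃ w, v = Em x w := by
  obtain ⟨y, hy⟩ := exists_dt hx
  refine ⟨Ph y v, ?_⟩
  conv_lhs => rw [M2_decomp hy v, h]
  simp

/-- minors identity. -/
theorem minor_id (x : k × k) (u v : VV k N) :
    lf (ph x u) • vl v - lf (ph x v) • vl u = Em x (mn u v) := by
  simp only [← Ph_vl, Ph_apply, Em_apply, mn, vl_apply]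
  ext1
  · simp only [Prod.fst_sub, Prod.smul_fst, smul_eq_mul]; ring
  · simp only [Prod.snd_sub, Prod.smul_snd, smul_eq_mul]; ring

theorem cramer (u v : VV k N) (m : M2 k N) :
    mn u v • m = (m.1 * lf v.2 - m.2 * lf v.1) • vl u + (lf u.1 * m.2 - lf u.2 * m.1) • vl v := by
  ext1
  · simp only [mn, vl_apply, Prod.fst_add, Prod.smul_fst, smul_eq_mul]; ring
  · simp only [mn, vl_apply, Prod.snd_add, Prod.smul_snd, smul_eq_mul]; ring

theorem I2_smul {C : Submodule k (VV k N)} {f : Pol k N} (hf : f ∈ I2 C) (m : M2 k N) : f • m ∈ SC C := by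
  induction hf using Submodule.span_induction with
  | mem x h =>
    obtain ⟨u, hu, v, hv, rfl⟩ := h
    rw [cramer]
    exact add_mem (Submodule.smul_mem _ _ (vl_mem_SC hu)) (Submodule.smul_mem _ _ (vl_mem_SC hv))
  | zero => rw [zero_smul]; exact zero_mem _
  | add x y _ _ hx hy => rw [add_smul]; exact add_mem hx hy
  | smul a x _ hx => rw [smul_assoc]; exact Submodule.smul_mem _ _ hx

/-- image. -/
def Lam (x : k × k) (C : Submodule k (VV k N)) : Submodule k (Vec k N) := C.map (ph x)
/-- fibre. -/
def Dd (x : k × k) (C : Submodule k (VV k N)) : Submodule k (Vec k N) := C.comap (em x)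
/-- the maximal `Z` with `Z × Z ⊆ C`. -/
def Zm (C : Submodule k (VV k N)) : Submodule k (Vec k N) := Dd (1, 0) C ⊓ Dd (0, 1) C
/-- the space of entries. -/
def Len (C : Submodule k (VV k N)) : Submodule k (Vec k N) := C.map (LinearMap.fst k _ _) ⊔ C.map (LinearMap.snd k _ _)

theorem mem_Dd {x : k × k} {C : Submodule k (VV k N)} {w} : w ∈ Dd x C ↔ em x w ∈ C := Iff.rfl

theorem mem_Zm {C : Submodule k (VV k N)} {w} : w ∈ Zm C ↔ (w, 0) ∈ C ∧ (0, w) ∈ C := by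
  simp [Zm, mem_Dd, em_apply]

theorem Zm_em {C : Submodule k (VV k N)} {w} (h : w ∈ Zm C) (x) : em x w ∈ C := by
  obtain ⟨h1, h2⟩ := mem_Zm.1 h
  have := C.add_mem (C.smul_mem x.1 h1) (C.smul_mem x.2 h2)
  simpa [em_apply] using this

theorem Zm_le_Dd (C : Submodule k (VV k N)) (x) : Zm C ≤ Dd x C := fun _ h => Zm_em h x

theorem mem_Zm_of {C : Submodule k (VV k N)} {w} {x y : k × k} (h : dt x y ≠ 0) (hx : em x w ∈ C) (hy : em y w ∈ C) :
    w ∈ Zm C := by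
  rw [mem_Zm]
  have e1 : (w, 0) = (dt x y)⁻¹ • (y.2 • em x w - x.2 • em y w) := by
    ext i <;> simp only [em_apply, Prod.fst_sub, Prod.snd_sub, Prod.smul_fst, Prod.smul_snd, Pi.sub_apply, Pi.smul_apply, smul_eq_mul, Pi.zero_apply]
    · field_simp; rw [dt]; ring
    · field_simp; ring
  have e2 : (0, w) = (dt x y)⁻¹ • (x.1 • em y w - y.1 • em x w) := by
    ext i <;> simp only [em_apply, Prod.fst_sub, Prod.snd_sub, Prod.smul_fst, Prod.smul_snd, Pi.sub_apply, Pi.smul_apply, smul_eq_mul, Pi.zero_apply]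
    · field_simp; ring
    · field_simp; rw [dt]; ring
  rw [e1, e2]
  exact ⟨C.smul_mem _ (C.sub_mem (C.smul_mem _ hx) (C.smul_mem _ hy)),
    C.smul_mem _ (C.sub_mem (C.smul_mem _ hy) (C.smul_mem _ hx))⟩

theorem ph_mem_Lam {x : k × k} {C : Submodule k (VV k N)} {v} (h : v ∈ C) : ph x v ∈ Lam x C := ⟨v, h, rfl⟩

theorem Zm_le_Lam {x : k × k} (hx : x ≠ 0) (C : Submodule k (VV k N)) : Zm C ≤ Lam x C := by
  intro w hw
  obtain ⟨y, hy⟩ := exists_dt hx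
  refine ⟨-em y w, C.neg_mem (Zm_em hw y), ?_⟩
  rw [map_neg, ph_em', hy]; simp

theorem Lam_le_Len (x : k × k) (C : Submodule k (VV k N)) : Lam x C ≤ Len C := by
  rintro _ ⟨v, hv, rfl⟩
  rw [ph_apply]
  exact sub_mem (Submodule.smul_mem _ _ (Submodule.mem_sup_left ⟨v, hv, rfl⟩))
    (Submodule.smul_mem _ _ (Submodule.mem_sup_right ⟨v, hv, rfl⟩))

theorem Len_eq {x y : k × k} (h : dt x y = 1) (C : Submodule k (VV k N)) : Len C = Lam x C ⊔ Lam y C := by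
  apply le_antisymm
  · refine sup_le ?_ ?_ <;> rintro _ ⟨v, hv, rfl⟩
    · have := congrArg Prod.fst (VV_decomp h v)
      change v.1 ∈ _
      rw [this]
      exact sub_mem (Submodule.smul_mem _ _ (Submodule.mem_sup_right ⟨v, hv, rfl⟩))
        (Submodule.smul_mem _ _ (Submodule.mem_sup_left ⟨v, hv, rfl⟩))
    · have := congrArg Prod.snd (VV_decomp h v)
      change v.2 ∈ _
      rw [this]
      exact sub_mem (Submodule.smul_mem _ _ (Submodule.mem_sup_right ⟨v, hv, rfl⟩))
        (Submodule.smul_mem _ _ (Submodule.mem_sup_left ⟨v, hv, rfl⟩))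
  · exact sup_le (Lam_le_Len _ _) (Lam_le_Len _ _)

theorem finrank_Lam {x : k × k} (hx : x ≠ 0) (C : Submodule k (VV k N)) :
    Module.finrank k (Lam x C) + Module.finrank k (Dd x C) = Module.finrank k C := by
  have h := LinearMap.finrank_range_add_finrank_ker ((ph x).domRestrict C)
  rw [LinearMap.range_domRestrict] at h
  rw [← h, Lam]
  congr 1
  have e : (LinearMap.ker ((ph x).domRestrict C)).map C.subtype = (Dd x C).map (em x) := by
    ext v
    simp only [Submodule.mem_map, LinearMap.mem_ker, LinearMap.domRestrict_apply, Submodule.subtype_apply]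
    constructor
    · rintro ⟨⟨v, hv⟩, h, rfl⟩
      obtain ⟨w, rfl⟩ := ker_ph hx h
      exact ⟨w, hv, rfl⟩
    · rintro ⟨w, hw, rfl⟩
      exact ⟨⟨_, hw⟩, ph_em _ _, rfl⟩
  rw [(Submodule.equivMapOfInjective (em x) (em_inj hx) (Dd x C)).finrank_eq, ← e,
    Submodule.finrank_map_subtype_eq]
end field
end QPD

namespace QPD
open MvPolynomial

section field
variable {k : Type u} [Field k] {N : ℕ}

theorem map_SC (x : k × k) (C : Submodule k (VV k N)) : (SC C).map (Ph x) = lid (Lam x C) := by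
  rw [SC, Submodule.map_span, ← Set.image_comp]
  change _ = Ideal.span _
  congr 1
  ext f
  simp only [Set.mem_image, Function.comp, Ph_vl, Lam, SetLike.mem_coe, Submodule.mem_map]
  constructor
  · rintro ⟨v, hv, rfl⟩; exact ⟨_, ⟨v, hv, rfl⟩, rfl⟩
  · rintro ⟨_, ⟨v, hv, rfl⟩, rfl⟩; exact ⟨v, hv, rfl⟩

theorem Ph_SC {x : k × k} {C : Submodule k (VV k N)} {m : M2 k N} (h : m ∈ SC C) : Ph x m ∈ lid (Lam x C) := by
  rw [← map_SC]; exact ⟨m, h, rfl⟩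

theorem exists_Ph {x : k × k} {C : Submodule k (VV k N)} {f : Pol k N} (h : f ∈ lid (Lam x C)) :
    ∃ m ∈ SC C, Ph x m = f := by
  rw [← map_SC] at h; exact h

theorem I2_le_Lam {x : k × k} (hx : x ≠ 0) (C : Submodule k (VV k N)) : I2 C ≤ lid (Lam x C) := by
  refine Ideal.span_le.2 ?_
  rintro _ ⟨u, hu, v, hv, rfl⟩
  obtain ⟨y, hy⟩ := exists_dt hx
  have := congrArg (Ph y) (minor_id x u v)
  rw [Ph_Em', show dt y x = -1 by rw [← hy, dt, dt]; ring, neg_neg, map_one, one_mul] at this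
  rw [SetLike.mem_coe, ← this, map_sub, map_smul, map_smul]
  exact sub_mem (Ideal.mul_mem_right _ _ (lf_mem_lid (ph_mem_Lam hu)))
    (Ideal.mul_mem_right _ _ (lf_mem_lid (ph_mem_Lam hv)))

theorem koszul (x : k × k) (C : Submodule k (VV k N)) : ∀ (r : ℕ) (c : Fin r → VV k N)
    (_ : LinearIndependent k fun i => ph x (c i)) (_ : ∀ i, c i ∈ C) (g : Fin r → Pol k N),
    ∑ i, g i * lf (ph x (c i)) = 0 → ∃ f ∈ I2 C, ∑ i, g i • vl (c i) = Em x f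
  | 0, c, _, _, g, _ => ⟨0, zero_mem _, by simp⟩
  | r+1, c, hli, hc, g, hg => by
    rw [Fin.sum_univ_castSucc] at hg
    have hli' : LinearIndependent k fun i : Fin r => ph x (c i.castSucc) :=
      hli.comp _ (Fin.castSucc_injective r)
    have hnot : ph x (c (Fin.last r)) ∉ Submodule.span k (Set.range fun i : Fin r => ph x (c i.castSucc)) := by
      have := hli.notMem_span_image (s := Set.range (Fin.castSucc : Fin r → Fin (r+1))) (x := Fin.last r)
        (by rintro ⟨i, hi⟩; exact absurd hi (Fin.castSucc_lt_last i).ne)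
      rwa [← Set.range_comp] at this
    have hmem : ∀ i : Fin r, lf (ph x (c i.castSucc)) ∈ lid (Submodule.span k (Set.range fun i : Fin r => ph x (c i.castSucc))) :=
      fun i => lf_mem_lid (Submodule.subset_span ⟨i, rfl⟩)
    have h1 : g (Fin.last r) * lf (ph x (c (Fin.last r))) ∈ lid (Submodule.span k (Set.range fun i : Fin r => ph x (c i.castSucc))) := by
      rw [← neg_eq_iff_add_eq_zero] at hg
      rw [← hg]
      exact neg_mem (sum_mem fun i _ => Ideal.mul_mem_left _ _ (hmem i))
    have h2 := ((lid_prime _).mem_or_mem h1).resolve_right (fun h => hnot (lf_mem_lid_iff.1 h))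
    rw [lid_span, ← Set.range_comp] at h2
    obtain ⟨a, ha⟩ := Ideal.mem_span_range_iff_exists_fun.1 h2
    simp only [Function.comp] at ha
    obtain ⟨f, hf, e⟩ := koszul x C r (fun i => c i.castSucc) hli' (fun i => hc _)
      (fun i => g i.castSucc + a i * lf (ph x (c (Fin.last r)))) (by
        refine Eq.trans ?_ hg
        rw [← ha, Finset.sum_mul, ← Finset.sum_add_distrib]
        exact Finset.sum_congr rfl fun i _ => by ring)
    refine ⟨f + ∑ i, a i * mn (c i.castSucc) (c (Fin.last r)), add_mem hf
      (sum_mem fun i _ => Ideal.mul_mem_left _ _ (mn_mem (hc _) (hc _))), ?_⟩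
    rw [map_add, ← e, map_sum, Fin.sum_univ_castSucc, ← ha, Finset.sum_smul, ← Finset.sum_add_distrib, ← Finset.sum_add_distrib]
    refine Finset.sum_congr rfl fun i _ => ?_
    rw [show Em x (a i * mn (c i.castSucc) (c (Fin.last r))) = a i • Em x (mn (c i.castSucc) (c (Fin.last r))) by
      rw [← smul_eq_mul, map_smul], ← minor_id, add_smul, smul_sub, smul_smul, smul_smul]
    abel

theorem lid_smul {C : Submodule k (VV k N)} {f : Pol k N} (hf : f ∈ lid (Zm C)) (m : M2 k N) : f • m ∈ SC C := by
  induction hf using Submodule.span_induction with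
  | mem y h =>
    obtain ⟨w, hw, rfl⟩ := h
    have h1 := vl_mem_SC (mem_Zm.1 hw).1
    have h2 := vl_mem_SC (mem_Zm.1 hw).2
    have : lf w • m = m.1 • vl (w, 0) + m.2 • vl (0, w) := by
      ext1 <;> simp [vl_apply, mul_comm]
    rw [this]
    exact add_mem (Submodule.smul_mem _ _ h1) (Submodule.smul_mem _ _ h2)
  | zero => rw [zero_smul]; exact zero_mem _
  | add x y _ _ hx hy => rw [add_smul]; exact add_mem hx hy
  | smul a x _ hx => rw [smul_assoc]; exact Submodule.smul_mem _ _ hx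

theorem Em_lid {x : k × k} {C : Submodule k (VV k N)} {f : Pol k N} (hf : f ∈ lid (Dd x C)) : Em x f ∈ SC C := by
  induction hf using Submodule.span_induction with
  | mem y h =>
    obtain ⟨w, hw, rfl⟩ := h
    rw [← vl_em]; exact vl_mem_SC hw
  | zero => rw [map_zero]; exact zero_mem _
  | add x y _ _ hx hy => rw [map_add]; exact add_mem hx hy
  | smul a y _ hx => rw [map_smul]; exact Submodule.smul_mem _ _ hx

theorem Em_eq_smul (x : k × k) (f : Pol k N) : Em x f = f • Em x 1 := by
  rw [← map_smul, smul_eq_mul, mul_one]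

/-- adapted decomposition. -/
theorem adapted {x : k × k} (hx : x ≠ 0) (C : Submodule k (VV k N)) : ∃ c : Fin (Module.finrank k (Lam x C)) → VV k N,
    (∀ i, c i ∈ C) ∧ LinearIndependent k (fun i => ph x (c i)) ∧
    Submodule.span k (Set.range fun i => ph x (c i)) = Lam x C ∧
    (Dd x C).map (em x) ⊔ Submodule.span k (Set.range c) = C := by
  let b := Module.finBasis k (Lam x C)
  have : ∀ i, ∃ c ∈ C, ph x c = b i := fun i => (b i).2
  choose c hc hcb using this
  have e : (fun i => ph x (c i)) = fun i => ((b i : Lam x C) : Vec k N) := funext hcb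
  have hsp : Submodule.span k (Set.range fun i => ph x (c i)) = Lam x C := by
    rw [e]
    have := b.span_eq
    apply_fun Submodule.map (Lam x C).subtype at this
    rw [Submodule.map_span, ← Set.range_comp] at this
    simp only [Submodule.map_top, Submodule.range_subtype] at this
    exact this
  refine ⟨c, hc, ?_, hsp, ?_⟩
  · rw [e]
    exact b.linearIndependent.map' (Lam x C).subtype (Submodule.ker_subtype _)
  · apply le_antisymm
    · refine sup_le ?_ (Submodule.span_le.2 ?_)
      · rintro _ ⟨w, hw, rfl⟩; exact hw
      · rintro _ ⟨i, rfl⟩; exact hc i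
    · intro v hv
      have h1 : ph x v ∈ (Submodule.span k (Set.range c)).map (ph x) := by
        rw [Submodule.map_span, ← Set.range_comp]
        change _ ∈ Submodule.span k (Set.range fun i => ph x (c i))
        rw [hsp]; exact ph_mem_Lam hv
      obtain ⟨u, hu, huv⟩ := h1
      have hu' : u ∈ C := (Submodule.span_le.2 (by rintro _ ⟨i, rfl⟩; exact hc i)) hu
      obtain ⟨w, hw⟩ := ker_ph hx (v := v - u) (by rw [map_sub, huv, sub_self])
      have : v = em x w + u := by rw [← hw]; simp
      rw [this]
      refine Submodule.add_mem_sup ⟨w, ?_, rfl⟩ hu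
      rw [SetLike.mem_coe, mem_Dd, ← hw]; exact C.sub_mem hv hu'

theorem Kp {x : k × k} (hx : x ≠ 0) {C : Submodule k (VV k N)} {f : Pol k N} :
    Em x f ∈ SC C ↔ f ∈ I2 C ⊔ lid (Dd x C) := by
  constructor
  · intro h
    obtain ⟨c, hc, hli, -, hsup⟩ := adapted hx C
    have h0 := h
    rw [← hsup, SC_sup, SC_span, ← Set.range_comp] at h
    obtain ⟨a, ha, b, hb, hab⟩ := Submodule.mem_sup.1 h
    obtain ⟨g, rfl⟩ := (Submodule.mem_span_range_iff_exists_fun _).1 hb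
    have ha' : ∃ f' ∈ lid (Dd x C), a = Em x f' := by
      clear hab
      rw [SC] at ha
      induction ha using Submodule.span_induction with
      | mem y h =>
        obtain ⟨_, ⟨w, hw, rfl⟩, rfl⟩ := h
        exact ⟨_, lf_mem_lid hw, vl_em _ _⟩
      | zero => exact ⟨0, zero_mem _, by simp⟩
      | add y z _ _ hx hy =>
        obtain ⟨f1, h1, rfl⟩ := hx
        obtain ⟨f2, h2, rfl⟩ := hy
        exact ⟨_, add_mem h1 h2, (map_add _ _ _).symm⟩
      | smul a y _ hx =>
        obtain ⟨f1, h1, rfl⟩ := hx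
        exact ⟨_, Submodule.smul_mem _ a h1, (map_smul _ _ _).symm⟩
    obtain ⟨f', hf', rfl⟩ := ha'
    have hP := congrArg (Ph x) hab
    rw [map_add, Ph_Em, Ph_Em, zero_add, map_sum] at hP
    simp only [map_smul, smul_eq_mul, Function.comp, Ph_vl] at hP
    obtain ⟨f2, hf2, e2⟩ := koszul x C _ c hli hc g hP
    simp only [Function.comp] at hab
    rw [e2, ← map_add] at hab
    rw [← Em_inj hx hab, add_comm]
    exact Submodule.add_mem_sup hf2 hf'
  · intro h
    obtain ⟨a, ha, b, hb, rfl⟩ := Submodule.mem_sup.1 h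
    rw [map_add]
    refine add_mem ?_ (Em_lid hb)
    rw [Em_eq_smul]; exact I2_smul ha _

theorem Ph_surj {x : k × k} (hx : x ≠ 0) : Function.Surjective (Ph x : M2 k N → Pol k N) := by
  obtain ⟨y, hy⟩ := exists_dt hx
  intro f
  exact ⟨Em y (-f), by rw [Ph_Em', hy]; simp⟩

theorem pd_comap {x : k × k} (hx : x ≠ 0) (J : Ideal (Pol k N)) {d : ℕ} (h : PD (Pol k N) (Pol k N ⧸ J) d) :
    PD (Pol k N) (M2 k N ⧸ (Submodule.comap (Ph x) J)) d := by
  have hs : Function.Surjective ((Submodule.mkQ J).comp (Ph x : M2 k N →ₗ[Pol k N] Pol k N)) :=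
    (Submodule.mkQ_surjective J).comp (Ph_surj hx)
  refine (h.of_equiv (LinearMap.quotKerEquivOfSurjective _ hs).symm).of_eq ?_
  rw [LinearMap.ker_comp, Submodule.ker_mkQ]

theorem mem_sup_Em {x : k × k} (hx : x ≠ 0) {A : Submodule (Pol k N) (M2 k N)} {m : M2 k N} :
    m ∈ A ⊔ Submodule.span (Pol k N) {Em x 1} ↔ Ph x m ∈ A.map (Ph x) := by
  constructor
  · intro h
    obtain ⟨a, ha, b, hb, rfl⟩ := Submodule.mem_sup.1 h
    obtain ⟨c, rfl⟩ := Submodule.mem_span_singleton.1 hb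
    exact ⟨a, ha, by rw [← Em_eq_smul, map_add, Ph_Em, add_zero]⟩
  · rintro ⟨a, ha, h⟩
    obtain ⟨w, hw⟩ := ker_Ph hx (v := m - a) (by rw [map_sub, h, sub_self])
    have : m = a + w • Em x 1 := by rw [← Em_eq_smul, ← hw]; simp
    rw [this]
    exact Submodule.add_mem_sup ha (Submodule.mem_span_singleton.2 ⟨w, rfl⟩)

theorem sup_Em {x : k × k} (hx : x ≠ 0) (A : Submodule (Pol k N) (M2 k N)) :
    A ⊔ Submodule.span (Pol k N) {Em x 1} = Submodule.comap (Ph x) (A.map (Ph x)) := by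
  ext m; exact mem_sup_Em hx

theorem pd_SCX {x : k × k} (hx : x ≠ 0) (C : Submodule k (VV k N)) :
    PD (Pol k N) (M2 k N ⧸ (SC C ⊔ Submodule.span (Pol k N) {Em x 1})) (Module.finrank k (Lam x C)) := by
  rw [sup_Em hx, map_SC]
  exact pd_comap hx _ (pd_lid _)

theorem lf_mem_kU' {U : Submodule k (Vec k N)} {v} (h : v ∈ U) : lf v ∈ kU U := lf_mem_kU h

theorem pd_Len (C : Submodule k (VV k N)) : PD (Pol k N) (M2 k N ⧸ SC C) (Module.finrank k (Len C)) := by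
  refine var2 (Len C) _ ?_
  rintro _ ⟨v, hv, rfl⟩
  exact ⟨lf_mem_kU (Submodule.mem_sup_left ⟨v, hv, rfl⟩), lf_mem_kU (Submodule.mem_sup_right ⟨v, hv, rfl⟩)⟩

theorem finrank_sup_map {C : Submodule k (VV k N)} (Λ : Submodule k (Vec k N)) (f : VV k N →ₗ[k] Vec k N) :
    Module.finrank k (Λ ⊔ C.map f : Submodule k (Vec k N)) + Module.finrank k (C ⊓ Λ.comap f : Submodule k (VV k N)) =
      Module.finrank k Λ + Module.finrank k C := by
  have h := LinearMap.finrank_range_add_finrank_ker ((Λ.mkQ.comp f).domRestrict C)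
  have h1 : LinearMap.range ((Λ.mkQ.comp f).domRestrict C) = (Λ ⊔ C.map f).map Λ.mkQ := by
    rw [LinearMap.range_domRestrict, Submodule.map_sup, Submodule.map_comp]
    simp
  have h2 : (LinearMap.ker ((Λ.mkQ.comp f).domRestrict C)).map C.subtype = C ⊓ Λ.comap f := by
    ext v
    simp [and_comm]
  have h3 : Module.finrank k ((Λ ⊔ C.map f).map Λ.mkQ) + Module.finrank k Λ = Module.finrank k (Λ ⊔ C.map f : Submodule k (Vec k N)) := by
    have := LinearMap.finrank_range_add_finrank_ker (Λ.mkQ.domRestrict (Λ ⊔ C.map f))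
    rw [LinearMap.range_domRestrict] at this
    rw [← this]
    congr 1
    rw [← Submodule.finrank_map_subtype_eq]
    suffices e : Λ = Submodule.map (Λ ⊔ Submodule.map f C).subtype (LinearMap.ker (Λ.mkQ.domRestrict (Λ ⊔ Submodule.map f C))) from
      congrArg (fun W : Submodule k (Vec k N) => Module.finrank k W) e
    ext v
    simp only [Submodule.mem_map, LinearMap.mem_ker, LinearMap.domRestrict_apply, Submodule.mkQ_apply, Submodule.Quotient.mk_eq_zero, Submodule.subtype_apply]
    constructor
    · intro h
      exact ⟨⟨v, Submodule.mem_sup_left h⟩, h, rfl⟩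
    · rintro ⟨⟨v, hv⟩, h, rfl⟩
      exact h
  rw [h1] at h
  rw [← h2, Submodule.finrank_map_subtype_eq]
  omega
end field
end QPD

namespace QPD
open MvPolynomial

section field
variable {k : Type u} [Field k] {N : ℕ}

/-- no special points. -/
def NoSp (C : Submodule k (VV k N)) : Prop := ∀ x : k × k, x ≠ 0 → Dd x C ≤ Zm C

/-- the vector `a + τ b`. -/
noncomputable def gen : VV k N →+ (Fin N → Polynomial k) where
  toFun v := fun i => Polynomial.C (v.1 i) + Polynomial.X * Polynomial.C (v.2 i)
  map_zero' := by ext1 i; simp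
  map_add' x y := by ext1 i; simp; ring

theorem gen_apply (v : VV k N) (i) : gen v i = Polynomial.C (v.1 i) + Polynomial.X * Polynomial.C (v.2 i) := rfl

theorem gen_smul (a : k) (v : VV k N) : gen (a • v) = (Polynomial.C a : Polynomial k) • gen v := by
  ext1 i; simp [gen_apply]; ring

/-- the `k[τ]`-module generated. -/
noncomputable def WW (C : Submodule k (VV k N)) : Submodule (Polynomial k) (Fin N → Polynomial k) :=
  Submodule.span _ (gen '' (C : Set (VV k N)))

theorem gen_mem {C : Submodule k (VV k N)} {v} (h : v ∈ C) : gen v ∈ WW C := Submodule.subset_span ⟨v, h, rfl⟩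

theorem WW_div {C : Submodule k (VV k N)} (c : k) {w} (hw : w ∈ WW C) :
    ∃ v ∈ C, ∃ w' ∈ WW C, w = gen v + (Polynomial.X - Polynomial.C c) • w' := by
  induction hw using Submodule.span_induction with
  | mem y h => obtain ⟨v, hv, rfl⟩ := h; exact ⟨v, hv, 0, zero_mem _, by simp⟩
  | zero => exact ⟨0, zero_mem _, 0, zero_mem _, by simp⟩
  | add x y _ _ hx hy =>
    obtain ⟨v, hv, w, hw, rfl⟩ := hx
    obtain ⟨v', hv', w', hw', rfl⟩ := hy
    exact ⟨_, add_mem hv hv', _, add_mem hw hw', by rw [map_add, smul_add]; abel⟩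
  | smul p x _ hx =>
    obtain ⟨v, hv, w, hw, rfl⟩ := hx
    obtain ⟨p', hp'⟩ := Polynomial.X_sub_C_dvd_sub_C_eval (p := p) (a := c)
    have hp : p = Polynomial.C (p.eval c) + (Polynomial.X - Polynomial.C c) * p' := by rw [← hp']; ring
    refine ⟨p.eval c • v, C.smul_mem _ hv, p' • gen v + p • w,
      add_mem (Submodule.smul_mem _ _ (gen_mem hv)) (Submodule.smul_mem _ _ hw), ?_⟩
    rw [gen_smul, smul_add, smul_add, smul_smul, smul_smul, smul_smul, ← add_assoc, ← add_smul, ← hp, mul_comm p]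

theorem WW_cancel {C : Submodule k (VV k N)} (h : NoSp C) (c : k) {u}
    (hu : (Polynomial.X - Polynomial.C c) • u ∈ WW C) : u ∈ WW C := by
  obtain ⟨v, hv, w, hw, e⟩ := WW_div c hu
  have h1 : v = em (-c, 1) v.2 := by
    ext1
    · ext i
      have := congrArg (Polynomial.eval c) (congrFun e i)
      simp [gen_apply] at this
      simp [em_apply]
      linear_combination -this
    · simp [em_apply]
  have h2 : v.2 ∈ Zm C := h (-c, 1) (by simp) (by rw [mem_Dd, ← h1]; exact hv)
  have h3 : gen v = (Polynomial.X - Polynomial.C c) • gen (v.2, 0) := by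
    rw [h1]; ext1 i; simp [gen_apply, em_apply]; ring
  rw [h3, ← smul_add] at e
  have h4 : u = gen (v.2, 0) + w := by
    ext1 i
    have := congrFun e i
    simp only [Pi.smul_apply, smul_eq_mul] at this
    exact mul_left_cancel₀ (Polynomial.X_sub_C_ne_zero c) this
  rw [h4]
  exact add_mem (gen_mem (mem_Zm.1 h2).1) hw

theorem WW_torsion [IsAlgClosed k] {C : Submodule k (VV k N)} (h : NoSp C) : ∀ (d : ℕ) (p : Polynomial k)
    (_ : p.natDegree = d) (_ : p ≠ 0) {u} (_ : p • u ∈ WW C), u ∈ WW C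
  | 0, p, hd, hp, u, hu => by
    rw [Polynomial.eq_C_of_natDegree_eq_zero hd] at hu
    have hc : p.coeff 0 ≠ 0 := fun h0 => hp (by rw [Polynomial.eq_C_of_natDegree_eq_zero hd, h0, map_zero])
    have := Submodule.smul_mem _ (Polynomial.C (p.coeff 0)⁻¹) hu
    rwa [smul_smul, ← map_mul, inv_mul_cancel₀ hc, map_one, one_smul] at this
  | d+1, p, hd, hp, u, hu => by
    obtain ⟨c, hc⟩ := IsAlgClosed.exists_root p (by
      rw [Polynomial.degree_eq_natDegree hp, hd]; exact_mod_cast Nat.succ_ne_zero d)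
    obtain ⟨q, rfl⟩ := Polynomial.dvd_iff_isRoot.2 hc
    have hq : q ≠ 0 := right_ne_zero_of_mul hp
    rw [Polynomial.natDegree_mul (Polynomial.X_sub_C_ne_zero c) hq, Polynomial.natDegree_X_sub_C] at hd
    rw [mul_smul] at hu
    exact WW_torsion h d q (by omega) hq (WW_cancel h c hu)

theorem WW_pr [IsAlgClosed k] {C : Submodule k (VV k N)} (h : NoSp C) : ∃ π, IsPr π (WW C) := by
  have : Module.IsTorsionFree (Polynomial k) ((Fin N → Polynomial k) ⧸ WW C) := by
    rw [Submodule.isTorsionFree_iff_torsion_eq_bot, eq_bot_iff]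
    intro y hy
    obtain ⟨⟨p, hp⟩, hpy⟩ := hy
    obtain ⟨u, rfl⟩ := Submodule.Quotient.mk_surjective _ y
    change p • (Submodule.Quotient.mk u : (Fin N → Polynomial k) ⧸ WW C) = 0 at hpy
    rw [← Submodule.Quotient.mk_smul, Submodule.Quotient.mk_eq_zero] at hpy
    exact (Submodule.Quotient.mk_eq_zero _).2 (WW_torsion h _ p rfl (nonZeroDivisors.ne_zero hp) hpy)
  obtain ⟨s, hs⟩ := Module.projective_lifting_property (WW C).mkQ LinearMap.id (Submodule.mkQ_surjective _)
  refine ⟨s.comp (WW C).mkQ, ?_, ?_⟩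
  · intro v hv
    rw [LinearMap.comp_apply, (WW C).mkQ_apply, (Submodule.Quotient.mk_eq_zero _).2 hv, map_zero]
  · intro v
    rw [← Submodule.Quotient.mk_eq_zero, Submodule.Quotient.mk_sub, sub_eq_zero]
    exact (LinearMap.congr_fun hs ((WW C).mkQ v)).symm

/-- inclusion of coefficients. -/
noncomputable def io : Pol k N →+* MvPolynomial (Fin N) (Polynomial k) := MvPolynomial.map Polynomial.C

/-- `v₁ + τ v₂`. -/
noncomputable def Phi (m : M2 k N) : MvPolynomial (Fin N) (Polynomial k) := io m.1 + C Polynomial.X * io m.2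

theorem Phi_vl (v : VV k N) : Phi (vl v) = lf (gen v) := by
  rw [Phi, lf_apply, vl_apply, lf_apply, lf_apply, io, map_sum, map_sum, Finset.mul_sum, ← Finset.sum_add_distrib]
  refine Finset.sum_congr rfl fun i _ => ?_
  simp [gen_apply]; ring

theorem Phi_mem {C : Submodule k (VV k N)} {m} (h : m ∈ SC C) : Phi m ∈ lid (WW C) := by
  induction h using Submodule.span_induction with
  | mem y h => obtain ⟨v, hv, rfl⟩ := h; rw [Phi_vl]; exact lf_mem_lid (gen_mem hv)
  | zero => simp [Phi]
  | add x y _ _ hx hy =>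
    have : Phi (x + y) = Phi x + Phi y := by simp [Phi]; ring
    rw [this]; exact add_mem hx hy
  | smul p x _ hx =>
    have : Phi (p • x) = io p * Phi x := by simp [Phi]; ring
    rw [this]; exact Ideal.mul_mem_left _ _ hx

/-- to `S[τ]`. -/
noncomputable def ev : MvPolynomial (Fin N) (Polynomial k) →+* Polynomial (Pol k N) :=
  eval₂Hom (Polynomial.mapRingHom C) (fun i => Polynomial.C (X i))

/-- `v₁ + τ v₂` in `S[τ]`. -/
noncomputable def Psi : M2 k N →ₗ[Pol k N] Polynomial (Pol k N) :=
  LinearMap.coprod (Polynomial.monomial 0) (Polynomial.monomial 1)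

theorem Psi_apply (m : M2 k N) : Psi m = Polynomial.C m.1 + Polynomial.X * Polynomial.C m.2 := by
  rw [Polynomial.X_mul_C, Polynomial.C_mul_X_eq_monomial]; rfl

theorem ev_io (f : Pol k N) : ev (io f) = Polynomial.C f := by
  have : (ev.comp io : Pol k N →+* _) = Polynomial.C := by
    apply MvPolynomial.ringHom_ext
    · intro r; simp [ev, io]
    · intro i; simp [ev, io]
  exact RingHom.congr_fun this f

theorem ev_Phi (m : M2 k N) : ev (Phi m) = Psi m := by
  rw [Psi_apply, Phi, map_add, map_mul, ev_io, ev_io]; simp [ev]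

/-- filtration. -/
noncomputable def TT (C : Submodule k (VV k N)) : ℕ → Submodule (Pol k N) (Polynomial (Pol k N))
  | 0 => ⊥
  | e+1 => TT C e ⊔ (SC C).map ((LinearMap.mulLeft (Pol k N) (Polynomial.X ^ e)).comp Psi)

theorem TT_mono (C : Submodule k (VV k N)) : Monotone (TT C) := monotone_nat_of_le_succ fun e => by
  rw [TT]; exact le_sup_left

theorem TT_X {C : Submodule k (VV k N)} : ∀ {e g}, g ∈ TT C e → Polynomial.X * g ∈ TT C (e+1)
  | 0, g, h => by
    rw [TT, Submodule.mem_bot] at h; rw [h, mul_zero]; exact zero_mem _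
  | e+1, g, h => by
    rw [TT] at h ⊢
    obtain ⟨a, ha, _, ⟨m, hm, rfl⟩, rfl⟩ := Submodule.mem_sup.1 h
    rw [mul_add]
    refine Submodule.add_mem_sup (TT_X ha) ⟨m, hm, ?_⟩
    simp [pow_succ', mul_assoc]

theorem TT_coeff {C : Submodule k (VV k N)} : ∀ {e g}, g ∈ TT C e → ∀ j, e < j → g.coeff j = 0
  | 0, g, h, j, _ => by
    rw [TT, Submodule.mem_bot] at h; rw [h, Polynomial.coeff_zero]
  | e+1, g, h, j, hj => by
    rw [TT] at h
    obtain ⟨a, ha, _, ⟨m, hm, rfl⟩, rfl⟩ := Submodule.mem_sup.1 h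
    rw [Polynomial.coeff_add, TT_coeff ha j (by omega), zero_add]
    obtain ⟨j, rfl⟩ := Nat.exists_eq_add_of_lt hj
    simp only [LinearMap.comp_apply, LinearMap.mulLeft_apply, Psi_apply]
    rw [show e + 1 + j + 1 = (j + 2) + e by ring, Polynomial.coeff_X_pow_mul]
    simp [Polynomial.coeff_X_mul, Polynomial.coeff_C]

theorem TT_mul {C : Submodule k (VV k N)} (p : Polynomial (Pol k N)) {e g} (h : g ∈ TT C e) : ∃ e', p * g ∈ TT C e' := by
  induction p using Polynomial.induction_on' with
  | add p q hp hq =>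
    obtain ⟨e1, h1⟩ := hp
    obtain ⟨e2, h2⟩ := hq
    rw [add_mul]
    exact ⟨max e1 e2, add_mem (TT_mono C (le_max_left _ _) h1) (TT_mono C (le_max_right _ _) h2)⟩
  | monomial n a =>
    rw [← Polynomial.C_mul_X_pow_eq_monomial, mul_assoc, ← Polynomial.smul_eq_C_mul]
    have : ∀ n, ∃ e', Polynomial.X ^ n * g ∈ TT C e' := by
      intro n
      induction n with
      | zero => exact ⟨e, by simpa using h⟩
      | succ n ih => obtain ⟨e', h'⟩ := ih; exact ⟨e'+1, by rw [pow_succ', mul_assoc]; exact TT_X h'⟩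
    obtain ⟨e', h'⟩ := this n
    exact ⟨e', Submodule.smul_mem _ _ h'⟩

theorem ev_mem {C : Submodule k (VV k N)} {g} (h : g ∈ lid (WW C)) : ∃ e, ev g ∈ TT C e := by
  rw [WW, lid_span] at h
  induction h using Submodule.span_induction with
  | mem y h =>
    obtain ⟨_, ⟨v, hv, rfl⟩, rfl⟩ := h
    rw [← Phi_vl, ev_Phi]
    refine ⟨1, ?_⟩
    rw [TT]
    exact Submodule.mem_sup_right ⟨_, vl_mem_SC hv, by simp⟩
  | zero => exact ⟨0, by rw [map_zero]; exact zero_mem _⟩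
  | add x y _ _ hx hy =>
    obtain ⟨e1, h1⟩ := hx
    obtain ⟨e2, h2⟩ := hy
    rw [map_add]
    exact ⟨max e1 e2, add_mem (TT_mono C (le_max_left _ _) h1) (TT_mono C (le_max_right _ _) h2)⟩
  | smul p x _ hx =>
    obtain ⟨e, h⟩ := hx
    rw [smul_eq_mul, map_mul]
    exact TT_mul _ h

theorem TT_lower {C : Submodule k (VV k N)} (hC : NoSp C) {g} (hg : ∀ j, 2 ≤ j → g.coeff j = 0) : ∀ {e}, g ∈ TT C e → g ∈ TT C 1
  | 0, h => TT_mono C (Nat.zero_le _) h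
  | 1, h => h
  | e+2, h => by
    apply TT_lower hC hg (e := e+1)
    have h0 := h
    rw [TT] at h
    obtain ⟨a, ha, _, ⟨m, hm, rfl⟩, rfl⟩ := Submodule.mem_sup.1 h
    refine add_mem ha ?_
    have h1 := hg (e+2) (by omega)
    rw [Polynomial.coeff_add, TT_coeff ha _ (by omega), zero_add] at h1
    simp only [LinearMap.comp_apply, LinearMap.mulLeft_apply, Psi_apply] at h1
    rw [show e + 2 = 1 + (e + 1) by ring, Polynomial.coeff_X_pow_mul] at h1
    simp [Polynomial.coeff_C, Polynomial.coeff_X_mul] at h1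
    have h2 : m = Em (1, 0) m.1 := by ext1 <;> simp [Em_apply, h1]
    have h3 : m.1 ∈ I2 C ⊔ lid (Zm C) := by
      rw [h2] at hm
      have hm' := (Kp (by simp)).1 hm
      exact (sup_le_sup_left (lid_mono (hC _ (by simp))) _) hm'
    have h4 : Em (0, 1) m.1 ∈ SC C := (Kp (by simp)).2 ((sup_le_sup_left (lid_mono (Zm_le_Dd C _)) _) h3)
    rw [TT]
    refine Submodule.mem_sup_right ⟨_, h4, ?_⟩
    simp [Psi_apply, Em_apply, h1, pow_succ, mul_assoc]

theorem mem_of_Phi {C : Submodule k (VV k N)} (hC : NoSp C) {m : M2 k N} (h : Phi m ∈ lid (WW C)) : m ∈ SC C := by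
  obtain ⟨e, he⟩ := ev_mem h
  rw [ev_Phi] at he
  have h1 := TT_lower hC (by
    intro j hj
    obtain ⟨j, rfl⟩ := Nat.exists_eq_add_of_le hj
    rw [Psi_apply, show 2 + j = j + 1 + 1 by ring]
    simp [Polynomial.coeff_C, Polynomial.coeff_X_mul]) he
  rw [TT, TT, bot_sup_eq] at h1
  obtain ⟨m', hm', e⟩ := h1
  simp [Psi_apply] at e
  have e0 := congrArg (fun p => Polynomial.coeff p 0) e
  have e1 := congrArg (fun p => Polynomial.coeff p 1) e
  simp [Polynomial.coeff_C, Polynomial.coeff_X_mul] at e0 e1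
  have : m = m' := Prod.ext e0.symm e1.symm
  rwa [this]

theorem P2 [IsAlgClosed k] {C : Submodule k (VV k N)} (hC : NoSp C) {f : Pol k N} {v : M2 k N} (h : f • v ∈ SC C)
    (hv : v ∉ SC C) : f ∈ I2 C ⊔ lid (Zm C) := by
  obtain ⟨π, hπ⟩ := WW_pr hC
  have h1 := Phi_mem h
  have e : Phi (f • v) = io f * Phi v := by simp [Phi]; ring
  rw [e] at h1
  have h2 := (hπ.prime.mem_or_mem h1).resolve_right (fun h => hv (mem_of_Phi hC h))
  have e2 : io f = Phi (Em (1, 0) f) := by simp [Phi, Em_apply]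
  rw [e2] at h2
  exact (sup_le_sup_left (lid_mono (hC _ (by simp))) _) ((Kp (by simp)).1 (mem_of_Phi hC h2))
end field
end QPD

namespace QPD
open MvPolynomial

section field
variable {k : Type u} [Field k] {N : ℕ}

/-- dimension. -/
noncomputable abbrev fr {E : Type*} [AddCommGroup E] [Module k E] (W : Submodule k E) : ℕ := Module.finrank k W

theorem ZZ_le (C : Submodule k (VV k N)) : (Zm C).prod (Zm C) ≤ C := by
  rintro ⟨a, b⟩ ⟨ha, hb⟩
  have := C.add_mem (mem_Zm.1 ha).1 (mem_Zm.1 hb).2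
  simpa using this

theorem le_Zm {W : Submodule k (Vec k N)} {C : Submodule k (VV k N)} (h : W.prod W ≤ C) : W ≤ Zm C := by
  intro w hw
  exact mem_Zm.2 ⟨h ⟨hw, W.zero_mem⟩, h ⟨W.zero_mem, hw⟩⟩

theorem fr_prod (W : Submodule k (Vec k N)) : fr (W.prod W) = 2 * fr W := by
  have h := finrank_Lam (x := ((1, 0) : k × k)) (by simp) (W.prod W)
  have h1 : Lam ((1, 0) : k × k) (W.prod W) = W := by
    ext w
    constructor
    · rintro ⟨v, hv, rfl⟩
      rw [ph_apply]; simpa using hv.2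
    · intro hw; exact ⟨(0, -w), ⟨W.zero_mem, W.neg_mem hw⟩, by simp [ph_apply]⟩
  have h2 : Dd ((1, 0) : k × k) (W.prod W) = W := by
    ext w
    simp [mem_Dd, em_apply]
  rw [h1, h2] at h
  rw [fr, fr, ← h]; ring

theorem Zm_mono {C C' : Submodule k (VV k N)} (h : C ≤ C') : Zm C ≤ Zm C' := le_Zm ((ZZ_le C).trans h)
theorem Dd_mono {C C' : Submodule k (VV k N)} (h : C ≤ C') (x) : Dd x C ≤ Dd x C' := fun _ hw => h hw
theorem Lam_mono {C C' : Submodule k (VV k N)} (h : C ≤ C') (x) : Lam x C ≤ Lam x C' := Submodule.map_mono h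
theorem Len_mono {C C' : Submodule k (VV k N)} (h : C ≤ C') : Len C ≤ Len C' :=
  sup_le_sup (Submodule.map_mono h) (Submodule.map_mono h)

theorem fr_le {E : Type*} [AddCommGroup E] [Module k E] [FiniteDimensional k E] {A B : Submodule k E} (h : A ≤ B) : fr A ≤ fr B := Submodule.finrank_mono h

theorem fr_lt {E : Type*} [AddCommGroup E] [Module k E] [FiniteDimensional k E] {A B : Submodule k E} (h : A ≤ B) {v} (hv : v ∈ B) (hv' : v ∉ A) :
    fr A < fr B := Submodule.finrank_lt_finrank_of_lt (lt_of_le_of_ne h (fun e => hv' (e ▸ hv)))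

theorem fr_sup_le {E : Type*} [AddCommGroup E] [Module k E] [FiniteDimensional k E] (A B : Submodule k E) : fr (A ⊔ B) ≤ fr A + fr B :=
  Submodule.finrank_add_le_finrank_add_finrank A B

theorem fr_span_one {E : Type*} [AddCommGroup E] [Module k E] [FiniteDimensional k E] (v : E) : fr (Submodule.span k {v}) ≤ 1 := by
  have := finrank_span_le_card (R := k) ({v} : Set E)
  simpa using this

theorem fr_Lam {x : k × k} (hx : x ≠ 0) (C : Submodule k (VV k N)) : fr (Lam x C) + fr (Dd x C) = fr C := finrank_Lam hx C

/-- the kernel space. -/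
def KK (x y : k × k) (C : Submodule k (VV k N)) : Submodule k (VV k N) := C ⊓ (Lam x C).comap (ph y)

theorem mem_KK {x y : k × k} {C : Submodule k (VV k N)} {v} : v ∈ KK x y C ↔ v ∈ C ∧ ph y v ∈ Lam x C := Iff.rfl

theorem dt_ne {x y : k × k} (h : dt x y = 1) : x ≠ 0 ∧ y ≠ 0 := by
  constructor <;> rintro rfl <;> simp [dt] at h

theorem Len_K {x y : k × k} (h : dt x y = 1) (C : Submodule k (VV k N)) :
    fr (Len C) + fr (KK x y C) + fr (Dd x C) = 2 * fr C := by
  have h1 := finrank_sup_map (C := C) (Lam x C) (ph y)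
  have h2 := finrank_Lam (dt_ne h).1 C
  rw [Len_eq h]
  change fr (Lam x C ⊔ Lam y C) + fr (KK x y C) = _ at h1
  simp only [fr] at *
  omega

theorem ZZ_le_KK {x y : k × k} (h : dt x y = 1) (C : Submodule k (VV k N)) : (Zm C).prod (Zm C) ≤ KK x y C := by
  intro v hv
  refine ⟨ZZ_le C hv, Zm_le_Lam (dt_ne h).1 C ?_⟩
  rw [ph_apply]
  exact sub_mem (Submodule.smul_mem _ _ hv.1) (Submodule.smul_mem _ _ hv.2)

theorem Len_le {x : k × k} (hx : x ≠ 0) (C : Submodule k (VV k N)) :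
    fr (Len C) + 2 * fr (Zm C) + fr (Dd x C) ≤ 2 * fr C := by
  obtain ⟨y, hy⟩ := exists_dt hx
  have h1 := Len_K hy C
  have h2 := fr_le (ZZ_le_KK hy C)
  rw [fr_prod] at h2
  omega

theorem two_z_le (C : Submodule k (VV k N)) : 2 * fr (Zm C) ≤ fr C := by
  rw [← fr_prod]; exact fr_le (ZZ_le C)

theorem Zm_le_Len (C : Submodule k (VV k N)) : Zm C ≤ Len C := (Zm_le_Lam (x := ((1, 0) : k × k)) (by simp) C).trans (Lam_le_Len _ C)

theorem SC_add (C : Submodule k (VV k N)) (v : VV k N) :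
    SC (C ⊔ Submodule.span k {v}) = SC C ⊔ Submodule.span (Pol k N) {vl v} := by
  rw [SC_sup, SC_span, Set.image_singleton]

theorem pd_NoSp [IsAlgClosed k] : ∀ (n : ℕ) (C : Submodule k (VV k N)) (_ : NoSp C)
    (_ : fr C = 2 * fr (Zm C) + n), PD (Pol k N) (M2 k N ⧸ SC C) (fr (Zm C) + n)
  | 0, C, hC, h => by
    refine (pd_Len C).mono ?_
    have h1 := Len_le (x := ((1, 0) : k × k)) (by simp) C
    have h2 := fr_le (Zm_le_Dd C ((1, 0) : k × k))
    simp only [fr] at *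
    omega
  | n+1, C, hC, h => by
    have : ∃ v ∈ C, v ∉ (Zm C).prod (Zm C) := by
      by_contra! hcon
      have := fr_le (show C ≤ (Zm C).prod (Zm C) from hcon)
      rw [fr_prod] at this
      omega
    obtain ⟨v, hv, hvZ⟩ := this
    obtain ⟨C1, h1, h2, h3, h4, h5⟩ := exists_hyper (ZZ_le C) hv hvZ
    have h5 : fr C = fr C1 + 1 := h5
    have hz : Zm C1 = Zm C := le_antisymm (Zm_mono h2) (le_Zm h1)
    have hC1 : NoSp C1 := fun x hx => by rw [hz]; exact (Dd_mono h2 x).trans (hC x hx)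
    have ih := pd_NoSp n C1 hC1 (by rw [hz]; omega)
    have hx : ((1, 0) : k × k) ≠ 0 := by simp
    have hD : Dd ((1, 0) : k × k) C1 = Zm C1 := le_antisymm (hC1 _ hx) (Zm_le_Dd _ _)
    have hq := pd_SCX hx C1
    have hl : fr (Lam ((1, 0) : k × k) C1) + fr _ = fr C1 := finrank_Lam hx C1
    rw [hD, hz] at hl
    rw [hz] at ih
    have h6 := cyc_left _ _ ih (hq.mono (show fr (Lam ((1, 0) : k × k) C1) ≤ _ by omega))
    have h7 : col (SC C1) (Em ((1, 0) : k × k) 1) = col (SC C1) (vl v) := by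
      ext f
      rw [mem_col, mem_col, ← Em_eq_smul, Kp hx, hD]
      constructor
      · intro hf
        obtain ⟨a, ha, b, hb, rfl⟩ := Submodule.mem_sup.1 hf
        rw [add_smul]
        exact add_mem (I2_smul ha _) (lid_smul hb _)
      · intro hf
        exact P2 hC1 hf (fun hh => h3 (vl_mem_SC_iff.1 hh))
    rw [h7] at h6
    have h8 := cyc_right _ _ h6 (ih.mono (Nat.le_succ _))
    rw [← SC_add, h4] at h8
    exact h8

/-- `q S²`. -/
noncomputable abbrev qM (q : Pol k N) : Submodule (Pol k N) (M2 k N) :=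
  (⊤ : Submodule (Pol k N) (M2 k N)).map (LinearMap.lsmul (Pol k N) (M2 k N) q)

theorem mem_qM {q : Pol k N} {m : M2 k N} : m ∈ qM q ↔ ∃ e, q • e = m := by
  simp [qM]

theorem qM_eq (q : Pol k N) : qM q = Submodule.span (Pol k N) {(q, 0), (0, q)} := by
  ext m
  rw [mem_qM, Submodule.mem_span_pair]
  constructor
  · rintro ⟨e, rfl⟩; exact ⟨e.1, e.2, by ext1 <;> simp [mul_comm]⟩
  · rintro ⟨a, b, rfl⟩; exact ⟨(a, b), by ext1 <;> simp [mul_comm]⟩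

theorem hcomp_mem {T : Set (Pol k N)} (hT : ∀ t ∈ T, ∃ d, t.IsHomogeneous d) {f : Pol k N} (hf : f ∈ Ideal.span T) (n : ℕ) :
    homogeneousComponent n f ∈ Ideal.span T := by
  letI := MvPolynomial.gradedAlgebra (σ := Fin N) (R := k)
  have h := Ideal.homogeneous_span (homogeneousSubmodule (Fin N) k) T hT
  have := h n hf
  have e := decomposition.decompose'_apply (σ := Fin N) (R := k) f n
  rw [← e]
  exact this

theorem hcomp_lid {W : Submodule k (Vec k N)} {f : Pol k N} (hf : f ∈ lid W) (n : ℕ) : homogeneousComponent n f ∈ lid W :=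
  hcomp_mem (by rintro _ ⟨v, -, rfl⟩; exact ⟨1, lf_homog v⟩) hf n

theorem hcomp_I2 {C : Submodule k (VV k N)} {f : Pol k N} (hf : f ∈ I2 C) (n : ℕ) : homogeneousComponent n f ∈ I2 C :=
  hcomp_mem (by rintro _ ⟨u, -, v, -, rfl⟩; exact ⟨2, mn_homog u v⟩) hf n

theorem exists_compl_in {E : Type*} [AddCommGroup E] [Module k E] [FiniteDimensional k E] {Z Λ : Submodule k E} (h : Z ≤ Λ) :
    ∃ Λ1 : Submodule k E, Z ⊔ Λ1 = Λ ∧ fr Λ = fr Z + fr Λ1 := by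
  obtain ⟨U, hU⟩ := Submodule.exists_isCompl Z
  refine ⟨U ⊓ Λ, ?_, ?_⟩
  · rw [← sup_inf_assoc_of_le _ h, hU.sup_eq_top, top_inf_eq]
  · have := Submodule.finrank_sup_add_finrank_inf_eq Z (U ⊓ Λ)
    rw [← sup_inf_assoc_of_le _ h, hU.sup_eq_top, top_inf_eq, ← inf_assoc, hU.inf_eq_bot, bot_inf_eq, finrank_bot] at this
    simpa using this

theorem pd_Var2 {C : Submodule k (VV k N)} {q : Pol k N} (hq : q.IsHomogeneous 2) {Λ : Submodule k (Vec k N)}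
    (h1 : Zm C ≤ Λ) (h2 : Λ ≤ Len C) (hqΛ : q ∈ I2 C ⊔ lid Λ) {d : ℕ} (hd : fr (Len C) + fr Λ = fr (Zm C) + d) :
    PD (Pol k N) (M2 k N ⧸ (SC C ⊔ qM q)) d := by
  obtain ⟨Λ1, hs, hfr⟩ := exists_compl_in h1
  rw [← hs, lid_sup] at hqΛ
  obtain ⟨i, hi, j, hj, e⟩ := Submodule.mem_sup.1 hqΛ
  obtain ⟨a, ha, b, hb, rfl⟩ := Submodule.mem_sup.1 hj
  have e2 := congrArg (homogeneousComponent 2) e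
  rw [hcomp_self hq, map_add, map_add] at e2
  obtain ⟨u, hu⟩ := quad_decomp (Module.finBasis k Λ1) (hcomp_lid hb 2) (homogeneousComponent_isHomogeneous 2 b)
  set q' := homogeneousComponent 2 b
  have key : ∀ m : M2 k N, q • m - q' • m ∈ SC C := by
    intro m
    rw [← sub_smul, ← e2, show ∀ a b c : Pol k N, a + (b + c) - c = a + b by intros; ring, add_smul]
    exact add_mem (I2_smul (hcomp_I2 hi 2) _) (lid_smul (hcomp_lid ha 2) _)
  have e3 : SC C ⊔ qM q = SC C ⊔ qM q' := by
    apply le_antisymm <;> refine sup_le le_sup_left ?_ <;> intro m hm <;> obtain ⟨w, rfl⟩ := mem_qM.1 hm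
    · rw [← sub_add_cancel (q • w) (q' • w)]
      exact add_mem (Submodule.mem_sup_left (key w)) (Submodule.mem_sup_right (mem_qM.2 ⟨w, rfl⟩))
    · rw [← sub_sub_cancel (q • w) (q' • w)]
      exact sub_mem (Submodule.mem_sup_right (mem_qM.2 ⟨w, rfl⟩)) (Submodule.mem_sup_left (key w))
  rw [e3, qM_eq, SC, ← Submodule.span_union]
  refine (var2 (Len C ⊔ Submodule.span k (Set.range u)) _ ?_).mono ?_
  · have hq' : q' ∈ kU (Len C ⊔ Submodule.span k (Set.range u)) := by
      rw [hu]
      refine sum_mem fun i _ => mul_mem (lf_mem_kU (Submodule.mem_sup_right (Submodule.subset_span ⟨i, rfl⟩)))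
        (lf_mem_kU (Submodule.mem_sup_left (h2 (hs ▸ Submodule.mem_sup_right (Subtype.coe_prop _)))))
    rintro t (⟨v, hv, rfl⟩ | rfl | rfl)
    · exact ⟨lf_mem_kU (Submodule.mem_sup_left (Submodule.mem_sup_left ⟨v, hv, rfl⟩)),
        lf_mem_kU (Submodule.mem_sup_left (Submodule.mem_sup_right ⟨v, hv, rfl⟩))⟩
    · exact ⟨hq', zero_mem _⟩
    · exact ⟨zero_mem _, hq'⟩
  · have h3 := Submodule.finrank_add_le_finrank_add_finrank (Len C) (Submodule.span k (Set.range u))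
    have h4 := finrank_range_le_card (R := k) u
    rw [Fintype.card_fin] at h4
    change fr (Submodule.span k (Set.range u)) ≤ fr Λ1 at h4
    change fr (Len C ⊔ Submodule.span k (Set.range u)) ≤ fr (Len C) + fr (Submodule.span k (Set.range u)) at h3
    change fr (Len C ⊔ Submodule.span k (Set.range u)) ≤ _
    omega
end field
end QPD

namespace QPD
open MvPolynomial

section field
variable {k : Type u} [Field k] {N : ℕ}

theorem em_smul (a : k) (x : k × k) (w : Vec k N) : em (a • x) w = a • em x w := by
  simp [em_apply, mul_smul]

theorem Dd_smul {a : k} (ha : a ≠ 0) (x : k × k) (C : Submodule k (VV k N)) : Dd (a • x) C = Dd x C := by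
  ext w
  rw [mem_Dd, mem_Dd, em_smul, Submodule.smul_mem_iff _ ha]

theorem ph_smul (a : k) (x : k × k) (w : VV k N) : ph (a • x) w = a • ph x w := by
  simp [ph_apply, mul_smul, smul_sub]

theorem Lam_smul {a : k} (ha : a ≠ 0) (x : k × k) (C : Submodule k (VV k N)) : Lam (a • x) C = Lam x C := by
  ext w
  constructor
  · rintro ⟨v, hv, rfl⟩; exact ⟨a • v, C.smul_mem _ hv, by rw [ph_smul, map_smul]⟩
  · rintro ⟨v, hv, rfl⟩; exact ⟨a⁻¹ • v, C.smul_mem _ hv, by rw [ph_smul, map_smul, smul_smul, mul_inv_cancel₀ ha, one_smul]⟩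

theorem exists_scale {x y : k × k} (hx : x ≠ 0) (hy : y ≠ 0) (h : dt x y = 0) : ∃ a : k, a ≠ 0 ∧ y = a • x := by
  obtain ⟨z, hz⟩ := exists_dt hx
  have e : y = dt y z • x := by
    rw [dt] at *
    ext1
    · simp; linear_combination (-y.1) * hz + z.1 * h
    · simp; linear_combination (-y.2) * hz + z.2 * h
  refine ⟨dt y z, ?_, e⟩
  intro h0
  rw [h0, zero_smul] at e
  exact hy e

theorem dt_smul (x y : k × k) (a : k) : dt x (a • y) = a * dt x y := by
  simp [dt]; ring

theorem exists_partner {C : Submodule k (VV k N)} {x y : k × k} (hx : x ≠ 0) (hy : y ≠ 0) (h1 : Dd y C ≤ Zm C) (h2 : ¬ Dd x C ≤ Zm C) :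
    ∃ y', dt x y' = 1 ∧ Dd y' C ≤ Zm C := by
  have h : dt x y ≠ 0 := by
    intro h
    obtain ⟨a, ha, rfl⟩ := exists_scale hx hy h
    rw [Dd_smul ha] at h1
    exact h2 h1
  exact ⟨(dt x y)⁻¹ • y, by rw [dt_smul, inv_mul_cancel₀ h], by rwa [Dd_smul (inv_ne_zero h)]⟩

theorem Dd_le_Len {x : k × k} (hx : x ≠ 0) (C : Submodule k (VV k N)) : Dd x C ≤ Len C := by
  intro w hw
  obtain ⟨y, hy⟩ := exists_dt hx
  rw [mem_Dd] at hw
  have := Lam_le_Len y C (ph_mem_Lam (x := y) hw)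
  rw [ph_em', show dt y x = - 1 by rw [← hy, dt, dt]; ring] at this
  simpa using this

theorem mn_lid_left {W : Submodule k (Vec k N)} {u v : VV k N} (h : u ∈ W.prod W) : mn u v ∈ lid W :=
  sub_mem (Ideal.mul_mem_right _ _ (lf_mem_lid h.1)) (Ideal.mul_mem_right _ _ (lf_mem_lid h.2))

theorem mn_lid_right {W : Submodule k (Vec k N)} {u v : VV k N} (h : v ∈ W.prod W) : mn u v ∈ lid W :=
  sub_mem (Ideal.mul_mem_left _ _ (lf_mem_lid h.2)) (Ideal.mul_mem_left _ _ (lf_mem_lid h.1))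

theorem I2_add_le (C : Submodule k (VV k N)) (W : Submodule k (Vec k N)) : I2 (C ⊔ W.prod W) ≤ I2 C ⊔ lid W := by
  refine Ideal.span_le.2 ?_
  rintro _ ⟨u, hu, v, hv, rfl⟩
  obtain ⟨a, ha, b, hb, rfl⟩ := Submodule.mem_sup.1 hu
  obtain ⟨c, hc, d, hd, rfl⟩ := Submodule.mem_sup.1 hv
  have e : mn (a + b) (c + d) = mn a c + (mn b (c + d) + mn a d) := by
    simp [mn, map_add]; ring
  rw [e]
  exact add_mem (Submodule.mem_sup_left (mn_mem ha hc)) (Submodule.mem_sup_right (add_mem (mn_lid_left hb) (mn_lid_right hd)))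

theorem Len_add (C : Submodule k (VV k N)) {W : Submodule k (Vec k N)} (h : W ≤ Len C) : Len (C ⊔ W.prod W) = Len C := by
  apply le_antisymm _ (Len_mono le_sup_left)
  refine sup_le ?_ ?_ <;> rw [Submodule.map_sup] <;> refine sup_le ?_ ?_
  · exact le_sup_left
  · rintro _ ⟨v, hv, rfl⟩; exact h hv.1
  · exact le_sup_right
  · rintro _ ⟨v, hv, rfl⟩; exact h hv.2

theorem prod_ph {W : Submodule k (Vec k N)} {v : VV k N} (h : v ∈ W.prod W) (x : k × k) : ph x v ∈ W :=
  sub_mem (W.smul_mem _ h.1) (W.smul_mem _ h.2)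

theorem prod_em {W : Submodule k (Vec k N)} {w : Vec k N} (h : w ∈ W) (x : k × k) : em x w ∈ W.prod W :=
  ⟨W.smul_mem _ h, W.smul_mem _ h⟩

theorem fr_add_prod {C : Submodule k (VV k N)} {x y : k × k} (h : dt x y = 1) :
    fr (C ⊔ (Dd x C).prod (Dd x C)) + fr (Zm C) ≤ fr C + fr (Dd x C) := by
  obtain ⟨D1, hs, hf⟩ := exists_compl_in (Zm_le_Dd C x)
  have h1 : C ⊔ (Dd x C).prod (Dd x C) ≤ C ⊔ D1.map (em y) := by
    refine sup_le le_sup_left ?_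
    intro v hv
    rw [VV_decomp h v]
    refine sub_mem (Submodule.mem_sup_left (prod_ph hv y)) ?_
    have := prod_ph hv x
    rw [← hs] at this
    obtain ⟨a, ha, b, hb, e⟩ := Submodule.mem_sup.1 this
    rw [← e, map_add]
    exact add_mem (Submodule.mem_sup_left (Zm_em ha y)) (Submodule.mem_sup_right ⟨b, hb, rfl⟩)
  have h2 := fr_le h1
  have h3 := fr_sup_le C (D1.map (em y))
  have h4 : fr (D1.map (em y)) ≤ fr D1 := Submodule.finrank_map_le (em y) D1
  omega

theorem WW' [IsAlgClosed k] {q : Pol k N} : ∀ (r : ℕ) (C : Submodule k (VV k N)) (y : k × k) (_ : y ≠ 0) (_ : Dd y C ≤ Zm C) (e : M2 k N)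
    (_ : q • e ∈ SC C) (_ : e ∉ SC C) (_ : fr (Len C) ≤ fr (Zm C) + r), ∃ Λ, Zm C ≤ Λ ∧ Λ ≤ Len C ∧ q ∈ I2 C ⊔ lid Λ ∧
      (fr Λ + fr (Zm C) + 1 ≤ fr C ∨ fr Λ + fr (Len C) + 2 * fr (Zm C) ≤ 2 * fr C) := by
  intro r
  induction r using Nat.strong_induction_on with
  | _ r ih =>
  intro C y hy hD e hqe he hr
  by_cases hN : NoSp C
  · refine ⟨Zm C, le_rfl, Zm_le_Len C, P2 hN hqe he, Or.inr ?_⟩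
    have h1 := Len_le hy C
    have h2 := fr_le (Zm_le_Dd C y)
    omega
  · rw [NoSp] at hN
    push Not at hN
    obtain ⟨x, hx, hxD⟩ := hN
    obtain ⟨w, hw, hwZ⟩ := Set.not_subset.1 hxD
    have hlt := fr_lt (Zm_le_Dd C x) hw hwZ
    by_cases hq : q ∈ lid (Lam x C)
    · refine ⟨Lam x C, Zm_le_Lam hx C, Lam_le_Len x C, Submodule.mem_sup_right hq, Or.inl ?_⟩
      have := fr_Lam hx C
      omega
    · obtain ⟨y', hy', hD'⟩ := exists_partner hx hy hD hxD
      have h1 := Ph_SC (x := x) hqe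
      rw [map_smul, smul_eq_mul] at h1
      have h2 := ((lid_prime _).mem_or_mem h1).resolve_left hq
      obtain ⟨m, hm, hme⟩ := exists_Ph h2
      obtain ⟨f, hf⟩ := ker_Ph hx (v := e - m) (by rw [map_sub, hme, sub_self])
      have hf1 : f ∉ I2 C ⊔ lid (Dd x C) := by
        intro h
        apply he
        rw [← sub_add_cancel e m, hf]
        exact add_mem ((Kp hx).2 h) hm
      have hf2 : q * f ∈ I2 C ⊔ lid (Dd x C) := by
        rw [← Kp hx, ← smul_eq_mul, map_smul, ← hf, smul_sub]
        exact sub_mem hqe (Submodule.smul_mem _ _ hm)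
      set D := Dd x C with hDdef
      set C' := C ⊔ D.prod D with hC'
      have hDL : D ≤ Len C := Dd_le_Len hx C
      have hy0 := (dt_ne hy').2
      have hD1 : Dd y' C' ≤ D := by
        intro w hw
        rw [mem_Dd] at hw
        obtain ⟨c, hc, v, hv, e1⟩ := Submodule.mem_sup.1 hw
        have e2 := VV_decomp hy' v
        have e3 : em y' (w + ph x v) = c + em x (ph y' v) := by
          rw [map_add, ← e1]; nth_rewrite 1 [e2]; abel
        have h3 : w + ph x v ∈ Dd y' C := by
          rw [mem_Dd, e3]; exact C.add_mem hc (prod_ph hv y')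
        have h4 := sub_mem (Zm_le_Dd C x (hD' h3)) (prod_ph hv x)
        simpa using h4
      have hZ : D ≤ Zm C' := le_Zm le_sup_right
      have hZD := Zm_le_Dd C' y'
      have hZe : Zm C' = D := le_antisymm (hZD.trans hD1) hZ
      have hDe : Dd y' C' = D := le_antisymm hD1 (hZ.trans hZD)
      have hLe : Len C' = Len C := Len_add C hDL
      have hI : ∀ Λ, D ≤ Λ → I2 C' ⊔ lid Λ ≤ I2 C ⊔ lid Λ := by
        intro Λ hΛ
        exact sup_le ((I2_add_le C D).trans (sup_le_sup_left (lid_mono hΛ) _)) le_sup_right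
      have hfr : fr C' + fr (Zm C) ≤ fr C + fr D := fr_add_prod hy'
      have hDlen := fr_le hDL
      obtain ⟨Λ, i1, i2, i3, i4⟩ := ih (fr (Len C) - fr D) (by omega) C' y' hy0 (by rw [hDe, hZe]) (Em y' f)
        (by
          rw [← map_smul, smul_eq_mul, Kp hy0, hDe]
          exact (sup_le_sup_right (I2_mono le_sup_left) _) hf2)
        (by
          rw [Kp hy0, hDe]
          exact fun h => hf1 (hI D le_rfl h))
        (by rw [hLe, hZe]; omega)
      rw [hZe] at i1 i4
      rw [hLe] at i2 i4
      refine ⟨Λ, (Zm_le_Dd C x).trans i1, i2, hI Λ i1 i3, ?_⟩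
      rcases i4 with i4 | i4 <;> [left; right] <;> omega

theorem W' [IsAlgClosed k] {q : Pol k N} {C : Submodule k (VV k N)} {y : k × k} (hy : y ≠ 0) (hD : Dd y C ≤ Zm C) {e : M2 k N}
    (hq : q • e ∈ SC C) (he : e ∉ SC C) : ∃ Λ, Zm C ≤ Λ ∧ Λ ≤ Len C ∧ q ∈ I2 C ⊔ lid Λ ∧
      (fr Λ + fr (Zm C) + 1 ≤ fr C ∨ fr Λ + fr (Len C) + 2 * fr (Zm C) ≤ 2 * fr C) :=
  WW' (fr (Len C)) C y hy hD e hq he (by omega)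

theorem pd_b [IsAlgClosed k] {q : Pol k N} (hq : q.IsHomogeneous 2) {C : Submodule k (VV k N)} {y : k × k} (hy : y ≠ 0) (hD : Dd y C ≤ Zm C)
    {d : ℕ} (h1 : fr (Len C) + 1 ≤ d) (h2 : fr (Len C) + fr C ≤ 2 * fr (Zm C) + 1 + d) (h3 : 2 * fr C ≤ 3 * fr (Zm C) + d) :
    PD (Pol k N) (M2 k N ⧸ (SC C ⊔ qM q)) d := by
  by_cases h : ∀ e, q • e ∈ SC C → e ∈ SC C
  · exact (PD.nzd _ _ h (pd_Len C)).mono h1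
  · push Not at h
    obtain ⟨e, he1, he2⟩ := h
    obtain ⟨Λ, i1, i2, i3, i4⟩ := W' hy hD he1 he2
    have := fr_le i1
    refine (pd_Var2 (d := fr (Len C) + fr Λ - fr (Zm C)) hq i1 i2 i3 (by omega)).mono ?_
    omega
end field
end QPD

namespace QPD
open MvPolynomial

section field
variable {k : Type u} [Field k] {N : ℕ}

/-- stripping data. -/
structure Strip (C C' : Submodule k (VV k N)) (Λ : Submodule k (Vec k N)) (v : M2 k N) : Prop where
  le : C ≤ C'
  len : Len C' = Len C
  frC : fr C' = fr C + 1
  z : fr (Zm C) + 1 ≤ fr (Zm C')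
  sc : SC C' = SC C ⊔ Submodule.span (Pol k N) {v}
  col : col (SC C) v = lid Λ
  frΛ : fr Λ + fr (Zm C) + 1 ≤ fr C
  i2 : I2 C' ≤ I2 C ⊔ lid (Zm C')

theorem exists_strip {C : Submodule k (VV k N)} (h : 2 * fr C ≤ fr (Len C) + 3 * fr (Zm C) + 2) (hN : ¬ NoSp C) :
    ∃ C' Λ v, Strip C C' Λ v := by
  rw [NoSp] at hN
  push Not at hN
  obtain ⟨x, hx, hxD⟩ := hN
  obtain ⟨d, hd, hdZ⟩ := Set.not_subset.1 hxD
  change d ∈ Dd x C at hd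
  have hlt := fr_lt (Zm_le_Dd C x) hd hdZ
  obtain ⟨y, hy⟩ := exists_dt hx
  have hyd : em y d ∉ C := fun hh => hdZ (mem_Zm_of (by rw [hy]; exact one_ne_zero) hd hh)
  have hphd : ph x (em y d) = -d := by rw [ph_em', hy]; simp
  have hphd' : ph y (em x d) = d := by rw [ph_em', show dt y x = -1 by rw [← hy, dt, dt]; ring]; simp
  have hle : C ≤ C ⊔ Submodule.span k {em y d} := le_sup_left
  have hdC' : d ∈ Zm (C ⊔ Submodule.span k {em y d}) := mem_Zm_of (by rw [hy]; exact one_ne_zero) (hle hd)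
        (Submodule.mem_sup_right (Submodule.mem_span_singleton_self _))
  refine ⟨C ⊔ Submodule.span k {em y d}, Lam x C, vl (em y d), hle, ?_, ?_, ?_, SC_add C _, ?_, ?_, ?_⟩
  · refine le_antisymm ?_ (Len_mono hle)
    rw [← Len_add C (Dd_le_Len hx C)]
    refine Len_mono (sup_le_sup_left ?_ _)
    rw [Submodule.span_singleton_le_iff_mem]
    exact prod_em hd y
  · have h1 := fr_lt hle (Submodule.mem_sup_right (Submodule.mem_span_singleton_self _)) hyd
    have h2 := fr_sup_le C (Submodule.span k {em y d})
    have h3 := fr_span_one (k := k) (em y d)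
    omega
  · exact fr_lt (Zm_mono hle) hdC' hdZ
  · apply le_antisymm
    · intro f hf
      rw [mem_col] at hf
      have h1 := Ph_SC (x := x) hf
      rw [map_smul, Ph_vl, hphd, map_neg, smul_eq_mul, mul_neg, neg_mem_iff] at h1
      by_cases hdΛ : d ∈ Lam x C
      · obtain ⟨c, hc, hcd⟩ := Submodule.neg_mem _ hdΛ
        have hcC : c ∈ C := hc
        have e1 := VV_decomp hy c
        have hα : ph y c ∉ Lam x C ∧ Dd x C ≤ Lam x C := by
          have hK := Len_K hy C
          have hxdK : em x d ∈ KK x y C := mem_KK.2 ⟨hd, by rw [hphd']; exact hdΛ⟩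
          have hxdZ : em x d ∉ (Zm C).prod (Zm C) := by
            intro hh
            have := prod_ph hh y
            rw [hphd'] at this
            exact hdZ this
          have hK1 := fr_lt (ZZ_le_KK hy C) hxdK hxdZ
          have hlt1 := fr_lt (le_sup_left : (Zm C).prod (Zm C) ≤ (Zm C).prod (Zm C) ⊔ Submodule.span k {em x d})
            (Submodule.mem_sup_right (Submodule.mem_span_singleton_self _)) hxdZ
          rw [fr_prod] at hK1 hlt1
          constructor
          · intro hα
            have hcK : c ∈ KK x y C := ⟨hcC, hα⟩
            have hcn : c ∉ (Zm C).prod (Zm C) ⊔ Submodule.span k {em x d} := by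
              intro hh
              obtain ⟨a, ha, b, hb, e⟩ := Submodule.mem_sup.1 hh
              obtain ⟨t, rfl⟩ := Submodule.mem_span_singleton.1 hb
              have := congrArg (ph x) e
              rw [map_add, map_smul, ph_em, smul_zero, add_zero, hcd] at this
              have h5 := prod_ph ha x
              rw [this, neg_mem_iff] at h5
              exact hdZ h5
            have hlt2 := fr_lt (sup_le (ZZ_le_KK hy C) ((Submodule.span_singleton_le_iff_mem _ _).2 hxdK)) hcK hcn
            omega
          · have h6 : Zm C ⊔ Submodule.span k {d} = Dd x C := by
              apply Submodule.eq_of_le_of_finrank_le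
              · exact sup_le (Zm_le_Dd C x) ((Submodule.span_singleton_le_iff_mem _ _).2 hd)
              · have := fr_lt (le_sup_left : Zm C ≤ Zm C ⊔ Submodule.span k {d})
                  (Submodule.mem_sup_right (Submodule.mem_span_singleton_self _)) hdZ
                change fr (Dd x C) ≤ fr (Zm C ⊔ Submodule.span k {d})
                omega
            rw [← h6]
            exact sup_le (Zm_le_Lam hx C) ((Submodule.span_singleton_le_iff_mem _ _).2 hdΛ)
        obtain ⟨hα, hDΛ⟩ := hα
        rw [hcd, map_neg, sub_neg_eq_add] at e1
        have h7 : Em x (f * lf (ph y c)) ∈ SC C := by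
          have : Em x (f * lf (ph y c)) = f • vl c - f • vl (em y d) := by
            rw [← smul_eq_mul, map_smul, ← vl_em, ← smul_sub, ← map_sub]
            congr 2
            nth_rewrite 2 [e1]; abel
          rw [this]
          exact sub_mem (Submodule.smul_mem _ _ (vl_mem_SC hcC)) hf
        have h8 := sup_le (I2_le_Lam hx C) (lid_mono hDΛ) ((Kp hx).1 h7)
        exact ((lid_prime _).mem_or_mem h8).resolve_right (fun h => hα (lf_mem_lid_iff.1 h))
      · exact ((lid_prime _).mem_or_mem h1).resolve_right (fun h => hdΛ (lf_mem_lid_iff.1 h))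
    · refine Ideal.span_le.2 ?_
      rintro _ ⟨_, ⟨c, hc, rfl⟩, rfl⟩
      change _ ∈ col (SC C) _
      rw [mem_col]
      have := minor_id x c (em y d)
      rw [hphd, sub_eq_iff_eq_add] at this
      rw [this]
      refine add_mem (Em_lid ?_) (Submodule.smul_mem _ _ (vl_mem_SC hc))
      exact mn_lid_right (prod_em hd y)
  · have := fr_Lam hx C
    omega
  · set C' := C ⊔ Submodule.span k {em y d}
    refine le_trans (I2_mono (sup_le_sup_left (?_ : Submodule.span k {em y d} ≤ (Zm C').prod (Zm C')) C)) (I2_add_le C _)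
    rw [Submodule.span_singleton_le_iff_mem]
    exact prod_em hdC' y

theorem NoSp_of {C : Submodule k (VV k N)} (h : 2 * fr C ≤ fr (Len C) + 3 * fr (Zm C)) : NoSp C := by
  intro x hx w hw
  by_contra hwZ
  have h1 := fr_lt (Zm_le_Dd C x) hw hwZ
  have h2 := Len_le hx C
  omega

theorem NoSp_ge {C : Submodule k (VV k N)} (h : ¬ NoSp C) : fr (Len C) + 3 * fr (Zm C) + 1 ≤ 2 * fr C := by
  by_contra hh
  exact h (NoSp_of (by omega))

theorem pd_NoSp' [IsAlgClosed k] {C : Submodule k (VV k N)} (hC : NoSp C) {d : ℕ} (hd : fr C ≤ fr (Zm C) + d) :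
    PD (Pol k N) (M2 k N ⧸ SC C) d := by
  have h1 := two_z_le C
  exact (pd_NoSp (fr C - 2 * fr (Zm C)) C hC (by omega)).mono (by omega)

theorem pd_S [IsAlgClosed k] : ∀ (r : ℕ) (_ : r ≤ 2) (C : Submodule k (VV k N)) (_ : 2 * fr C ≤ fr (Len C) + 3 * fr (Zm C) + r)
    (d : ℕ) (_ : fr C ≤ fr (Zm C) + d), PD (Pol k N) (M2 k N ⧸ SC C) d
  | 0, _, C, h, d, hd => pd_NoSp' (NoSp_of h) hd
  | r+1, hr, C, h, d, hd => by
    by_cases hN : NoSp C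
    · exact pd_NoSp' hN hd
    · obtain ⟨C', Λ, v, s⟩ := exists_strip (by omega) hN
      have s1 := s.frC
      have s2 := s.z
      have s3 := s.frΛ
      refine cyc_mid _ v ?_ ?_
      · rw [s.col]; exact (pd_lid Λ).mono (show fr Λ ≤ d by omega)
      · rw [← s.sc]; exact pd_S r (by omega) C' (by rw [s.len]; omega) d (by omega)

theorem pd_S' [IsAlgClosed k] {C : Submodule k (VV k N)} (h : 2 * fr C ≤ fr (Len C) + 3 * fr (Zm C) + 2)
    {d : ℕ} (hd : fr C ≤ fr (Zm C) + d) : PD (Pol k N) (M2 k N ⧸ SC C) d := pd_S 2 le_rfl C h d hd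
end field
end QPD

namespace QPD
open MvPolynomial

section field
variable {k : Type u} [Field k] {N : ℕ}

theorem indep [Infinite k] {ι : Type*} [Fintype ι] [DecidableEq ι] {u w : ι → Vec k N} (hu : LinearIndependent k u) (F : Finset k) :
    ∃ t ∉ F, LinearIndependent k (fun i => u i + t • w i) := by
  classical
  obtain ⟨g, hg⟩ := LinearMap.exists_leftInverse_of_injective (Fintype.linearCombination k u)
    (by rw [LinearMap.ker_eq_bot]; exact linearIndependent_iff_injective_fintypeLinearCombination.1 hu)
  have hgu : ∀ i, g (u i) = Pi.single i 1 := by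
    intro i
    have := LinearMap.congr_fun hg (Pi.single i 1)
    simpa using this
  let M : Matrix ι ι k := fun i => g (w i)
  let P : Polynomial k := (1 + (Polynomial.X : Polynomial k) • M.map Polynomial.C).det
  have hP : ∀ t, P.eval t = (1 + t • M).det := by
    intro t
    change (Polynomial.evalRingHom t) P = _
    rw [RingHom.map_det]
    congr 1
    ext i j
    simp [Matrix.one_apply, apply_ite]
    try ring
  have hP0 : P ≠ 0 := by
    intro h
    have := hP 0
    rw [h] at this
    simp at this
  obtain ⟨t, ht⟩ := Infinite.exists_notMem_finset (F ∪ P.roots.toFinset)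
  rw [Finset.mem_union, not_or] at ht
  refine ⟨t, ht.1, ?_⟩
  have hdet : (1 + t • M).det ≠ 0 := by
    rw [← hP]
    intro h
    exact ht.2 (by rw [Multiset.mem_toFinset, Polynomial.mem_roots hP0]; exact h)
  have := Matrix.linearIndependent_rows_of_det_ne_zero hdet
  refine LinearIndependent.of_comp g ?_
  have e : (g ∘ fun i => u i + t • w i) = fun i => (1 + t • M) i := by
    ext i j
    by_cases hij : i = j
    · subst hij; simp [hgu, M]; rfl
    · simp [hgu, M, hij, Ne.symm hij]; rfl
  rw [e]
  exact this

/-- `x` maximizes. -/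
def Mx (C : Submodule k (VV k N)) (x : k × k) : Prop := x ≠ 0 ∧ ∀ y, y ≠ 0 → fr (Lam y C) ≤ fr (Lam x C)

theorem exists_Mx (C : Submodule k (VV k N)) : ∃ x, Mx C x := by
  classical
  have hb : ∀ x, fr (Lam x C) ≤ fr C := fun x => Submodule.finrank_map_le (ph x) C
  let P : ℕ → Prop := fun n => ∃ x : k × k, x ≠ 0 ∧ fr (Lam x C) = n
  have h0 : P (fr (Lam (1, 0) C)) := ⟨(1, 0), by simp, rfl⟩
  obtain ⟨x, hx, e⟩ := Nat.findGreatest_spec (P := P) (hb (1, 0)) h0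
  refine ⟨x, hx, fun y hy => ?_⟩
  rw [e]
  exact Nat.le_findGreatest (hb y) ⟨y, hy, rfl⟩

theorem fr_ge_card {ι : Type*} [Fintype ι] {v : ι → Vec k N} (hv : LinearIndependent k v) {W : Submodule k (Vec k N)} (h : ∀ i, v i ∈ W) :
    Fintype.card ι ≤ fr W := by
  rw [← finrank_span_eq_card hv]
  exact fr_le (Submodule.span_le.2 (by rintro _ ⟨i, rfl⟩; exact h i))

theorem ph_add (x y : k × k) (t : k) (v : VV k N) : ph (x + t • y) v = ph x v + t • ph y v := by
  simp only [ph_apply, Prod.fst_add, Prod.snd_add, Prod.smul_fst, Prod.smul_snd, smul_eq_mul, add_smul, mul_smul, smul_sub]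
  abel

theorem add_ne {x y : k × k} (h : dt x y = 1) (t : k) : x + t • y ≠ 0 := by
  have : dt (x + t • y) y = 1 := by rw [← h]; simp [dt]; ring
  exact (dt_ne this).1

theorem Mx.gen [Infinite k] {C : Submodule k (VV k N)} {x y : k × k} (h : Mx C x) (hy : dt x y = 1) (F : Finset k) :
    ∃ t ∉ F, Mx C (x + t • y) := by
  obtain ⟨c, hc, hli, -, -⟩ := adapted h.1 C
  obtain ⟨t, ht, hli'⟩ := indep (w := fun i => ph y (c i)) hli F
  refine ⟨t, ht, add_ne hy t, fun z hz => (h.2 z hz).trans ?_⟩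
  have := fr_ge_card hli' (W := Lam (x + t • y) C) (fun i => ⟨c i, hc i, ph_add x y t (c i)⟩)
  rwa [Fintype.card_fin] at this

theorem Mx.Dd_le [Infinite k] {C : Submodule k (VV k N)} {x : k × k} (h : Mx C x) : Dd x C ≤ Lam x C := by
  intro d hd
  by_contra hdΛ
  obtain ⟨y, hy⟩ := exists_dt h.1
  obtain ⟨c, hc, hli, hsp, -⟩ := adapted h.1 C
  have hli1 := hli.option (x := d) (by rw [hsp]; exact hdΛ)
  obtain ⟨t, ht, hli'⟩ := indep (w := fun o => Option.casesOn' o (0 : Vec k N) (fun i => ph y (c i))) hli1 {0}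
  rw [Finset.mem_singleton] at ht
  have := fr_ge_card hli' (W := Lam (x + t • y) C) (by
    rintro (_ | i)
    · simp only [Option.casesOn'_none, smul_zero, add_zero]
      refine ⟨t⁻¹ • em x d, C.smul_mem _ hd, ?_⟩
      rw [ph_add, map_smul, ph_em, smul_zero, zero_add, map_smul, ph_em', smul_smul, mul_inv_cancel₀ ht, one_smul,
        show dt y x = -1 by rw [← hy, dt, dt]; ring]
      simp
    · exact ⟨c i, hc i, ph_add x y t (c i)⟩)
  rw [Fintype.card_option, Fintype.card_fin] at this
  have h2 := h.2 _ (add_ne hy t)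
  change fr (Lam x C) + 1 ≤ _ at this
  omega

theorem mem_Lam_of {C : Submodule k (VV k N)} {x y : k × k} (h : dt x y ≠ 0) {d} (hd : d ∈ Dd y C) : d ∈ Lam x C := by
  have := ph_mem_Lam (x := x) (show em y d ∈ C from hd)
  rw [ph_em', Submodule.smul_mem_iff _ (neg_ne_zero.2 h)] at this
  exact this

theorem Mx.smul {C : Submodule k (VV k N)} {x : k × k} (h : Mx C x) {a : k} (ha : a ≠ 0) : Mx C (a • x) :=
  ⟨smul_ne_zero ha h.1, fun y hy => by rw [Lam_smul ha]; exact h.2 y hy⟩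

theorem sp_mem {C : Submodule k (VV k N)} (h : ∀ x : k × k, x ≠ 0 → ¬ Dd x C ≤ Zm C) {x : k × k} (hx : x ≠ 0) : ∃ d ∈ Dd x C, d ∉ Zm C :=
  Set.not_subset.1 (h x hx)

theorem dt_swap (x y : k × k) : dt y x = - dt x y := by rw [dt, dt]; ring

theorem NF_aux [Infinite k] {C : Submodule k (VV k N)} (h : ∀ x : k × k, x ≠ 0 → ¬ Dd x C ≤ Zm C) :
    ∃ x y, ∃ d e : Vec k N, dt x y = 1 ∧ Mx C x ∧ Mx C y ∧ d ∈ Dd x C ∧ d ∉ Zm C ∧ e ∈ Dd y C ∧ e ∉ Zm C ∧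
      (Dd x C).map (em x) ⊔ (Dd y C).map (em y) ≤ KK x y C ∧
      fr (Dd x C) + fr (Dd y C) = fr ((Dd x C).map (em x) ⊔ (Dd y C).map (em y)) ∧
      ∃ b ∈ KK x y C, b ∉ (Dd x C).map (em x) ⊔ (Dd y C).map (em y) ∧ ph y b = -e := by
  obtain ⟨x, hx⟩ := exists_Mx C
  obtain ⟨y0, hy0⟩ := exists_dt hx.1
  obtain ⟨t, ht, hM⟩ := hx.gen hy0 {0}
  rw [Finset.mem_singleton] at ht
  have hM' := hM.smul (inv_ne_zero ht)
  set y := t⁻¹ • (x + t • y0) with hydef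
  have hy : dt x y = 1 := by
    rw [hydef, dt_smul, show dt x (x + t • y0) = t * dt x y0 by simp [dt]; ring, hy0, mul_one, inv_mul_cancel₀ ht]
  have hyx : dt y x = -1 := by rw [dt_swap, hy]
  obtain ⟨d, hd, hdZ⟩ := sp_mem h hx.1
  obtain ⟨e, he, heZ⟩ := sp_mem h hM'.1
  have heΛ := hM'.Dd_le he
  obtain ⟨b, hb, hbe⟩ := Submodule.neg_mem _ heΛ
  have hone : dt x y ≠ 0 := by rw [hy]; exact one_ne_zero
  refine ⟨x, y, d, e, hy, hx, hM', hd, hdZ, he, heZ, ?_, ?_, b, mem_KK.2 ⟨hb, ?_⟩, ?_, hbe⟩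
  · refine sup_le ?_ ?_ <;> rintro _ ⟨w, hw, rfl⟩
    · refine mem_KK.2 ⟨hw, ?_⟩
      rw [ph_em', hyx]
      simpa using hx.Dd_le hw
    · refine mem_KK.2 ⟨hw, ?_⟩
      rw [ph_em]; exact zero_mem _
  · have h1 := Submodule.finrank_sup_add_finrank_inf_eq ((Dd x C).map (em x)) ((Dd y C).map (em y))
    rw [← (Submodule.equivMapOfInjective _ (em_inj hx.1) (Dd x C)).finrank_eq, ← (Submodule.equivMapOfInjective _ (em_inj hM'.1) (Dd y C)).finrank_eq] at h1
    have h2 : (Dd x C).map (em x) ⊓ (Dd y C).map (em y) = ⊥ := by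
      rw [eq_bot_iff]
      rintro v ⟨⟨a, -, rfl⟩, ⟨b, -, hb⟩⟩
      have := congrArg (ph y) hb
      rw [ph_em, ph_em', hyx] at this
      simp at this
      rw [← this]; simp
    rw [h2, finrank_bot, add_zero] at h1
    exact h1.symm
  · rw [hbe]; exact neg_mem (mem_Lam_of hone he)
  · intro hbb
    obtain ⟨_, ⟨p, hp, rfl⟩, _, ⟨r, hr, rfl⟩, rfl⟩ := Submodule.mem_sup.1 hbb
    rw [map_add, ph_em, add_zero, ph_em', hyx] at hbe
    simp at hbe
    rw [hbe] at hp
    exact heZ (mem_Zm_of hone (mem_Dd.1 (by simpa using (Dd x C).neg_mem hp)) he)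

theorem NF1 [Infinite k] {C : Submodule k (VV k N)} (h : ∀ x : k × k, x ≠ 0 → ¬ Dd x C ≤ Zm C) :
    fr (Len C) + 3 * fr (Zm C) + 4 ≤ 2 * fr C := by
  obtain ⟨x, y, d, e, hy, hx, hyM, hd, hdZ, he, heZ, hle, hfr, b, hb, hb', -⟩ := NF_aux h
  have h1 := Len_K hy C
  have h2 := fr_lt hle hb hb'
  have h3 := fr_lt (Zm_le_Dd C x) hd hdZ
  have h4 := fr_lt (Zm_le_Dd C y) he heZ
  omega

theorem fr_le_of_span {E : Type*} [AddCommGroup E] [Module k E] [FiniteDimensional k E] {W : Submodule k E} (h : fr W ≤ 1) {d w} (hd : d ∈ W) (hd0 : d ≠ 0) (hw : w ∈ W) :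
    ∃ a : k, w = a • d := by
  have hle : Submodule.span k {d} ≤ W := (Submodule.span_singleton_le_iff_mem _ _).2 hd
  have := Submodule.eq_of_le_of_finrank_le hle (by rw [finrank_span_singleton hd0]; exact h)
  rw [← this] at hw
  obtain ⟨a, ha⟩ := Submodule.mem_span_singleton.1 hw
  exact ⟨a, ha.symm⟩

theorem NF2 [Infinite k] {C : Submodule k (VV k N)} (h : ∀ x : k × k, x ≠ 0 → ¬ Dd x C ≤ Zm C)
    (hz : fr (Zm C) = 0) (hL : fr (Len C) + 4 = 2 * fr C) :
    ∃ x y, ∃ d e : Vec k N, ∃ a b : k, dt x y = 1 ∧ em x d ∈ C ∧ em y e ∈ C ∧ a ≠ 0 ∧ b ≠ 0 ∧ a • em x e + b • em y d ∈ C ∧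
      LinearIndependent k ![d, e] := by
  obtain ⟨x, y, d, e, hy, hx, hyM, hd, hdZ, he, heZ, hle, hfr, b, hb, hb', hbe⟩ := NF_aux h
  have hone : dt x y ≠ 0 := by rw [hy]; exact one_ne_zero
  have hyx : dt y x = -1 := by rw [dt_swap, hy]
  have hZ : ∀ w, w ∉ Zm C → w ≠ 0 := by rintro _ h rfl; exact h (zero_mem _)
  have h1 := Len_K hy C
  have h2 := fr_lt hle hb hb'
  have h3 := fr_lt (Zm_le_Dd C x) hd hdZ
  have h4 := fr_lt (Zm_le_Dd C y) he heZ
  have hKe : (Dd x C).map (em x) ⊔ (Dd y C).map (em y) ⊔ Submodule.span k {b} = KK x y C := by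
    have hl := (fr_lt (le_sup_left : (Dd x C).map (em x) ⊔ (Dd y C).map (em y) ≤ (Dd x C).map (em x) ⊔ (Dd y C).map (em y) ⊔ Submodule.span k {b})
      (Submodule.mem_sup_right (Submodule.mem_span_singleton_self _)) hb')
    apply Submodule.eq_of_le_of_finrank_le (sup_le hle ((Submodule.span_singleton_le_iff_mem _ _).2 hb))
    change fr (KK x y C) ≤ fr ((Dd x C).map (em x) ⊔ (Dd y C).map (em y) ⊔ Submodule.span k {b})
    omega
  obtain ⟨t, ht, hM⟩ := hx.gen hy {0}
  rw [Finset.mem_singleton] at ht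
  obtain ⟨d1, hd1, hd1Z⟩ := sp_mem h hM.1
  have hxm : dt x (x + t • y) ≠ 0 := by
    rw [show dt x (x + t • y) = t * dt x y by simp [dt]; ring, hy, mul_one]; exact ht
  have hym : dt y (x + t • y) ≠ 0 := by
    rw [show dt y (x + t • y) = dt y x by simp [dt]; ring, hyx]; simp
  have hd1x := mem_Lam_of hxm hd1
  obtain ⟨c, hc, hcd⟩ := mem_Lam_of hym hd1
  have hcK : c ∈ KK x y C := mem_KK.2 ⟨hc, by rw [hcd]; exact hd1x⟩
  rw [← hKe] at hcK
  obtain ⟨_, hv, _, hbb, rfl⟩ := Submodule.mem_sup.1 hcK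
  obtain ⟨_, ⟨p, hp, rfl⟩, _, ⟨r, hr, rfl⟩, rfl⟩ := Submodule.mem_sup.1 hv
  obtain ⟨s, rfl⟩ := Submodule.mem_span_singleton.1 hbb
  rw [map_add, map_add, ph_em, add_zero, ph_em', hyx, map_smul, hbe] at hcd
  obtain ⟨p', rfl⟩ := fr_le_of_span (by omega) hd (hZ _ hdZ) hp
  have e1 : d1 = p' • d + (-s) • e := by rw [← hcd]; simp
  have e2 : em (x + t • y) d1 = em x d1 + t • em y d1 := by
    simp only [em_apply]; ext i <;> simp <;> ring
  have hmem : em x d1 + t • em y d1 ∈ C := by rw [← e2]; exact hd1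
  have hp0 : p' ≠ 0 := by
    rintro rfl
    rw [zero_smul, zero_add] at e1
    have : em y d1 ∈ C := by rw [e1]; exact (Dd y C).smul_mem _ he
    exact hd1Z (mem_Zm_of hym this hd1)
  have hs0 : -s ≠ 0 := by
    intro h0
    rw [h0, zero_smul, add_zero] at e1
    have : em x d1 ∈ C := by rw [e1]; exact (Dd x C).smul_mem _ hd
    exact hd1Z (mem_Zm_of hxm this hd1)
  refine ⟨x, y, d, e, -s, t * p', hy, hd, he, hs0, mul_ne_zero ht hp0, ?_, ?_⟩
  · have : (-s) • em x e + (t * p') • em y d = (em x d1 + t • em y d1) - p' • em x d - (t * (-s)) • em y e := by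
      rw [e1, map_add, map_add, map_smul, map_smul, map_smul, map_smul, smul_add, smul_smul, smul_smul]
      abel
    rw [this]
    exact sub_mem (sub_mem hmem (C.smul_mem _ hd)) (C.smul_mem _ he)
  · rw [LinearIndependent.pair_iff]
    intro α β hαβ
    have hβ : β = 0 := by
      by_contra hβ
      have : e = (-(β⁻¹ * α)) • d := by
        have := congrArg (fun v => β⁻¹ • v) hαβ
        simp only [smul_add, smul_smul, inv_mul_cancel₀ hβ, one_smul, smul_zero] at this
        rw [neg_smul]; exact eq_neg_of_add_eq_zero_right this
      exact heZ (mem_Zm_of hone (show em x e ∈ C by rw [this]; exact (Dd x C).smul_mem _ hd) he)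
    rw [hβ, zero_smul, add_zero] at hαβ
    exact ⟨(smul_eq_zero.1 hαβ).resolve_right (hZ _ hdZ), hβ⟩
end field
end QPD

namespace QPD
open MvPolynomial

section field
variable {k : Type u} [Field k] {N : ℕ}

theorem mn_self (u : VV k N) : mn u u = 0 := by rw [mn]; ring
theorem mn_swap (u v : VV k N) : mn v u = - mn u v := by rw [mn, mn]; ring
theorem mn_add_right (u v w : VV k N) : mn u (v + w) = mn u v + mn u w := by
  simp only [mn, Prod.fst_add, Prod.snd_add, map_add]; ring
theorem mn_smul_right (a : k) (u v : VV k N) : mn u (a • v) = C a * mn u v := by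
  simp only [mn, Prod.smul_fst, Prod.smul_snd, lf_smul]; ring
theorem mn_zero_right (u : VV k N) : mn u 0 = 0 := by simp [mn]

theorem mn_span_mem {T : Set (VV k N)} {J : Ideal (Pol k N)} {u : VV k N} (h : ∀ v ∈ T, mn u v ∈ J) {v}
    (hv : v ∈ Submodule.span k T) : mn u v ∈ J := by
  induction hv using Submodule.span_induction with
  | mem v hv => exact h v hv
  | zero => rw [mn_zero_right]; exact zero_mem _
  | add v w _ _ h1 h2 => rw [mn_add_right]; exact add_mem h1 h2
  | smul a v _ h1 => rw [mn_smul_right]; exact J.mul_mem_left _ h1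

theorem I2_span_le {T : Set (VV k N)} {J : Ideal (Pol k N)} (h : ∀ u ∈ T, ∀ v ∈ T, mn u v ∈ J) :
    I2 (Submodule.span k T) ≤ J := by
  refine Ideal.span_le.2 ?_
  rintro _ ⟨u, hu, v, hv, rfl⟩
  refine mn_span_mem (fun v hv => ?_) hv
  rw [← neg_neg (mn u v), ← mn_swap]
  refine neg_mem (mn_span_mem (fun w hw => h v hv w hw) hu)

theorem col_Em {x : k × k} (hx : x ≠ 0) (C : Submodule k (VV k N)) : col (SC C) (Em x 1) = I2 C ⊔ lid (Dd x C) := by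
  ext f
  rw [mem_col, ← Em_eq_smul, Kp hx]

theorem lf_mem_Len {C : Submodule k (VV k N)} {u : VV k N} (hu : u ∈ C) : lf u.1 ∈ kU (Len C) ∧ lf u.2 ∈ kU (Len C) :=
  ⟨lf_mem_kU (Submodule.mem_sup_left ⟨u, hu, rfl⟩), lf_mem_kU (Submodule.mem_sup_right ⟨u, hu, rfl⟩)⟩

theorem mn_mem_kU {C : Submodule k (VV k N)} {u v : VV k N} (hu : u ∈ C) (hv : v ∈ C) : mn u v ∈ kU (Len C) :=
  sub_mem (mul_mem (lf_mem_Len hu).1 (lf_mem_Len hv).2) (mul_mem (lf_mem_Len hu).2 (lf_mem_Len hv).1)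

theorem fr_zero_bot {W : Submodule k (Vec k N)} (h : fr W = 0) : W = ⊥ := Submodule.finrank_eq_zero.1 h

theorem HB [IsAlgClosed k] (u1 u2 u3 : VV k N) :
    PD (Pol k N) (Pol k N ⧸ Ideal.span {mn u1 u2, mn u1 u3, mn u2 u3}) 4 := by
  let C : Submodule k (VV k N) := Submodule.span k {u1, u2, u3}
  have h1 : u1 ∈ C := Submodule.subset_span (by simp)
  have h2 : u2 ∈ C := Submodule.subset_span (by simp)
  have h3 : u3 ∈ C := Submodule.subset_span (by simp)
  by_cases hL : fr (Len C) ≤ 4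
  · refine (var1 (Len C) _ ?_).mono hL
    rintro _ (rfl | rfl | rfl)
    · exact mn_mem_kU h1 h2
    · exact mn_mem_kU h1 h3
    · exact mn_mem_kU h2 h3
  · have hC : fr C ≤ 3 := by
      have e : C = Submodule.span k {u1} ⊔ Submodule.span k {u2} ⊔ Submodule.span k {u3} := by
        rw [← Submodule.span_union, ← Submodule.span_union]
        change Submodule.span k {u1, u2, u3} = _
        congr 1
        ext w
        simp only [Set.mem_insert_iff, Set.mem_singleton_iff, Set.mem_union, or_assoc]
      have a1 := fr_sup_le (Submodule.span k {u1}) (Submodule.span k {u2})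
      have a2 := fr_sup_le (Submodule.span k {u1} ⊔ Submodule.span k {u2}) (Submodule.span k {u3})
      have b1 := fr_span_one (k := k) u1
      have b2 := fr_span_one (k := k) u2
      have b3 := fr_span_one (k := k) u3
      rw [← e] at a2
      omega
    have l1 := Len_le (x := ((1, 0) : k × k)) (by simp) C
    have l2 := fr_le (Zm_le_Dd C ((1, 0) : k × k))
    have hns : ¬ ∀ x : k × k, x ≠ 0 → ¬ Dd x C ≤ Zm C := by
      intro hh
      have : Infinite k := IsAlgClosed.instInfinite
      have := NF1 hh
      omega
    push Not at hns
    obtain ⟨x, hx, hxD⟩ := hns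
    have hz : Zm C = ⊥ := fr_zero_bot (by omega)
    rw [hz, le_bot_iff] at hxD
    have hI : col (SC C) (Em x 1) = Ideal.span {mn u1 u2, mn u1 u3, mn u2 u3} := by
      rw [col_Em hx, hxD, lid_bot, sup_bot_eq]
      apply le_antisymm
      · have m1 : mn u1 u2 ∈ (Ideal.span {mn u1 u2, mn u1 u3, mn u2 u3} : Ideal (Pol k N)) := Ideal.subset_span (by simp)
        have m2 : mn u1 u3 ∈ (Ideal.span {mn u1 u2, mn u1 u3, mn u2 u3} : Ideal (Pol k N)) := Ideal.subset_span (by simp)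
        have m3 : mn u2 u3 ∈ (Ideal.span {mn u1 u2, mn u1 u3, mn u2 u3} : Ideal (Pol k N)) := Ideal.subset_span (by simp)
        refine I2_span_le ?_
        rintro u (rfl | rfl | rfl) v (rfl | rfl | rfl)
        · rw [mn_self]; exact zero_mem _
        · exact m1
        · exact m2
        · have := neg_mem m1; rwa [← mn_swap] at this
        · rw [mn_self]; exact zero_mem _
        · exact m3
        · have := neg_mem m2; rwa [← mn_swap] at this
        · have := neg_mem m3; rwa [← mn_swap] at this
        · rw [mn_self]; exact zero_mem _
      · refine Ideal.span_le.2 ?_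
        rintro _ (rfl | rfl | rfl)
        · exact mn_mem h1 h2
        · exact mn_mem h1 h3
        · exact mn_mem h2 h3
    have p1 : PD (Pol k N) (M2 k N ⧸ SC C) 3 := pd_S' (by omega) (by omega)
    have p2 : fr (Lam x C) ≤ fr C := Submodule.finrank_map_le (ph x) C
    have := cyc_left (SC C) (Em x 1) p1 ((pd_SCX hx C).mono (show fr (Lam x C) ≤ 3 + 1 by omega))
    exact (this.mono (by norm_num)).of_eq hI

theorem lsub_mn (π : Vec k N →ₗ[k] Vec k N) (u v : VV k N) :
    lsub π (mn u v) = mn (π u.1, π u.2) (π v.1, π v.2) := by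
  simp only [mn, map_sub, map_mul, lsub_lf]

theorem HBD [IsAlgClosed k] (W : Submodule k (Vec k N)) (u1 u2 u3 : VV k N) :
    PD (Pol k N) (Pol k N ⧸ (lid W ⊔ Ideal.span {mn u1 u2, mn u1 u3, mn u2 u3})) (4 + fr W) := by
  obtain ⟨π, hπ⟩ := exists_pr' W
  refine pd_lid_sup hπ _ ?_
  rw [Set.image_insert_eq, Set.image_pair, lsub_mn, lsub_mn, lsub_mn]
  exact HB _ _ _

/-- `q` regular or in the annihilator. -/
theorem NoSp_reg [IsAlgClosed k] {C : Submodule k (VV k N)} (hC : NoSp C) (q : Pol k N) :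
    (∀ e, q • e ∈ SC C → e ∈ SC C) ∨ q ∈ I2 C ⊔ lid (Zm C) := by
  by_cases h : q ∈ I2 C ⊔ lid (Zm C)
  · exact Or.inr h
  · refine Or.inl fun e he => ?_
    by_contra h'
    exact h (P2 hC he h')

theorem ann_SC {C : Submodule k (VV k N)} {q : Pol k N} (h : q ∈ I2 C ⊔ lid (Zm C)) : qM q ≤ SC C := by
  intro m hm
  obtain ⟨e, rfl⟩ := mem_qM.1 hm
  obtain ⟨a, ha, b, hb, rfl⟩ := Submodule.mem_sup.1 h
  rw [add_smul]
  exact add_mem (I2_smul ha e) (lid_smul hb e)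

/-- case (a). -/
theorem main_a [IsAlgClosed k] {C : Submodule k (VV k N)} (hC : NoSp C) (q : Pol k N) {d : ℕ}
    (hd : fr C + 1 ≤ fr (Zm C) + d) : PD (Pol k N) (M2 k N ⧸ (SC C ⊔ qM q)) d := by
  have h2 := two_z_le C
  obtain ⟨d, rfl⟩ : ∃ d', d = d' + 1 := ⟨d - 1, by omega⟩
  rcases NoSp_reg hC q with h | h
  · exact PD.nzd (SC C) q h (pd_NoSp' hC (by omega))
  · rw [sup_eq_left.2 (ann_SC h)]
    exact pd_NoSp' hC (by omega)
end field
end QPD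

namespace QPD
open MvPolynomial

section field
variable {k : Type u} [Field k] {N : ℕ}

theorem mem_sup_qM {A : Submodule (Pol k N) (M2 k N)} {q : Pol k N} {m : M2 k N} :
    m ∈ A ⊔ qM q ↔ ∃ s ∈ A, ∃ e, m = s + q • e := by
  constructor
  · intro h
    obtain ⟨s, hs, t, ht, rfl⟩ := Submodule.mem_sup.1 h
    obtain ⟨e, rfl⟩ := mem_qM.1 ht
    exact ⟨s, hs, e, rfl⟩
  · rintro ⟨s, hs, e, rfl⟩
    exact add_mem (Submodule.mem_sup_left hs) (Submodule.mem_sup_right (mem_qM.2 ⟨e, rfl⟩))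

theorem col_mono {A B : Submodule (Pol k N) (M2 k N)} (h : A ≤ B) (v) : col A v ≤ col B v := fun f hf => by
  rw [mem_col] at hf ⊢; exact h hf

theorem q_mem_col (A : Submodule (Pol k N) (M2 k N)) (q : Pol k N) (v : M2 k N) : q ∈ col (A ⊔ qM q) v := by
  rw [mem_col]; exact Submodule.mem_sup_right (mem_qM.2 ⟨v, rfl⟩)

theorem col_reg {A B : Submodule (Pol k N) (M2 k N)} {v : M2 k N} {q : Pol k N}
    (hB : B = A ⊔ Submodule.span (Pol k N) {v}) (hreg : ∀ e, q • e ∈ B → e ∈ B) :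
    col (A ⊔ qM q) v = col A v ⊔ Ideal.span {q} := by
  apply le_antisymm
  · intro f hf
    rw [mem_col, mem_sup_qM] at hf
    obtain ⟨s, hs, e, he⟩ := hf
    have h1 : q • e ∈ B := by
      rw [← sub_eq_iff_eq_add'.2 he, hB]
      exact sub_mem (Submodule.mem_sup_right (Submodule.smul_mem _ _ (Submodule.mem_span_singleton_self _))) (Submodule.mem_sup_left hs)
    have h2 := hreg e h1
    rw [hB] at h2
    obtain ⟨s', hs', t, ht, rfl⟩ := Submodule.mem_sup.1 h2
    obtain ⟨g, rfl⟩ := Submodule.mem_span_singleton.1 ht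
    rw [show f = (f - q * g) + g * q by ring]
    refine add_mem (Submodule.mem_sup_left ?_) (Submodule.mem_sup_right (Ideal.mul_mem_left _ _ (Ideal.mem_span_singleton_self q)))
    rw [mem_col, sub_smul, he, mul_smul]
    rw [show s + q • (s' + g • v) - q • g • v = s + q • s' by rw [smul_add]; abel]
    exact add_mem hs (A.smul_mem _ hs')
  · refine sup_le (col_mono le_sup_left v) ?_
    rw [Ideal.span_le, Set.singleton_subset_iff]
    exact q_mem_col A q v

theorem pd_reg {C : Submodule k (VV k N)} {q : Pol k N} (h : ∀ e, q • e ∈ SC C → e ∈ SC C) {d : ℕ} (hd : fr (Len C) + 1 ≤ d) :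
    PD (Pol k N) (M2 k N ⧸ (SC C ⊔ qM q)) d := (PD.nzd _ _ h (pd_Len C)).mono hd

theorem sup_swap (A : Submodule (Pol k N) (M2 k N)) (B D : Submodule (Pol k N) (M2 k N)) : A ⊔ B ⊔ D = A ⊔ D ⊔ B := by
  rw [sup_assoc, sup_comm B, ← sup_assoc]

theorem Len_Z (C : Submodule k (VV k N)) : fr (Len C) + 3 * fr (Zm C) ≤ 2 * fr C := by
  have l1 := Len_le (x := ((1, 0) : k × k)) (by simp) C
  have l2 := fr_le (Zm_le_Dd C ((1, 0) : k × k))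
  omega

theorem main_c [IsAlgClosed k] {C : Submodule k (VV k N)} {q : Pol k N} (hq : q.IsHomogeneous 2) (hz : fr (Zm C) = 0)
    (hL : 2 * fr C ≤ fr (Len C) + 2) (hN : ¬ NoSp C) {d : ℕ} (hd : 2 * fr C ≤ d) :
    PD (Pol k N) (M2 k N ⧸ (SC C ⊔ qM q)) d := by
  have n0 := NoSp_ge hN
  obtain ⟨C', Λ, v1, s⟩ := exists_strip (by omega) hN
  have s1 := s.frC
  have s2 := s.z
  have s3 := s.frΛ
  have s4 : fr (Len C') = fr (Len C) := by rw [s.len]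
  have lz := Len_Z C'
  have e1 : SC C ⊔ qM q ⊔ Submodule.span (Pol k N) {v1} = SC C' ⊔ qM q := by rw [sup_swap, ← s.sc]
  by_cases hreg : ∀ e, q • e ∈ SC C' → e ∈ SC C'
  · refine cyc_mid _ v1 ?_ ?_
    · rw [col_reg s.sc hreg, s.col]
      exact (pd_one Λ q).mono (show 1 + fr Λ ≤ d by omega)
    · rw [e1]
      exact pd_reg hreg (by omega)
  have hle : Zm C' ≤ Len C := by rw [← s.len]; exact Zm_le_Len C'
  by_cases hN' : NoSp C'
  · have hq' := (NoSp_reg hN' q).resolve_left hreg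
    have hq2 : q ∈ I2 C ⊔ lid (Zm C') := (sup_le s.i2 le_sup_right : I2 C' ⊔ lid (Zm C') ≤ _) hq'
    exact (pd_Var2 (d := fr (Len C) + fr (Zm C')) hq (Zm_mono s.le) hle hq2 (by omega)).mono (by omega)
  have n1 := NoSp_ge hN'
  obtain ⟨C'', Λ2, v2, t⟩ := exists_strip (by omega) hN'
  have t1 := t.frC
  have t2 := t.z
  have t3 := t.frΛ
  have t4 : fr (Len C'') = fr (Len C') := by rw [t.len]
  have lz' := Len_Z C''
  have hN'' : NoSp C'' := NoSp_of (by omega)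
  by_cases hreg2 : ∀ e, q • e ∈ SC C'' → e ∈ SC C''
  · push Not at hreg
    obtain ⟨e, he, heC⟩ := hreg
    have he2 := hreg2 e (SC_mono t.le he)
    rw [t.sc] at he2
    obtain ⟨w, hw, _, hg, rfl⟩ := Submodule.mem_sup.1 he2
    obtain ⟨g, rfl⟩ := Submodule.mem_span_singleton.1 hg
    have hg1 : g ∉ lid Λ2 := by
      rw [← t.col, mem_col]
      exact fun h => heC (add_mem hw h)
    have hg2 : q * g ∈ lid Λ2 := by
      rw [← t.col, mem_col, mul_smul]
      have := sub_mem he ((SC C').smul_mem q hw)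
      rwa [smul_add, add_sub_cancel_left] at this
    have hqΛ : q ∈ lid Λ2 := ((lid_prime Λ2).mem_or_mem hg2).resolve_right hg1
    have hqv : q • v2 ∈ SC C' := by rw [← mem_col, t.col]; exact hqΛ
    rw [s.sc] at hqv
    obtain ⟨w0, hw0, _, hth, hqe⟩ := Submodule.mem_sup.1 hqv
    obtain ⟨θ, rfl⟩ := Submodule.mem_span_singleton.1 hth
    refine cyc_mid _ v1 ?_ ?_
    · have : col (SC C ⊔ qM q) v1 = lid Λ ⊔ Ideal.span {q, θ} := by
        apply le_antisymm
        · intro f hf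
          rw [mem_col, mem_sup_qM] at hf
          obtain ⟨a, ha, e, hfe⟩ := hf
          have h1 : q • e ∈ SC C'' := by
            rw [← sub_eq_iff_eq_add'.2 hfe]
            refine SC_mono t.le ?_
            rw [s.sc]
            exact sub_mem (Submodule.mem_sup_right (Submodule.smul_mem _ _ (Submodule.mem_span_singleton_self _))) (Submodule.mem_sup_left ha)
          have h2 := hreg2 e h1
          rw [t.sc, s.sc] at h2
          obtain ⟨b, hb, _, hg2, rfl⟩ := Submodule.mem_sup.1 h2
          obtain ⟨b, hb', _, hg1, rfl⟩ := Submodule.mem_sup.1 hb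
          obtain ⟨g1, rfl⟩ := Submodule.mem_span_singleton.1 hg1
          obtain ⟨g2, rfl⟩ := Submodule.mem_span_singleton.1 hg2
          rw [show f = (f - g1 * q - g2 * θ) + (g1 * q + g2 * θ) by ring]
          refine add_mem (Submodule.mem_sup_left ?_) (Submodule.mem_sup_right (Ideal.mem_span_pair.2 ⟨g1, g2, rfl⟩))
          rw [← s.col, mem_col]
          have : (f - g1 * q - g2 * θ) • v1 = a + q • b + g2 • w0 := by
            have hw0' : w0 = q • v2 - θ • v1 := eq_sub_of_add_eq hqe
            rw [sub_smul, sub_smul, hfe, hw0']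
            module
          rw [this]
          exact add_mem (add_mem ha ((SC C).smul_mem _ hb')) ((SC C).smul_mem _ hw0)
        · refine sup_le ?_ ?_
          · rw [← s.col]; exact col_mono le_sup_left v1
          · rw [Ideal.span_le]
            rintro _ (rfl | rfl)
            · exact q_mem_col _ _ _
            · change _ ∈ col _ _
              rw [mem_col, mem_sup_qM]
              refine ⟨-w0, neg_mem hw0, v2, ?_⟩
              rw [← hqe]; abel
      rw [this]
      exact (pd_two Λ q θ).mono (show 2 + fr Λ ≤ d by omega)
    · rw [e1]
      refine cyc_mid _ v2 ?_ ?_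
      · rw [col_reg t.sc hreg2, t.col, sup_eq_left.2 ((Ideal.span_singleton_le_iff_mem _).2 hqΛ)]
        exact (pd_lid Λ2).mono (show fr Λ2 ≤ d by omega)
      · rw [sup_swap, ← t.sc]
        exact pd_reg hreg2 (by omega)
  · have hq' := (NoSp_reg hN'' q).resolve_left hreg2
    have hq2 : q ∈ I2 C ⊔ lid (Zm C'') :=
      (sup_le (t.i2.trans (sup_le (s.i2.trans (sup_le_sup_left (lid_mono (Zm_mono t.le)) _)) le_sup_right)) le_sup_right :
        I2 C'' ⊔ lid (Zm C'') ≤ _) hq'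
    exact (pd_Var2 (d := fr (Len C) + fr (Zm C'')) hq (Zm_mono (s.le.trans t.le))
      (by rw [← s.len, ← t.len]; exact Zm_le_Len C'') hq2 (by omega)).mono (by omega)

theorem exists_point [Infinite k] {U : Submodule k (Vec k N)} {q : Pol k N} (h : q ∉ lid U) :
    ∃ c : Vec k N, (∀ v ∈ U, v ⬝ᵥ c = 0) ∧ MvPolynomial.eval c q ≠ 0 := by
  obtain ⟨π, hπ⟩ := exists_pr' U
  have h1 : lsub π q ≠ 0 := fun h0 => h (hπ.mem_iff.2 h0)
  obtain ⟨c', hc'⟩ : ∃ c', MvPolynomial.eval c' (lsub π q) ≠ 0 := by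
    by_contra hh
    push Not at hh
    exact h1 (MvPolynomial.funext fun x => by rw [hh x, map_zero])
  have hev : ∀ v : Vec k N, MvPolynomial.eval c' (lf v) = v ⬝ᵥ c' := by
    intro v; simp [lf_apply, dotProduct]
  let c : Vec k N := fun i => π (Pi.single i 1) ⬝ᵥ c'
  have hc : ∀ v : Vec k N, v ⬝ᵥ c = π v ⬝ᵥ c' := by
    intro v
    have : v = ∑ i, v i • (Pi.single i 1 : Vec k N) := by
      ext j; simp [Finset.sum_apply, Pi.single_apply]
    conv_rhs => rw [this, map_sum, sum_dotProduct]
    rw [dotProduct]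
    refine Finset.sum_congr rfl fun i _ => ?_
    rw [map_smul, smul_dotProduct, smul_eq_mul]
  have hall : ∀ f : Pol k N, MvPolynomial.eval c f = MvPolynomial.eval c' (lsub π f) := by
    intro f
    induction f using MvPolynomial.induction_on with
    | C a => simp [lsub]
    | add p q hp hq => simp [hp, hq]
    | mul_X p i hp => simp only [map_mul, hp]; congr 1; simp [lsub, hev, c]
  refine ⟨c, fun v hv => ?_, ?_⟩
  · rw [hc, hπ.zero v hv, zero_dotProduct]
  · rw [hall]; exact hc'

theorem nzd_of_not_mem [Infinite k] {C : Submodule k (VV k N)} {q : Pol k N} (hq : q.IsHomogeneous 2) (h : q ∉ lid (Len C)) :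
    ∀ e, q • e ∈ SC C → e ∈ SC C := by
  obtain ⟨c, h1, h2⟩ := exists_point h
  intro e he
  refine nzd_quad (U := Len C) ?_ hq h1 h2 he
  rintro _ ⟨v, hv, rfl⟩
  exact lf_mem_Len hv

theorem mn_em (x : k × k) (d : Vec k N) (c : VV k N) : mn (em x d) c = - (lf d * lf (ph x c)) := by
  simp only [mn, em_apply, ph_apply, map_sub, lf_smul]; ring

theorem Lam_smul_em {C : Submodule k (VV k N)} {x : k × k} {d : Vec k N} (hd : em x d ∈ C) {l} (hl : l ∈ Lam x C) (y : k × k) :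
    lf l • vl (em y d) ∈ SC C := by
  obtain ⟨c, hc, rfl⟩ := hl
  have := I2_smul (mn_mem hd hc) (-Em y 1)
  rw [mn_em, neg_smul, smul_neg, neg_neg, ← Em_eq_smul] at this
  rw [vl_em, ← map_smul, smul_eq_mul, mul_comm]
  exact this

theorem main_e [IsAlgClosed k] {C : Submodule k (VV k N)} {q : Pol k N} (hq : q.IsHomogeneous 2)
    (h : ∀ x : k × k, x ≠ 0 → ¬ Dd x C ≤ Zm C) {n0 : ℕ} (hn : fr C ≤ n0) (hn0 : 3 ≤ n0) :
    PD (Pol k N) (M2 k N ⧸ (SC C ⊔ qM q)) (max (3 * n0 - 4) (4 * n0 - 10)) := by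
  have : Infinite k := IsAlgClosed.instInfinite
  have nf := NF1 h
  by_cases hqL : q ∈ lid (Len C)
  swap
  · exact pd_reg (nzd_of_not_mem hq hqL) (by omega)
  by_cases hcase : fr (Zm C) = 0 ∧ fr C = n0 ∧ fr (Len C) + 4 = 2 * fr C ∧ 5 ≤ n0
  swap
  · have hzl := fr_le (Zm_le_Len C)
    exact (pd_Var2 (d := 2 * fr (Len C) - fr (Zm C)) hq (Zm_le_Len C) le_rfl (Submodule.mem_sup_right hqL) (by omega)).mono (by omega)
  obtain ⟨hz, hC, hL, h5⟩ := hcase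
  obtain ⟨x, y, d, e, a, b, hxy, hd, he, ha, hb, hab, hli⟩ := NF2 h hz hL
  have hone : dt x y ≠ 0 := by rw [hxy]; exact one_ne_zero
  have hx0 := (dt_ne hxy).1
  let C0 : Submodule k (VV k N) := C ⊔ Submodule.span k {em y d}
  have hle : C ≤ C0 := le_sup_left
  have hη : em y d ∈ C0 := Submodule.mem_sup_right (Submodule.mem_span_singleton_self _)
  have hdZ : d ∈ Zm C0 := mem_Zm_of hone (hle hd) hη
  have heZ : e ∈ Zm C0 := by
    refine mem_Zm_of hone ?_ (hle he)
    have := C0.sub_mem (hle hab) (C0.smul_mem b hη)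
    rw [add_sub_cancel_right] at this
    exact (C0.smul_mem_iff ha).1 this
  have hfr := fr_sup_le C (Submodule.span k {em y d})
  have hfr1 := fr_span_one (k := k) (em y d)
  have hfrC : fr C0 ≤ fr C + 1 := hfr.trans (by omega)
  have hz2 : 2 ≤ fr (Zm C0) := by
    have := fr_ge_card hli (W := Zm C0) (by intro i; fin_cases i <;> assumption)
    simpa using this
  have hC0 : C0 ≤ C ⊔ (Submodule.span k {d}).prod (Submodule.span k {d}) := by
    refine sup_le_sup_left ?_ _
    rw [Submodule.span_singleton_le_iff_mem]
    exact ⟨Submodule.smul_mem _ _ (Submodule.mem_span_singleton_self _), Submodule.smul_mem _ _ (Submodule.mem_span_singleton_self _)⟩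
  have hLen : Len C0 = Len C := by
    refine le_antisymm ((Len_mono hC0).trans ?_) (Len_mono hle)
    rw [Len_add]
    rw [Submodule.span_singleton_le_iff_mem]
    exact Dd_le_Len hx0 C hd
  have hLen' : fr (Len C0) = fr (Len C) := by rw [hLen]
  have lz := Len_Z C0
  have hNoSp : NoSp C0 := NoSp_of (by omega)
  have hZL : Zm C0 ≤ Len C := by rw [← hLen]; exact Zm_le_Len C0
  rcases NoSp_reg hNoSp q with hreg | hq'
  swap
  · have hI : I2 C0 ≤ I2 C ⊔ lid (Zm C0) := by
      refine (I2_mono hC0).trans ((I2_add_le C _).trans (sup_le_sup_left (lid_mono ?_) _))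
      rw [Submodule.span_singleton_le_iff_mem]; exact hdZ
    have hq2 : q ∈ I2 C ⊔ lid (Zm C0) := (sup_le hI le_sup_right : I2 C0 ⊔ lid (Zm C0) ≤ _) hq'
    exact (pd_Var2 (d := fr (Len C) + fr (Zm C0)) hq (Zm_mono hle) hZL hq2 (by omega)).mono (by omega)
  have hsc : SC C0 = SC C ⊔ Submodule.span (Pol k N) {vl (em y d)} := SC_add C _
  have hcolL : lid (Len C) ≤ col (SC C) (vl (em y d)) := by
    rw [Len_eq hxy, lid_sup]
    refine sup_le ?_ ?_
    · refine Ideal.span_le.2 ?_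
      rintro _ ⟨l, hl, rfl⟩
      exact mem_col.2 (Lam_smul_em hd hl y)
    · refine Ideal.span_le.2 ?_
      rintro _ ⟨l, hl, rfl⟩
      refine mem_col.2 ?_
      have h1 := Lam_smul_em he hl x
      have h2 := (SC C).smul_mem (lf l) (vl_mem_SC hab)
      rw [map_add, smul_vl, smul_vl, smul_add] at h2
      have h3 := (SC C).smul_mem (MvPolynomial.C a : Pol k N) h1
      rw [smul_comm] at h3
      have h4 := (SC C).sub_mem h2 h3
      rw [add_sub_cancel_left] at h4
      have h5 := (SC C).smul_mem (MvPolynomial.C b⁻¹ : Pol k N) h4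
      rw [smul_comm (lf l), smul_smul, ← map_mul, inv_mul_cancel₀ hb, map_one, one_smul] at h5
      exact h5
  refine cyc_mid _ (vl (em y d)) ?_ ?_
  · rw [col_reg hsc hreg, sup_eq_left.2 ((Ideal.span_singleton_le_iff_mem _).2 (hcolL hqL))]
    refine (cyc_left (SC C) (vl (em y d)) (pd_Len C) ?_).mono (show fr (Len C) ≤ _ by omega)
    rw [← hsc]
    exact (pd_Len C0).mono (show fr (Len C0) ≤ fr (Len C) + 1 by omega)
  · rw [sup_swap, ← hsc]
    exact pd_reg hreg (by omega)
end field
end QPD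

namespace QPD
open MvPolynomial

section field
variable {k : Type u} [Field k] {N : ℕ}

theorem adapted2 {x : k × k} (hx : x ≠ 0) (C : Submodule k (VV k N)) (h : fr (Lam x C) ≤ 2) :
    ∃ c1 c2, c1 ∈ C ∧ c2 ∈ C ∧ (fr (Lam x C) ≤ 1 → c2 = 0) ∧ (Dd x C).map (em x) ⊔ Submodule.span k {c1, c2} = C := by
  obtain ⟨c, hc, -, -, hs⟩ := adapted hx C
  let cc : ℕ → VV k N := fun i => if h : i < Module.finrank k (Lam x C) then c ⟨i, h⟩ else 0
  have hcc : ∀ i, cc i ∈ C := by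
    intro i
    by_cases h : i < Module.finrank k (Lam x C)
    · simp only [cc, h, dif_pos]; exact hc _
    · simp only [cc, h, dif_neg, not_false_eq_true]; exact zero_mem _
  refine ⟨cc 0, cc 1, hcc 0, hcc 1, fun h1 => dif_neg (by change ¬ 1 < fr (Lam x C); omega), le_antisymm ?_ ?_⟩
  · refine sup_le (by rintro _ ⟨w, hw, rfl⟩; exact hw) (Submodule.span_le.2 ?_)
    rintro _ (rfl | rfl)
    · exact hcc 0
    · exact hcc 1
  · conv_lhs => rw [← hs]
    refine sup_le_sup_left (Submodule.span_mono ?_) _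
    rintro _ ⟨⟨i, hi⟩, rfl⟩
    have e : c ⟨i, hi⟩ = cc i := by simp only [cc]; rw [dif_pos hi]
    change i < fr (Lam x C) at hi
    rw [e]
    have : i = 0 ∨ i = 1 := by omega
    rcases this with rfl | rfl <;> simp

theorem main_d [IsAlgClosed k] {C : Submodule k (VV k N)} {q : Pol k N} (hq : q.IsHomogeneous 2)
    {x : k × k} (hx : x ≠ 0) (hC : fr C = 3) (hD : 1 ≤ fr (Dd x C)) :
    PD (Pol k N) (M2 k N ⧸ (SC C ⊔ qM q)) 5 := by
  have hfr := fr_Lam hx C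
  obtain ⟨y, hy⟩ := exists_dt hx
  have hyx : dt y x = -1 := by rw [dt_swap, hy]
  obtain ⟨c1, c2, h1, h2, h20, hs⟩ := adapted2 hx C (by omega)
  have hmap : (SC C ⊔ qM q).map (Ph x) = lid (Lam x C) ⊔ Ideal.span {q} := by
    rw [Submodule.map_sup, map_SC]
    congr 1
    ext f
    rw [Ideal.mem_span_singleton', Submodule.mem_map]
    constructor
    · rintro ⟨m, hm, rfl⟩
      obtain ⟨e, rfl⟩ := mem_qM.1 hm
      exact ⟨Ph x e, by rw [map_smul, smul_eq_mul, mul_comm]⟩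
    · rintro ⟨a, rfl⟩
      obtain ⟨e, rfl⟩ := Ph_surj (N := N) hx a
      exact ⟨q • e, mem_qM.2 ⟨e, rfl⟩, by rw [map_smul, smul_eq_mul, mul_comm]⟩
  have hI2 : I2 C ⊔ lid (Dd x C) = lid (Dd x C) ⊔ Ideal.span {mn c1 c2} := by
    apply le_antisymm
    · refine sup_le ?_ le_sup_left
      have hs' : C = Submodule.span k ((em x '' (Dd x C : Set (Vec k N))) ∪ {c1, c2}) := by
        rw [Submodule.span_union, ← Submodule.map_coe, Submodule.span_eq]
        exact hs.symm
      have m0 : mn c1 c2 ∈ lid (Dd x C) ⊔ Ideal.span {mn c1 c2} := Submodule.mem_sup_right (Ideal.mem_span_singleton_self _)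
      have mD : ∀ w ∈ Dd x C, ∀ v, mn (em x w) v ∈ lid (Dd x C) ⊔ Ideal.span {mn c1 c2} := by
        intro w hw v
        rw [mn_em]
        exact neg_mem (Submodule.mem_sup_left (Ideal.mul_mem_right _ _ (lf_mem_lid hw)))
      conv_lhs => rw [hs']
      refine I2_span_le ?_
      rintro u (⟨w, hw, rfl⟩ | hu) v hv
      · exact mD w hw v
      · rcases hv with ⟨w, hw, rfl⟩ | hv
        · have := neg_mem (mD w hw u)
          rwa [← mn_swap] at this
        · rcases hu with rfl | rfl <;> rcases hv with rfl | rfl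
          · rw [mn_self]; exact zero_mem _
          · exact m0
          · have := neg_mem m0
            rwa [← mn_swap] at this
          · rw [mn_self]; exact zero_mem _
    · refine sup_le le_sup_right ?_
      rw [Ideal.span_singleton_le_iff_mem]
      exact Submodule.mem_sup_left (mn_mem h1 h2)
  refine cyc_mid _ (Em x 1) ?_ ?_
  swap
  · rw [sup_Em hx, hmap]
    exact pd_comap hx _ ((pd_one (Lam x C) q).mono (show 1 + fr (Lam x C) ≤ 5 by omega))
  have base : I2 C ⊔ lid (Dd x C) ≤ col (SC C ⊔ qM q) (Em x 1) := by
    rw [← col_Em hx]; exact col_mono le_sup_left _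
  by_cases hqΛ : q ∈ lid (Lam x C)
  swap
  · have e : col (SC C ⊔ qM q) (Em x 1) = lid (Dd x C) ⊔ Ideal.span {mn c1 c2, q} := by
      rw [Ideal.span_insert, ← sup_assoc, ← hI2]
      apply le_antisymm
      · intro f hf
        rw [mem_col, mem_sup_qM, ← Em_eq_smul] at hf
        obtain ⟨s, hs, e, he⟩ := hf
        have h0 := congrArg (Ph x) he
        rw [Ph_Em, map_add, map_smul, smul_eq_mul] at h0
        have h3 : q * Ph x e ∈ lid (Lam x C) := by
          rw [← neg_eq_of_add_eq_zero_right h0.symm]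
          exact neg_mem (Ph_SC hs)
        obtain ⟨m, hm, hme⟩ := exists_Ph (((lid_prime _).mem_or_mem h3).resolve_left hqΛ)
        obtain ⟨w, hw⟩ := ker_Ph hx (v := e - m) (by rw [map_sub, hme, sub_self])
        rw [show f = (f - q * w) + w * q by ring]
        refine add_mem (Submodule.mem_sup_left ((Kp hx).1 ?_)) (Submodule.mem_sup_right (Ideal.mul_mem_left _ _ (Ideal.mem_span_singleton_self q)))
        rw [map_sub, he, ← smul_eq_mul, map_smul, ← hw, smul_sub]
        rw [show s + q • e - (q • e - q • m) = s + q • m by abel]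
        exact add_mem hs ((SC C).smul_mem _ hm)
      · refine sup_le base ?_
        rw [Ideal.span_singleton_le_iff_mem]
        exact q_mem_col _ _ _
    rw [e]
    exact (pd_two (Dd x C) _ _).mono (show 2 + fr (Dd x C) ≤ 5 by omega)
  · have hLs : Lam x C = Submodule.span k {ph x c1, ph x c2} := by
      rw [Lam]
      conv_lhs => rw [← hs]
      rw [Submodule.map_sup, ← Submodule.map_comp, Submodule.map_span, Set.image_pair]
      rw [show (ph x).comp (em x) = (0 : Vec k N →ₗ[k] Vec k N) from LinearMap.ext fun w => ph_em x w, Submodule.map_zero, bot_sup_eq]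
    rw [hLs, lid_span, Set.image_pair, Ideal.mem_span_pair] at hqΛ
    obtain ⟨a1, a2, haq⟩ := hqΛ
    obtain ⟨g1, hg1⟩ := homog_one_eq (homogeneousComponent_isHomogeneous 1 a1)
    obtain ⟨g2, hg2⟩ := homog_one_eq (homogeneousComponent_isHomogeneous 1 a2)
    have hqg : q = lf g1 * lf (ph x c1) + lf g2 * lf (ph x c2) := by
      rw [← hcomp_self hq, ← haq, map_add, mul_comm a1, mul_comm a2, hcomp_mul' (lf_homog _) (by norm_num),
        hcomp_mul' (lf_homog _) (by norm_num), ← hg1, ← hg2]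
      ring
    set m0 : M2 k N := lf g1 • vl c1 + lf g2 • vl c2 with hm0
    have hm0S : m0 ∈ SC C := add_mem ((SC C).smul_mem _ (vl_mem_SC h1)) ((SC C).smul_mem _ (vl_mem_SC h2))
    set θ : Pol k N := lf g1 * lf (ph y c1) + lf g2 * lf (ph y c2) with hθ
    have e1 : Ph x m0 = q := by
      rw [hm0, map_add, map_smul, map_smul, Ph_vl, Ph_vl, hqg]; rfl
    have e2 : Ph y m0 = θ := by
      rw [hm0, map_add, map_smul, map_smul, Ph_vl, Ph_vl, hθ]; rfl
    have hdec : m0 = Em x θ - Em y q := by rw [M2_decomp hy m0, e1, e2]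
    have e : col (SC C ⊔ qM q) (Em x 1) = lid (Dd x C) ⊔ Ideal.span {mn c1 c2, q, θ} := by
      rw [Ideal.span_insert, ← sup_assoc, ← hI2]
      apply le_antisymm
      · intro f hf
        rw [mem_col, mem_sup_qM, ← Em_eq_smul] at hf
        obtain ⟨s, hs, e, he⟩ := hf
        set w := Ph y e with hw
        set t := Ph x e with ht
        rw [show f = (f - q * w + t * θ) + (w * q + (-t) * θ) by ring]
        refine add_mem (Submodule.mem_sup_left ((Kp hx).1 ?_)) (Submodule.mem_sup_right (Ideal.mem_span_pair.2 ⟨w, -t, rfl⟩))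
        have he' : e = Em x w - Em y t := M2_decomp hy e
        have : Em x (f - q * w + t * θ) = s + t • m0 := by
          rw [map_add, map_sub, he, hdec, ← smul_eq_mul, map_smul, he', smul_sub, smul_sub, ← smul_eq_mul, map_smul]
          have : t • Em y q = q • Em y t := by rw [← map_smul, ← map_smul, smul_eq_mul, smul_eq_mul, mul_comm]
          rw [this]
          abel
        rw [this]
        exact add_mem hs ((SC C).smul_mem _ hm0S)
      · refine sup_le base ?_
        rw [Ideal.span_le]
        rintro _ (rfl | rfl)
        · exact q_mem_col _ _ _
        · change _ ∈ col _ _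
          rw [mem_col, mem_sup_qM, ← Em_eq_smul]
          refine ⟨m0, hm0S, Em y 1, ?_⟩
          rw [← Em_eq_smul, hdec, sub_add_cancel]
    rw [e]
    by_cases hr : fr (Lam x C) ≤ 1
    · rw [h20 hr, mn_zero_right, Ideal.span_insert_zero]
      exact (pd_two (Dd x C) _ _).mono (show 2 + fr (Dd x C) ≤ 5 by omega)
    · have hh := HBD (Dd x C) (ph x c1, ph x c2) (ph y c1, ph y c2) (-g2, g1)
      have m1 : mn (ph x c1, ph x c2) (ph y c1, ph y c2) = mn c1 c2 := by
        have hC' : (MvPolynomial.C x.1 * MvPolynomial.C y.2 - MvPolynomial.C x.2 * MvPolynomial.C y.1 : Pol k N) = 1 := by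
          rw [← map_mul, ← map_mul, ← map_sub]; rw [dt] at hy; rw [hy, map_one]
        simp only [mn, ph_apply, map_sub, lf_smul]
        linear_combination (lf c1.1 * lf c2.2 - lf c1.2 * lf c2.1) * hC'
      have m2 : mn (ph x c1, ph x c2) (-g2, g1) = q := by
        rw [hqg, mn]; simp only [map_neg]; ring
      have m3 : mn (ph y c1, ph y c2) (-g2, g1) = θ := by
        rw [hθ, mn]; simp only [map_neg]; ring
      rw [m1, m2, m3] at hh
      exact hh.mono (by omega)

/-- bound for `S²/(SC + q S²)`. -/
theorem main [IsAlgClosed k] {C : Submodule k (VV k N)} {q : Pol k N} (hq : q.IsHomogeneous 2)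
    {n0 : ℕ} (hn : fr C ≤ n0) (hn0 : 3 ≤ n0) :
    PD (Pol k N) (M2 k N ⧸ (SC C ⊔ qM q)) (max (3 * n0 - 4) (4 * n0 - 10)) := by
  by_cases hN : NoSp C
  · exact main_a hN q (by omega)
  by_cases hall : ∀ x : k × k, x ≠ 0 → ¬ Dd x C ≤ Zm C
  · exact main_e hq hall hn hn0
  have hge := NoSp_ge hN
  by_cases hd : n0 = 3 ∧ fr C = 3 ∧ fr (Zm C) = 0
  · obtain ⟨rfl, h3, hz⟩ := hd
    rw [NoSp] at hN
    push Not at hN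
    obtain ⟨x, hx, hxD⟩ := hN
    refine (main_d hq hx h3 ?_).mono (by omega)
    rw [fr_zero_bot hz, le_bot_iff] at hxD
    by_contra hh
    exact hxD (fr_zero_bot (by omega))
  by_cases hc : fr (Zm C) = 0 ∧ fr C = n0 ∧ 2 * fr C ≤ fr (Len C) + 2
  · exact main_c hq hc.1 hc.2.2 hN (by omega)
  push Not at hall
  obtain ⟨x, hx, hxD⟩ := hall
  exact pd_b hq hx hxD (by omega) (by omega) (by omega)
end field
end QPD

namespace QPD
open MvPolynomial

section field
variable {k : Type u} [Field k] {N : ℕ}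

theorem lf_ne {x : Vec k N} (hx : x ≠ 0) : (lf x : Pol k N) ≠ 0 := fun h => hx (lf_injective (h.trans (map_zero _).symm))

theorem mem_lid_single {x : Vec k N} {f : Pol k N} : f ∈ lid (Submodule.span k {x}) ↔ ∃ t, t * lf x = f := by
  rw [lid_span, Set.image_singleton, Ideal.mem_span_singleton']

theorem kos {x y : Vec k N} (hx : x ≠ 0) (hy : y ∉ Submodule.span k {x}) {u v : Pol k N} (h : u * lf x + v * lf y = 0) :
    ∃ t, u = t * lf y ∧ v = - (t * lf x) := by
  have h1 : v * lf y ∈ lid (Submodule.span k {x}) := mem_lid_single.2 ⟨-u, by linear_combination -h⟩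
  obtain ⟨t, ht⟩ := mem_lid_single.1 (((lid_prime _).mem_or_mem h1).resolve_right (fun hh => hy (lf_mem_lid_iff.1 hh)))
  refine ⟨-t, ?_, by rw [← ht]; ring⟩
  rw [← ht] at h
  have : lf x * (u + t * lf y) = 0 := by linear_combination h
  rcases mul_eq_zero.1 this with h0 | h0
  · exact absurd h0 (lf_ne hx)
  · linear_combination h0

theorem mem_lid_pair {x y : Vec k N} {f : Pol k N} : f ∈ lid (Submodule.span k {x, y}) ↔ ∃ u v, u * lf x + v * lf y = f := by
  rw [lid_span, Set.image_pair, Ideal.mem_span_pair]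

theorem quad_pair {x y : Vec k N} {f : Pol k N} (hf : f.IsHomogeneous 2) (h : f ∈ lid (Submodule.span k {x, y})) :
    ∃ a b, lf a * lf x + lf b * lf y = f := by
  obtain ⟨a1, a2, haq⟩ := mem_lid_pair.1 h
  obtain ⟨g1, hg1⟩ := homog_one_eq (homogeneousComponent_isHomogeneous 1 a1)
  obtain ⟨g2, hg2⟩ := homog_one_eq (homogeneousComponent_isHomogeneous 1 a2)
  refine ⟨g1, g2, ?_⟩
  rw [← hcomp_self hf, ← haq, map_add, mul_comm a1, mul_comm a2, hcomp_mul' (lf_homog _) (by norm_num),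
        hcomp_mul' (lf_homog _) (by norm_num), ← hg1, ← hg2]
  ring

/-- the map `(u,v) ↦ ux+vy`. -/
noncomputable def psi (x y : Vec k N) : M2 k N →ₗ[Pol k N] Pol k N :=
  LinearMap.coprod (LinearMap.toSpanSingleton _ _ (lf x)) (LinearMap.toSpanSingleton _ _ (lf y))

theorem psi_apply (x y : Vec k N) (m : M2 k N) : psi x y m = m.1 * lf x + m.2 * lf y := by
  simp [psi]

theorem pd_psi (x y : Vec k N) {A : Submodule (Pol k N) (M2 k N)} {I : Ideal (Pol k N)}
    (hA : ∀ m, m ∈ A ↔ psi x y m ∈ I) {d : ℕ} (h1 : PD (Pol k N) (M2 k N ⧸ A) d)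
    (h2 : PD (Pol k N) (Pol k N ⧸ (lid (Submodule.span k {x, y}) ⊔ I)) d) : PD (Pol k N) (Pol k N ⧸ I) d := by
  have hle : A ≤ Submodule.comap (psi x y) I := fun m hm => (hA m).1 hm
  refine PD.mid (Submodule.mapQ A I (psi x y) hle) (Submodule.mapQ I (lid (Submodule.span k {x, y}) ⊔ I) LinearMap.id le_sup_right) ?_ ?_ ?_ h1 h2
  · rw [injective_iff_map_eq_zero]
    intro m hm
    obtain ⟨m, rfl⟩ := Submodule.Quotient.mk_surjective _ m
    rw [Submodule.mapQ_apply, Submodule.Quotient.mk_eq_zero] at hm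
    rw [Submodule.Quotient.mk_eq_zero]
    exact (hA m).2 hm
  · intro m
    obtain ⟨m, rfl⟩ := Submodule.Quotient.mk_surjective _ m
    exact ⟨Submodule.Quotient.mk m, rfl⟩
  · intro m
    obtain ⟨m, rfl⟩ := Submodule.Quotient.mk_surjective _ m
    rw [Submodule.mapQ_apply, LinearMap.id_apply, Submodule.Quotient.mk_eq_zero]
    constructor
    · intro h
      obtain ⟨a, ha, b, hb, rfl⟩ := Submodule.mem_sup.1 h
      obtain ⟨u, v, rfl⟩ := mem_lid_pair.1 ha
      refine ⟨Submodule.Quotient.mk (u, v), ?_⟩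
      rw [Submodule.mapQ_apply, psi_apply, Submodule.Quotient.eq]
      simpa using hb
    · rintro ⟨w, hw⟩
      obtain ⟨w, rfl⟩ := Submodule.Quotient.mk_surjective _ w
      rw [Submodule.mapQ_apply, Submodule.Quotient.eq, psi_apply] at hw
      rw [show m = (w.1 * lf x + w.2 * lf y) - (w.1 * lf x + w.2 * lf y - m) by ring]
      exact sub_mem (Submodule.mem_sup_left (mem_lid_pair.2 ⟨_, _, rfl⟩)) (Submodule.mem_sup_right hw)

theorem psi_SC {ι : Type*} [Fintype ι] {x y : Vec k N} (hx : x ≠ 0) (hy : y ∉ Submodule.span k {x}) (a b : ι → Vec k N) (m : M2 k N) :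
    m ∈ SC (Submodule.span k (Set.range fun i => (a i, b i)) ⊔ Submodule.span k {(y, -x)}) ↔
      psi x y m ∈ (Ideal.span (Set.range fun i => lf (a i) * lf x + lf (b i) * lf y) : Ideal (Pol k N)) := by
  rw [SC_sup, SC_span, SC_span, Set.image_singleton, ← Set.range_comp]
  constructor
  · intro h
    obtain ⟨s, hs, t, ht, rfl⟩ := Submodule.mem_sup.1 h
    rw [map_add]
    clear h
    refine add_mem ?_ ?_
    · induction hs using Submodule.span_induction with
      | mem v hv =>
        obtain ⟨i, rfl⟩ := hv
        rw [psi_apply]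
        exact Ideal.subset_span ⟨i, rfl⟩
      | zero => simp
      | add u v _ _ h1 h2 =>
        rw [map_add]
        exact add_mem h1 h2
      | smul r v _ h1 =>
        rw [map_smul]
        exact Ideal.mul_mem_left _ _ h1
    · obtain ⟨r, rfl⟩ := Submodule.mem_span_singleton.1 ht
      rw [map_smul, psi_apply, vl_apply]
      simp only [map_neg]
      rw [show lf y * lf x + -lf x * lf y = 0 by ring, smul_zero]
      exact zero_mem _
  · intro h
    rw [Ideal.mem_span_range_iff_exists_fun] at h
    obtain ⟨c, hc⟩ := h
    rw [psi_apply] at hc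
    have hk : (m.1 - ∑ i, c i * lf (a i)) * lf x + (m.2 - ∑ i, c i * lf (b i)) * lf y = 0 := by
      rw [sub_mul, sub_mul, Finset.sum_mul, Finset.sum_mul]
      have : ∑ i, c i * (lf (a i) * lf x + lf (b i) * lf y) = ∑ i, c i * lf (a i) * lf x + ∑ i, c i * lf (b i) * lf y := by
        rw [← Finset.sum_add_distrib]
        exact Finset.sum_congr rfl fun i _ => by ring
      rw [this] at hc
      linear_combination -hc
    obtain ⟨t, h1, h2⟩ := kos hx hy hk
    have : m = ∑ i, c i • vl (a i, b i) + t • vl (y, -x) := by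
      ext1
      · rw [Prod.fst_add, Prod.fst_sum]
        simp only [Prod.smul_fst, vl_apply, smul_eq_mul]
        linear_combination h1
      · rw [Prod.snd_add, Prod.snd_sum]
        simp only [Prod.smul_snd, vl_apply, smul_eq_mul, map_neg]
        linear_combination h2
    rw [this]
    refine add_mem (Submodule.mem_sup_left (sum_mem fun i _ => Submodule.smul_mem _ _ (Submodule.subset_span ⟨i, rfl⟩)))
      (Submodule.mem_sup_right (Submodule.smul_mem _ _ (Submodule.mem_span_singleton_self _)))

theorem fr_span_range {ι : Type*} [Fintype ι] (a : ι → VV k N) (v : VV k N) :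
    fr (Submodule.span k (Set.range a) ⊔ Submodule.span k {v}) ≤ Fintype.card ι + 1 := by
  have h1 := fr_sup_le (Submodule.span k (Set.range a)) (Submodule.span k {v})
  have h2 := fr_span_one (k := k) v
  have h3 : fr (Submodule.span k (Set.range a)) ≤ Fintype.card ι := finrank_range_le_card a
  omega

theorem pd_EC [IsAlgClosed k] {C : Submodule k (VV k N)} {n : ℕ} (hn : 3 ≤ n) (hC : fr C ≤ n + 1) :
    PD (Pol k N) (M2 k N ⧸ SC C) (max (3 * n - 4) (4 * n - 10)) := by
  by_cases hN : NoSp C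
  · exact pd_NoSp' hN (by omega)
  have := NoSp_ge hN
  by_cases hL : fr (Len C) ≤ max (3 * n - 4) (4 * n - 10)
  · exact (pd_Len C).mono hL
  · exact pd_S' (by omega) (by omega)

theorem fr_pair (x y : Vec k N) : fr (Submodule.span k {x, y}) ≤ 2 := by
  classical
  have := finrank_span_finset_le_card (R := k) ({x, y} : Finset (Vec k N))
  have h3 := Finset.card_le_two (a := x) (b := y)
  have h4 : ((({x, y} : Finset (Vec k N)) : Set (Vec k N))) = {x, y} := by simp
  rw [Set.finrank, h4] at this
  exact this.trans h3

theorem red_all [IsAlgClosed k] {n : ℕ} (hn : 3 ≤ n) (f : Fin n → Pol k N) (hf : ∀ i, (f i).IsHomogeneous 2) {x y : Vec k N}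
    (hx : x ≠ 0) (hy : y ∉ Submodule.span k {x}) (h : ∀ i, f i ∈ lid (Submodule.span k {x, y})) :
    PD (Pol k N) (Pol k N ⧸ Ideal.span (Set.range f)) (max (3 * n - 4) (4 * n - 10)) := by
  choose a b hab using fun i => quad_pair (hf i) (h i)
  have hfe : f = fun i => lf (a i) * lf x + lf (b i) * lf y := funext fun i => (hab i).symm
  have hfr := fr_span_range (fun i => (a i, b i)) (y, -x)
  rw [Fintype.card_fin] at hfr
  refine pd_psi x y (A := SC (Submodule.span k (Set.range fun i => (a i, b i)) ⊔ Submodule.span k {(y, -x)})) ?_ (pd_EC hn hfr) ?_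
  · intro m
    rw [hfe]
    exact psi_SC hx hy a b m
  · rw [sup_eq_left.2]
    · have h2 := fr_pair x y
      exact (pd_lid _).mono (h2.trans (by omega))
    · rw [Ideal.span_le]
      rintro _ ⟨i, rfl⟩
      exact h i

theorem red_main [IsAlgClosed k] {n : ℕ} (hn : 3 ≤ n) (f : Fin n → Pol k N) (hf : ∀ i, (f i).IsHomogeneous 2) {x y : Vec k N}
    (hx : x ≠ 0) (hy : y ∉ Submodule.span k {x}) (i0 : Fin n) (h0 : f i0 ∉ lid (Submodule.span k {x, y}))
    (h : ∀ i, ∃ c : k, f i - C c * f i0 ∈ lid (Submodule.span k {x, y})) :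
    PD (Pol k N) (Pol k N ⧸ Ideal.span (Set.range f)) (max (3 * n - 4) (4 * n - 10)) := by
  choose c hc using h
  choose a b hab using fun i => quad_pair (show (f i - C (c i) * f i0).IsHomogeneous 2 from
    (hf i).sub (by simpa using (isHomogeneous_C (Fin N) (c i)).mul (hf i0))) (hc i)
  let ι := {i : Fin n // i ≠ i0}
  set q := f i0 with hq
  let J : Ideal (Pol k N) := Ideal.span (Set.range fun i : ι => lf (a i) * lf x + lf (b i) * lf y)
  have hI : Ideal.span (Set.range f) = J ⊔ Ideal.span {q} := by
    have hq1 : q ∈ Ideal.span (Set.range f) := Ideal.subset_span ⟨i0, rfl⟩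
    apply le_antisymm
    · rw [Ideal.span_le]
      rintro _ ⟨i, rfl⟩
      by_cases hi : i = i0
      · subst hi; exact Submodule.mem_sup_right (Ideal.mem_span_singleton_self _)
      · have : f i = (lf (a i) * lf x + lf (b i) * lf y) + C (c i) * q := by rw [hab]; ring
        rw [this]
        exact add_mem (Submodule.mem_sup_left (Ideal.subset_span ⟨⟨i, hi⟩, rfl⟩))
          (Submodule.mem_sup_right (Ideal.mul_mem_left _ _ (Ideal.mem_span_singleton_self _)))
    · refine sup_le ?_ ((Ideal.span_singleton_le_iff_mem _).2 hq1)
      rw [Ideal.span_le]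
      rintro _ ⟨i, rfl⟩
      change lf (a i) * lf x + lf (b i) * lf y ∈ _
      rw [hab]
      exact sub_mem (Ideal.subset_span ⟨i, rfl⟩) (Ideal.mul_mem_left _ _ hq1)
  have hJle : J ≤ lid (Submodule.span k {x, y}) := by
    rw [Ideal.span_le]
    rintro _ ⟨i, rfl⟩
    exact mem_lid_pair.2 ⟨_, _, rfl⟩
  have hfr := fr_span_range (fun i : ι => (a i, b i)) (y, -x)
  have hcard : Fintype.card ι = n - 1 := by
    simp [ι, Fintype.card_subtype_compl]
  rw [hcard] at hfr
  rw [hI]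
  refine pd_psi x y (A := SC (Submodule.span k (Set.range fun i : ι => (a i, b i)) ⊔ Submodule.span k {(y, -x)}) ⊔ qM q) ?_
    (main (hf i0) (hfr.trans (by omega)) hn) ?_
  · intro m
    constructor
    · intro h
      obtain ⟨s, hs, e, rfl⟩ := mem_sup_qM.1 h
      rw [map_add, map_smul]
      exact add_mem (Submodule.mem_sup_left ((psi_SC hx hy (fun i : ι => a i) (fun i : ι => b i) s).1 hs))
        (Submodule.mem_sup_right (Ideal.mul_mem_right _ _ (Ideal.mem_span_singleton_self _)))
    · intro h
      obtain ⟨j, hj, t, ht, hjt⟩ := Submodule.mem_sup.1 h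
      obtain ⟨r, rfl⟩ := Ideal.mem_span_singleton'.1 ht
      have h1 : r * q ∈ lid (Submodule.span k {x, y}) := by
        rw [← sub_eq_iff_eq_add'.2 hjt.symm]
        exact sub_mem (mem_lid_pair.2 ⟨_, _, (psi_apply x y m).symm⟩) (hJle hj)
      obtain ⟨u, v, huv⟩ := mem_lid_pair.1 (((lid_prime _).mem_or_mem h1).resolve_right h0)
      rw [mem_sup_qM]
      refine ⟨m - q • (u, v), ?_, (u, v), by abel⟩
      refine (psi_SC hx hy (fun i : ι => a i) (fun i : ι => b i) _).2 ?_
      rw [map_sub, map_smul, ← hjt, psi_apply, smul_eq_mul]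
      simp only
      rw [huv, show j + r * q - q * r = j by ring]
      exact hj
  · have e : lid (Submodule.span k {x, y}) ⊔ (J ⊔ Ideal.span {q}) = lid (Submodule.span k {x, y}) ⊔ Ideal.span {q} := by
      rw [← sup_assoc, sup_eq_left.2 hJle]
    rw [e]
    have := fr_pair x y
    exact (pd_one _ q).mono (show 1 + fr _ ≤ _ by omega)

theorem ge_two {n : ℕ} (f : Fin n → Pol k N) {x y : Vec k N} (hx : x ≠ 0) (hy : y ∉ Submodule.span k {x}) {g : Pol k N}
    (hg : g ∉ Ideal.span (Set.range f)) (hxg : lf x * g ∈ Ideal.span (Set.range f)) (hyg : lf y * g ∈ Ideal.span (Set.range f)) :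
    2 ≤ n := by
  by_contra hn
  obtain ⟨f0, hf0⟩ : ∃ f0, Ideal.span (Set.range f) = Ideal.span {f0} := by
    have : n = 0 ∨ n = 1 := by omega
    rcases this with rfl | rfl
    · exact ⟨0, by simp [Set.range_eq_empty]⟩
    · exact ⟨f 0, by rw [Set.range_unique]; rfl⟩
  rw [hf0] at hg hxg hyg
  rw [Ideal.mem_span_singleton'] at hxg hyg
  obtain ⟨u, hu⟩ := hxg
  obtain ⟨v, hv⟩ := hyg
  have hg0 : g ≠ 0 := by rintro rfl; exact hg (zero_mem _)
  have h1 : g * (v * lf x + (-u) * lf y) = 0 := by linear_combination (-v) * hu + u * hv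
  obtain ⟨t, -, ht⟩ := kos hx hy ((mul_eq_zero.1 h1).resolve_left hg0)
  apply hg
  rw [Ideal.mem_span_singleton']
  refine ⟨t, mul_left_cancel₀ (lf_ne hx) ?_⟩
  rw [← hu]
  linear_combination f0 * ht

/-- the reduction. -/
theorem reduction [IsAlgClosed k] {n : ℕ} (f : Fin n → Pol k N) (hf : ∀ i, (f i).IsHomogeneous 2) {x y : Vec k N}
    (hx : x ≠ 0) (hy : y ∉ Submodule.span k {x}) {g : Pol k N}
    (hg : g ∉ Ideal.span (Set.range f)) (hxg : lf x * g ∈ Ideal.span (Set.range f)) (hyg : lf y * g ∈ Ideal.span (Set.range f))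
    (H : ∀ i, f i ∉ lid (Submodule.span k {x, y}) → ∀ j, ∃ c : k, f j - C c * f i ∈ lid (Submodule.span k {x, y})) :
    PD (Pol k N) (Pol k N ⧸ Ideal.span (Set.range f)) (max (3 * n - 4) (4 * n - 10)) := by
  have h2 := ge_two f hx hy hg hxg hyg
  by_cases hn : n = 2
  · subst hn
    have : Set.range f = {f 0, f 1} := by
      ext z; simp [Fin.exists_fin_two, eq_comm]
    rw [this]
    exact (pd_pair _ _).mono (by norm_num)
  by_cases hall : ∀ i, f i ∈ lid (Submodule.span k {x, y})
  · exact red_all (by omega) f hf hx hy hall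
  · push Not at hall
    obtain ⟨i, hi⟩ := hall
    exact red_main (by omega) f hf hx hy i hi (H i hi)
end field
end QPD

namespace QPD
open MvPolynomial

section field
variable {k : Type u} [Field k] {N : ℕ}

theorem hcomp_lt {a b : Pol k N} {i n : ℕ} (ha : a.IsHomogeneous i) (h : n < i) :
    homogeneousComponent n (a * b) = 0 := by
  letI := MvPolynomial.gradedAlgebra (σ := Fin N) (R := k)
  have := DirectSum.coe_decompose_mul_of_left_mem_of_not_le (homogeneousSubmodule (Fin N) k) (i := i) (n := n) (a := a) (b := b) ha (by omega)
  have e := fun (φ : Pol k N) (i : ℕ) => decomposition.decompose'_apply (σ := Fin N) (R := k) φ i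
  rw [← e]
  exact this

theorem hcomp_hmul {a b : Pol k N} {i n : ℕ} (ha : a.IsHomogeneous i) :
    homogeneousComponent n (a * b) = if i ≤ n then a * homogeneousComponent (n - i) b else 0 := by
  split_ifs with h
  · exact hcomp_mul' ha h
  · exact hcomp_lt ha (by omega)

theorem hcomp_sum (f : Pol k N) {M : ℕ} (h : f.totalDegree < M) : ∑ i ∈ Finset.range M, homogeneousComponent i f = f := by
  conv_rhs => rw [← sum_homogeneousComponent f]
  symm
  apply Finset.sum_subset
  · intro i hi; rw [Finset.mem_range] at *; omega
  · intro i _ hi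
    rw [Finset.mem_range] at hi
    exact homogeneousComponent_eq_zero _ _ (by omega)

theorem hcomp_prod (f g : Pol k N) {M : ℕ} (h : f.totalDegree < M) (n : ℕ) :
    homogeneousComponent n (f * g) = ∑ i ∈ Finset.range M, if i ≤ n then homogeneousComponent i f * homogeneousComponent (n - i) g else 0 := by
  conv_lhs => rw [← hcomp_sum f h, Finset.sum_mul, map_sum]
  exact Finset.sum_congr rfl fun i _ => hcomp_hmul (homogeneousComponent_isHomogeneous _ _)

/-- homogeneous ideals. -/
def HI (I : Ideal (Pol k N)) : Prop := ∀ f ∈ I, ∀ d, homogeneousComponent d f ∈ I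

theorem HI_span {ι : Type*} [Fintype ι] (f : ι → Pol k N) (d : ι → ℕ) (hf : ∀ i, (f i).IsHomogeneous (d i)) : HI (Ideal.span (Set.range f)) := by
  intro g hg n
  rw [Ideal.mem_span_range_iff_exists_fun] at hg
  obtain ⟨c, rfl⟩ := hg
  rw [map_sum]
  refine sum_mem fun i _ => ?_
  rw [mul_comm, hcomp_hmul (hf i)]
  split_ifs
  · exact Ideal.mul_mem_right _ _ (Ideal.subset_span ⟨i, rfl⟩)
  · exact zero_mem _

theorem HI_sum {I : Ideal (Pol k N)} {f : Pol k N} (h : ∀ d, homogeneousComponent d f ∈ I) : f ∈ I := by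
  rw [← sum_homogeneousComponent f]
  exact sum_mem fun i _ => h i

theorem HI_colon {I p : Ideal (Pol k N)} (hI : HI I) (hp : p.IsPrime) {g : Pol k N} (hg : ∀ f, f ∈ p ↔ f * g ∈ I) : HI p := by
  -- top component
  have key : ∀ f ∈ p, ∀ m, f.totalDegree ≤ m → homogeneousComponent m f ∈ p := by
    intro f hf m hm
    set t := homogeneousComponent m f with ht
    have hfg := (hg f).1 hf
    set b := g.totalDegree with hb
    have claim : ∀ j, j ≤ b → t ^ (j+1) * homogeneousComponent (b - j) g ∈ I := by
      intro j
      induction j using Nat.strong_induction_on with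
      | _ j ih =>
      intro hj
      have h1 := hI _ hfg (m + (b - j))
      rw [hcomp_prod f g (M := m+1) (by omega), Finset.sum_range_succ, if_pos (by omega), Nat.add_sub_cancel_left] at h1
      have h2 := Ideal.mul_mem_left I (t ^ j) h1
      rw [mul_add, Finset.mul_sum] at h2
      have h3 : ∑ i ∈ Finset.range m, t ^ j * (if i ≤ m + (b - j) then homogeneousComponent i f * homogeneousComponent (m + (b - j) - i) g else 0) ∈ I := by
        refine sum_mem fun i hi => ?_
        rw [Finset.mem_range] at hi
        rw [if_pos (by omega)]
        by_cases hbi : b < m + (b - j) - i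
        · rw [homogeneousComponent_eq_zero _ _ hbi]; simp
        · have h4 := ih (b - (m + (b - j) - i)) (by omega) (by omega)
          rw [Nat.sub_sub_self (by omega)] at h4
          obtain ⟨e, he⟩ := Nat.exists_eq_add_of_le (show b - (m + (b - j) - i) + 1 ≤ j by omega)
          have : t ^ j = t ^ (b - (m + (b - j) - i) + 1) * t ^ e := by rw [← pow_add, ← he]
          rw [this, show ∀ a b c d : Pol k N, a * b * (c * d) = (b * c) * (a * d) by intros; ring]
          exact Ideal.mul_mem_left _ _ h4
      have h5 := (Submodule.add_mem_iff_right I h3).1 h2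
      rw [pow_succ, mul_assoc]
      exact h5
    have : t ^ (b + 1) ∈ p := by
      rw [hg]
      rw [← sum_homogeneousComponent g, Finset.mul_sum]
      refine sum_mem fun i hi => ?_
      rw [Finset.mem_range] at hi
      have h4 := claim (b - i) (by omega)
      rw [Nat.sub_sub_self (by omega)] at h4
      obtain ⟨e, he⟩ := Nat.exists_eq_add_of_le (show b - i + 1 ≤ b + 1 by omega)
      rw [he, pow_add, mul_comm (t ^ _), mul_assoc]
      exact Ideal.mul_mem_left _ _ h4
    exact hp.mem_of_pow_mem _ this
  have main : ∀ m, ∀ f ∈ p, f.totalDegree < m → ∀ d, homogeneousComponent d f ∈ p := by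
    intro m
    induction m with
    | zero => intro f _ h; omega
    | succ m ih =>
      intro f hf hm d
      have ht := key f hf m (by omega)
      by_cases hm0 : m = 0
      · subst hm0
        by_cases hd : d = 0
        · subst hd; exact ht
        · rw [homogeneousComponent_eq_zero _ _ (by omega)]; exact zero_mem _
      have h1 := sub_mem hf ht
      have h2 : (f - homogeneousComponent m f).totalDegree < m := by
        have : f - homogeneousComponent m f = ∑ i ∈ Finset.range m, homogeneousComponent i f := by
          conv_lhs => lhs; rw [← hcomp_sum f hm, Finset.sum_range_succ]
          ring
        rw [this]
        refine (totalDegree_finsetSum_le (d := m - 1) fun i hi => ?_).trans_lt (by omega)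
        rw [Finset.mem_range] at hi
        exact (homogeneousComponent_isHomogeneous i f).totalDegree_le.trans (by omega)
      have h3 := ih _ h1 h2 d
      rw [map_sub] at h3
      have h4 : homogeneousComponent d (homogeneousComponent m f) ∈ p := by
        rw [homogeneousComponent_of_mem (homogeneousComponent_mem m f)]
        split_ifs
        · exact ht
        · exact zero_mem _
      have := add_mem h3 h4
      rwa [sub_add_cancel] at this
  exact fun f hf d => main (f.totalDegree + 1) f hf (by omega) d

theorem assoc_data {I p : Ideal (Pol k N)} (hI : HI I) (hp : IsAssociatedPrime p (Pol k N ⧸ I)) :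
    p.IsPrime ∧ HI p ∧ ∃ g, g ∉ I ∧ ∀ f, f ∈ p ↔ f * g ∈ I := by
  obtain ⟨h1, x, hx⟩ := isAssociatedPrime_iff.1 hp
  obtain ⟨g, rfl⟩ := Ideal.Quotient.mk_surjective x
  have hg : ∀ f, f ∈ p ↔ f * g ∈ I := by
    intro f
    rw [hx, Submodule.mem_colon_singleton, Submodule.mem_bot, ← Ideal.Quotient.eq_zero_iff_mem, map_mul]
    rfl
  refine ⟨h1, HI_colon hI h1 hg, g, fun h => h1.ne_top ?_, hg⟩
  rw [Ideal.eq_top_iff_one, hg, one_mul]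
  exact h
end field
end QPD

namespace QPD
open MvPolynomial

theorem lc_nonneg {P : Polynomial ℚ} (h : ∀ᶠ d : ℕ in Filter.atTop, 0 ≤ P.eval (d : ℚ)) : 0 ≤ P.leadingCoeff := by
  by_contra hneg
  push Not at hneg
  by_cases hd : 0 < P.degree
  · have h1 := (P.tendsto_atBot_of_leadingCoeff_nonpos hd hneg.le).comp (tendsto_natCast_atTop_atTop (R := ℚ))
    obtain ⟨d, h2, h3⟩ := (h.and (h1.eventually (Filter.eventually_lt_atBot 0))).exists
    simp only [Function.comp] at h3
    linarith
  · rw [Polynomial.eq_C_of_degree_le_zero (not_lt.1 hd)] at h hneg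
    obtain ⟨d, h2⟩ := h.exists
    rw [Polynomial.eval_C] at h2
    rw [Polynomial.leadingCoeff_C] at hneg
    linarith

theorem cmp_deg {A B : Polynomial ℚ} (h : ∀ᶠ d : ℕ in Filter.atTop, A.eval (d : ℚ) ≤ B.eval (d : ℚ)) (hA : 0 < A.leadingCoeff) :
    A.natDegree ≤ B.natDegree ∧ (A.natDegree = B.natDegree → A.leadingCoeff ≤ B.leadingCoeff) := by
  have h1 : 0 ≤ (B - A).leadingCoeff := lc_nonneg (h.mono fun d hd => by simpa using hd)
  have hA0 : A ≠ 0 := by rintro rfl; simp at hA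
  constructor
  · by_contra hlt
    push Not at hlt
    rw [Polynomial.leadingCoeff_sub_of_degree_lt' (Polynomial.degree_lt_degree hlt)] at h1
    linarith
  · intro he
    by_contra hlt
    push Not at hlt
    have hB0 : B ≠ 0 := by
      rintro rfl
      simp at h1
      linarith
    rw [Polynomial.leadingCoeff_sub_of_degree_eq (by rw [Polynomial.degree_eq_natDegree hA0, Polynomial.degree_eq_natDegree hB0, he]) hlt.ne] at h1
    linarith

/-- the Hilbert polynomial of a polynomial ring in `D+1` variables. -/
noncomputable def QP (D : ℕ) : Polynomial ℚ := Polynomial.C (1 / (D.factorial : ℚ)) * (ascPochhammer ℚ D).comp (Polynomial.X + Polynomial.C 1)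

theorem QP_deg (D : ℕ) : (QP D).natDegree = D := by
  rw [QP, Polynomial.natDegree_C_mul (by positivity), Polynomial.natDegree_comp, ascPochhammer_natDegree, Polynomial.natDegree_X_add_C, mul_one]

theorem QP_lc (D : ℕ) : (QP D).leadingCoeff = 1 / (D.factorial : ℚ) := by
  rw [QP, Polynomial.leadingCoeff_mul, Polynomial.leadingCoeff_C, (Polynomial.Monic.comp_X_add_C (monic_ascPochhammer ℚ D) _).leadingCoeff, mul_one]

theorem QP_eval (D d : ℕ) : (QP D).eval (d : ℚ) = ((D+1).multichoose d : ℕ) := by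
  rw [QP, Polynomial.eval_mul, Polynomial.eval_C, Polynomial.eval_comp]
  have : Polynomial.eval (d : ℚ) (Polynomial.X + Polynomial.C 1) = ((d + 1 : ℕ) : ℚ) := by simp
  rw [this, ← ascPochhammer_eval_cast, ascPochhammer_nat_eq_ascFactorial, Nat.ascFactorial_eq_factorial_mul_choose, Nat.multichoose_eq]
  have : (D + 1 + d - 1).choose d = (d + D).choose D := by
    rw [show D + 1 + d - 1 = d + D by omega]
    exact Nat.choose_symm_add
  rw [this]
  push_cast
  field_simp

theorem mult_bounds {P : Polynomial ℚ} {h : ℕ → ℕ} (hP : ∀ᶠ d : ℕ in Filter.atTop, (h d : ℚ) = P.eval (d : ℚ)) {D m C E E2 : ℕ} (hm : 1 ≤ m)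
    (h1 : ∀ d, m * (D+1).multichoose d ≤ h (d + E)) (h2 : ∀ d, E2 ≤ d → h d ≤ C * (D+1).multichoose d) :
    (m : ℚ) ≤ P.natDegree.factorial * P.leadingCoeff ∧ P.natDegree.factorial * P.leadingCoeff ≤ C := by
  have hm' : (0:ℚ) < m := by exact_mod_cast hm
  have hD : (0:ℚ) < D.factorial := by positivity
  set P' := P.comp (Polynomial.X + Polynomial.C (E : ℚ)) with hP'
  have hd' : P'.natDegree = P.natDegree := by
    rw [hP', Polynomial.natDegree_comp, Polynomial.natDegree_X_add_C, mul_one]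
  have hl' : P'.leadingCoeff = P.leadingCoeff := by
    rw [hP', Polynomial.leadingCoeff_comp (by rw [Polynomial.natDegree_X_add_C]; norm_num)]
    rw [Polynomial.leadingCoeff_X_add_C]; simp
  have a1 : ∀ᶠ d : ℕ in Filter.atTop, (Polynomial.C (m : ℚ) * QP D).eval (d : ℚ) ≤ P'.eval (d : ℚ) := by
    have := (Filter.tendsto_add_atTop_nat E).eventually hP
    filter_upwards [this] with d hd
    rw [hP', Polynomial.eval_comp, Polynomial.eval_mul, Polynomial.eval_C, QP_eval]
    have e : Polynomial.eval (d : ℚ) (Polynomial.X + Polynomial.C (E : ℚ)) = ((d + E : ℕ) : ℚ) := by simp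
    rw [e, ← hd]
    exact_mod_cast h1 d
  have a2 : ∀ᶠ d : ℕ in Filter.atTop, P.eval (d : ℚ) ≤ (Polynomial.C (C : ℚ) * QP D).eval (d : ℚ) := by
    filter_upwards [hP, Filter.eventually_ge_atTop E2] with d hd hE2
    rw [← hd, Polynomial.eval_mul, Polynomial.eval_C, QP_eval]
    exact_mod_cast h2 d hE2
  have l1 : (Polynomial.C (m : ℚ) * QP D).leadingCoeff = m / D.factorial := by
    rw [Polynomial.leadingCoeff_mul, Polynomial.leadingCoeff_C, QP_lc]; ring
  have n1 : (Polynomial.C (m : ℚ) * QP D).natDegree = D := by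
    rw [Polynomial.natDegree_C_mul hm'.ne', QP_deg]
  obtain ⟨b1, b2⟩ := cmp_deg a1 (by rw [l1]; positivity)
  rw [n1, hd'] at b1 b2
  rw [l1, hl'] at b2
  have hP0 : P ≠ 0 := by
    rintro rfl
    have := lc_nonneg (P := - (Polynomial.C (m : ℚ) * QP D)) (a1.mono fun d hd => by
      rw [Polynomial.eval_neg]
      simp only [hP', Polynomial.zero_comp, Polynomial.eval_zero] at hd
      linarith)
    rw [Polynomial.leadingCoeff_neg, l1] at this
    have : (0:ℚ) < m / D.factorial := by positivity
    linarith
  have hPl : 0 < P.leadingCoeff := lt_of_le_of_ne (lc_nonneg (hP.mono fun d hd => by rw [← hd]; positivity)) (Ne.symm (Polynomial.leadingCoeff_ne_zero.2 hP0))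
  obtain ⟨c1, c2⟩ := cmp_deg a2 hPl
  have n2 : (Polynomial.C (C : ℚ) * QP D).natDegree ≤ D := (Polynomial.natDegree_C_mul_le _ _).trans (QP_deg D).le
  have hdeg : P.natDegree = D := le_antisymm (c1.trans n2) b1
  have l2 : (Polynomial.C (C : ℚ) * QP D).leadingCoeff = C / D.factorial := by
    rw [Polynomial.leadingCoeff_mul, Polynomial.leadingCoeff_C, QP_lc]; ring
  rw [l2] at c2
  rw [hdeg]
  have d1 := b2 hdeg.symm
  have d2 := c2 (le_antisymm c1 (n2.trans hdeg.ge))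
  rw [div_le_iff₀ hD] at d1
  rw [le_div_iff₀ hD] at d2
  constructor <;> linarith

theorem mult_zero {P : Polynomial ℚ} {h : ℕ → ℕ} (hP : ∀ᶠ d : ℕ in Filter.atTop, (h d : ℚ) = P.eval (d : ℚ))
    {E2 : ℕ} (h2 : ∀ d, E2 ≤ d → h d = 0) : P.leadingCoeff = 0 := by
  have : ∀ᶠ d : ℕ in Filter.atTop, P.eval (d : ℚ) = 0 := by
    filter_upwards [hP, Filter.eventually_ge_atTop E2] with d hd h1
    rw [← hd, h2 d h1]; simp
  apply le_antisymm
  · have := lc_nonneg (P := -P) (this.mono fun d hd => by simp [hd])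
    simpa using this
  · exact lc_nonneg (this.mono fun d hd => hd.ge)

section field
variable {k : Type u} [Field k] {N : ℕ}

theorem mult_exists {J : Ideal (Pol k N)} (h : hilbertSamuelMultiplicity k J = 2) :
    ∃ P : Polynomial ℚ, (∀ᶠ d : ℕ in Filter.atTop, (hilbertFunction k J d : ℚ) = P.eval (d : ℚ)) ∧ (P.natDegree.factorial : ℚ) * P.leadingCoeff = 2 := by
  unfold hilbertSamuelMultiplicity at h
  split_ifs at h with hh
  · exact ⟨_, hh.choose_spec, h⟩
  · norm_num at h

/-- lower and upper bounds for the Hilbert function give bounds for the multiplicity. -/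
theorem mult_le {J : Ideal (Pol k N)} (h : hilbertSamuelMultiplicity k J = 2) {D m C E E2 : ℕ} (hm : 1 ≤ m)
    (h1 : ∀ d, m * D.multichoose d ≤ hilbertFunction k J (d + E)) (h2 : ∀ d, E2 ≤ d → hilbertFunction k J d ≤ C * D.multichoose d) :
    m ≤ 2 ∧ 2 ≤ C := by
  obtain ⟨P, hP, he⟩ := mult_exists h
  cases D with
  | zero =>
    have := mult_zero hP (E2 := E2 + 1) (fun d hd => by
      have := h2 d (by omega)
      obtain ⟨d, rfl⟩ := Nat.exists_eq_add_of_le' (show 1 ≤ d by omega)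
      simpa using this)
    rw [this] at he
    norm_num at he
  | succ D =>
    have := mult_bounds hP hm h1 h2
    rw [he] at this
    exact ⟨by exact_mod_cast this.1, by exact_mod_cast this.2⟩

theorem homog_finite (d : ℕ) : Module.Finite k (homogeneousSubmodule (Fin N) k d) := by
  rw [homogeneousSubmodule_eq_finsupp_supported]
  have e : {e : Fin N →₀ ℕ | e.degree = d} = ((Finset.finsuppAntidiag (Finset.univ : Finset (Fin N)) d : Finset (Fin N →₀ ℕ)) : Set (Fin N →₀ ℕ)) := by
      ext e
      simp [Finsupp.degree_eq_sum]
  rw [e]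
  exact Module.Finite.equiv (AddMonoidAlgebra.supportedEquivFinsupp (R := k) (S := k) _).symm

theorem homog_finrank (d : ℕ) : Module.finrank k (homogeneousSubmodule (Fin N) k d) = N.multichoose d := by
  rw [homogeneousSubmodule_eq_finsupp_supported]
  have e : {e : Fin N →₀ ℕ | e.degree = d} = ((Finset.finsuppAntidiag (Finset.univ : Finset (Fin N)) d : Finset (Fin N →₀ ℕ)) : Set (Fin N →₀ ℕ)) := by
      ext e
      simp [Finsupp.degree_eq_sum]
  rw [e, (AddMonoidAlgebra.supportedEquivFinsupp (R := k) (S := k) _).finrank_eq]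
  rw [Module.finrank_finsupp_self]
  simp [Finset.card_finsuppAntidiag_nat_eq_multichoose]
end field
end QPD

namespace QPD
open MvPolynomial

theorem multi_mono {D a b : ℕ} (ha : 1 ≤ a) (hab : a ≤ b) : D.multichoose a ≤ D.multichoose b := by
  cases D with
  | zero => obtain ⟨c, rfl⟩ := Nat.exists_eq_add_of_le' ha; simp
  | succ D =>
    induction hab with
    | refl => exact le_rfl
    | step h ih => rw [Nat.multichoose_succ_succ]; omega

theorem integral_trans' {A B R : Type*} [CommRing A] [CommRing B] [CommRing R] (ψ : A →+* R) (φ : B →+* R)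
    (hφ : φ.IsIntegral) (h : ∀ b, ψ.IsIntegralElem (φ b)) : ψ.IsIntegral := by
  letI := ψ.toAlgebra
  let φ' : B →+* integralClosure A R := φ.codRestrict (integralClosure A R).toSubring h
  have h1 : (algebraMap (integralClosure A R) R).IsIntegral := RingHom.IsIntegral.tower_top φ' _ hφ
  have h2 : (algebraMap A (integralClosure A R)).IsIntegral := fun x => integralClosure.isIntegral x
  exact RingHom.IsIntegral.trans _ _ h2 h1

section field
variable {k : Type u} [Field k] {N : ℕ}

/-- substitution of linear forms. -/
noncomputable def th {D : ℕ} (θ : Fin D → Vec k N) : Pol k D →ₐ[k] Pol k N := aeval fun i => lf (θ i)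

theorem th_X {D : ℕ} (θ : Fin D → Vec k N) (i : Fin D) : th θ (X i) = lf (θ i) := by simp [th]

theorem th_C {D : ℕ} (θ : Fin D → Vec k N) (a : k) : th θ (C a) = C a := by simp [th]

theorem th_homog {D : ℕ} (θ : Fin D → Vec k N) {F : Pol k D} {d : ℕ} (h : F.IsHomogeneous d) : (th θ F).IsHomogeneous d := by
  have := h.aeval (fun i => lf (θ i)) (fun i => lf_homog _)
  rw [one_mul] at this
  exact this

theorem hcomp_th {D : ℕ} (θ : Fin D → Vec k N) (F : Pol k D) (d : ℕ) :
    homogeneousComponent d (th θ F) = th θ (homogeneousComponent d F) := by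
  conv_lhs => rw [← hcomp_sum F (M := max (F.totalDegree + 1) (d + 1)) (by omega), map_sum, map_sum]
  rw [Finset.sum_eq_single d]
  · exact hcomp_self (th_homog θ (homogeneousComponent_isHomogeneous _ _))
  · intro i _ hi
    rw [homogeneousComponent_of_mem (m := d) (n := i) (th_homog θ (homogeneousComponent_isHomogeneous _ _)), if_neg (Ne.symm hi)]
  · intro h
    exact absurd (Finset.mem_range.2 (by omega)) h

theorem th_lf {D : ℕ} (θ : Fin D → Vec k N) (v : Vec k D) : th θ (lf v) = lf (∑ i, v i • θ i) := by
  rw [lf_apply, map_sum, map_sum]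
  refine Finset.sum_congr rfl fun i _ => ?_
  rw [map_mul, th_C, th_X, map_smul, smul_eq_C_mul]

/-- composition with the quotient map. -/
noncomputable def phq {D : ℕ} (θ : Fin D → Vec k N) (p : Ideal (Pol k N)) : Pol k D →ₐ[k] (Pol k N ⧸ p) := (Ideal.Quotient.mkₐ k p).comp (th θ)

theorem phq_apply {D : ℕ} (θ : Fin D → Vec k N) (p : Ideal (Pol k N)) (F : Pol k D) : phq θ p F = Ideal.Quotient.mk p (th θ F) := rfl

theorem hilb_lower {D m E : ℕ} (θ : Fin D → Vec k N) {p : Ideal (Pol k N)} (z : Fin m → Pol k N) (hz : ∀ i, (z i).IsHomogeneous E)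
    (ind : ∀ a : Fin m → Pol k D, ∑ i, th θ (a i) * z i ∈ p → a = 0) (d : ℕ) :
    m * D.multichoose d ≤ hilbertFunction k p (d + E) := by
  have := homog_finite (k := k) (N := D) d
  have := homog_finite (k := k) (N := N) (d + E)
  let L : (Fin m → homogeneousSubmodule (Fin D) k d) →ₗ[k] Pol k N :=
    ∑ i, (LinearMap.mulRight k (z i)) ∘ₗ (th θ).toLinearMap ∘ₗ (homogeneousSubmodule (Fin D) k d).subtype ∘ₗ LinearMap.proj i
  have hL : ∀ a, L a = ∑ i, th θ (a i : Pol k D) * z i := by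
    intro a; simp [L, LinearMap.sum_apply]
  let L' : (Fin m → homogeneousSubmodule (Fin D) k d) →ₗ[k] (Submodule.map (Ideal.Quotient.mkₐ k p).toLinearMap (homogeneousSubmodule (Fin N) k (d + E))) :=
    LinearMap.codRestrict _ ((Ideal.Quotient.mkₐ k p).toLinearMap ∘ₗ L) (fun a => Submodule.mem_map_of_mem (by
      rw [hL]
      exact sum_mem fun i _ => (th_homog θ (a i).2).mul (hz i)))
  have hinj : Function.Injective L' := by
    rw [injective_iff_map_eq_zero]
    intro a ha
    have h1 : Ideal.Quotient.mk p (L a) = 0 := congrArg Subtype.val ha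
    rw [Ideal.Quotient.eq_zero_iff_mem, hL] at h1
    have := ind _ h1
    funext i
    exact Subtype.ext (congrFun this i)
  have h1 := LinearMap.finrank_le_finrank_of_injective hinj
  rw [Module.finrank_pi_fintype] at h1
  simp only [homog_finrank, Finset.sum_const, Finset.card_univ, Fintype.card_fin, smul_eq_mul] at h1
  exact h1

theorem hilb_upper {D : ℕ} (θ : Fin D → Vec k N) {p : Ideal (Pol k N)} (hp : HI p) {ι : Type} [Fintype ι] (z : ι → Pol k N) (e : ι → ℕ)
    (hz : ∀ i, (z i).IsHomogeneous (e i)) (gen : ∀ f, ∃ a : ι → Pol k D, f - ∑ i, th θ (a i) * z i ∈ p) {d : ℕ} (hd : ∑ i, e i < d) :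
    hilbertFunction k p d ≤ Fintype.card ι * D.multichoose d := by
  have he : ∀ i, e i < d := fun i => (Finset.single_le_sum (fun i _ => Nat.zero_le (e i)) (Finset.mem_univ i)).trans_lt hd
  have := fun d => homog_finite (k := k) (N := D) d
  let L : (∀ i : ι, homogeneousSubmodule (Fin D) k (d - e i)) →ₗ[k] Pol k N :=
    ∑ i, (LinearMap.mulRight k (z i)) ∘ₗ (th θ).toLinearMap ∘ₗ (homogeneousSubmodule (Fin D) k (d - e i)).subtype ∘ₗ LinearMap.proj i
  have hL : ∀ a, L a = ∑ i, th θ (a i : Pol k D) * z i := by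
    intro a; simp [L, LinearMap.sum_apply]
  have hle : Submodule.map (Ideal.Quotient.mkₐ k p).toLinearMap (homogeneousSubmodule (Fin N) k d) ≤ LinearMap.range ((Ideal.Quotient.mkₐ k p).toLinearMap ∘ₗ L) := by
    rintro _ ⟨f, hf, rfl⟩
    obtain ⟨a, ha⟩ := gen f
    have h1 := hp _ ha d
    rw [map_sub, map_sum, hcomp_self hf] at h1
    refine ⟨fun i => ⟨homogeneousComponent (d - e i) (a i), homogeneousComponent_isHomogeneous _ _⟩, ?_⟩
    change Ideal.Quotient.mk p (L _) = Ideal.Quotient.mk p f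
    rw [hL, eq_comm, Ideal.Quotient.eq]
    convert h1 using 2
    refine Finset.sum_congr rfl fun i _ => ?_
    rw [mul_comm (th θ (a i)), hcomp_mul' (hz i) (he i).le, hcomp_th, mul_comm]
  have h1 := Submodule.finrank_mono hle
  refine h1.trans ((LinearMap.finrank_range_le _).trans ?_)
  rw [Module.finrank_pi_fintype]
  simp only [homog_finrank]
  rw [← smul_eq_mul, ← Finset.card_univ]
  refine Finset.sum_le_card_nsmul _ _ _ fun i _ => ?_
  have := he i
  exact multi_mono (by omega) (by omega)

theorem fin_of_int {K A R : Type*} [CommRing K] [CommRing A] [CommRing R] [Algebra K A] [Algebra K R] [Algebra.FiniteType K R]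
    (φ : A →ₐ[K] R) (hIntg : φ.toRingHom.IsIntegral) : ∃ (c : ℕ) (s : Fin c → R), ∀ r, ∃ a : Fin c → A, ∑ i, φ (a i) * s i = r := by
  letI := φ.toRingHom.toAlgebra
  have : IsScalarTower K A R := IsScalarTower.of_algebraMap_eq' φ.comp_algebraMap.symm
  have hfin : Module.Finite A R := by
    have : Algebra.IsIntegral A R := ⟨hIntg⟩
    have : Algebra.FiniteType A R := Algebra.FiniteType.of_restrictScalars_finiteType K _ _
    exact Algebra.IsIntegral.finite
  obtain ⟨c, s, hs⟩ := Module.Finite.exists_fin (R := A) (M := R)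
  refine ⟨c, s, fun r => ?_⟩
  have h1 : r ∈ Submodule.span A (Set.range s) := by rw [hs]; trivial
  obtain ⟨a, ha⟩ := (Submodule.mem_span_range_iff_exists_fun _).1 h1
  refine ⟨a, ?_⟩
  simp only [Algebra.smul_def] at ha
  exact ha

theorem hilb_upper' {D : ℕ} (θ : Fin D → Vec k N) {p : Ideal (Pol k N)} (hp : HI p) (hIntg : (phq θ p).toRingHom.IsIntegral) :
    ∃ C E2, ∀ d, E2 ≤ d → hilbertFunction k p d ≤ C * D.multichoose d := by
  obtain ⟨c, s, hs⟩ := fin_of_int _ hIntg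
  choose r hr using fun i => Ideal.Quotient.mk_surjective (s i)
  obtain ⟨M, hM⟩ : ∃ M, ∀ i, (r i).totalDegree < M :=
    ⟨∑ i, (r i).totalDegree + 1, fun i => Nat.lt_succ_of_le (Finset.single_le_sum (f := fun i => (r i).totalDegree) (fun i _ => Nat.zero_le _) (Finset.mem_univ i))⟩
  refine ⟨Fintype.card (Fin c × Fin M), _, fun d hd => hilb_upper θ hp (fun x : Fin c × Fin M => homogeneousComponent x.2 (r x.1)) (fun x => x.2)
    (fun x => homogeneousComponent_isHomogeneous _ _) ?_ hd⟩
  intro f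
  obtain ⟨a, ha⟩ := hs (Ideal.Quotient.mk p f)
  refine ⟨fun x => a x.1, ?_⟩
  rw [← Ideal.Quotient.eq, ← ha, Fintype.sum_prod_type, map_sum]
  refine Finset.sum_congr rfl fun i _ => ?_
  have h2 : ∑ y : Fin M, th θ (a i) * homogeneousComponent (y : ℕ) (r i) = th θ (a i) * r i := by
    rw [← Finset.mul_sum]
    congr 1
    conv_rhs => rw [← hcomp_sum (r i) (hM i), Finset.sum_range]
  rw [phq_apply, ← hr, ← map_mul, ← h2]
end field
end QPD

namespace QPD
open MvPolynomial

section field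
variable {k : Type u} [Field k] {N : ℕ}

theorem lead_mono {B : Type*} [CommRing B] [Algebra k B] {D : ℕ} (τ : Fin D → B) (a : Fin D → k) (s : Fin D →₀ ℕ) :
    (aeval (fun j => Polynomial.C (τ j) + Polynomial.C (algebraMap k B (a j)) * Polynomial.X) (monomial s (1 : k))).natDegree ≤ s.degree ∧
    (aeval (fun j => Polynomial.C (τ j) + Polynomial.C (algebraMap k B (a j)) * Polynomial.X) (monomial s (1 : k))).coeff s.degree =
      algebraMap k B (MvPolynomial.eval a (monomial s 1)) := by
  induction s using Finsupp.induction_linear with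
  | zero => simp
  | add s t hs ht =>
    have h1 : monomial (s + t) (1 : k) = monomial s 1 * monomial t 1 := by simp [monomial_mul]
    rw [h1, map_mul, map_mul, map_mul, map_add]
    exact ⟨Polynomial.natDegree_mul_le_of_le hs.1 ht.1, by rw [Polynomial.coeff_mul_add_eq_of_natDegree_le hs.1 ht.1, hs.2, ht.2]⟩
  | single i n =>
    have h1 : monomial (Finsupp.single i n) (1 : k) = X i ^ n := (X_pow_eq_monomial).symm
    rw [h1, map_pow, map_pow, aeval_X, eval_X, Finsupp.degree_single]
    have h2 : (Polynomial.C (τ i) + Polynomial.C (algebraMap k B (a i)) * Polynomial.X).natDegree ≤ 1 := by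
      rw [add_comm]; exact Polynomial.natDegree_linear_le
    constructor
    · have := Polynomial.natDegree_pow_le_of_le n h2
      rwa [mul_one] at this
    · have := Polynomial.coeff_pow_of_natDegree_le h2 (m := n)
      rw [mul_one] at this
      rw [this]
      simp

theorem lead_homog {B : Type*} [CommRing B] [Algebra k B] {D m : ℕ} (τ : Fin D → B) (a : Fin D → k) {F : Pol k D} (hF : F.IsHomogeneous m) :
    (aeval (fun j => Polynomial.C (τ j) + Polynomial.C (algebraMap k B (a j)) * Polynomial.X) F).natDegree ≤ m ∧
    (aeval (fun j => Polynomial.C (τ j) + Polynomial.C (algebraMap k B (a j)) * Polynomial.X) F).coeff m =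
      algebraMap k B (MvPolynomial.eval a F) := by
  have h1 : F = ∑ s ∈ F.support, F.coeff s • monomial s (1 : k) := by
    conv_lhs => rw [F.as_sum]
    simp [smul_monomial]
  have hd : ∀ s ∈ F.support, s.degree = m := fun s hs => by
    have := hF (mem_support_iff.1 hs)
    rw [Finsupp.degree_eq_weight_one (R := ℕ)]
    exact this
  have h2 := lead_mono (k := k) τ a
  constructor
  · rw [h1, map_sum]
    refine Polynomial.natDegree_sum_le_of_forall_le _ _ fun s hs => ?_
    rw [map_smul]
    exact (Polynomial.natDegree_smul_le _ _).trans ((h2 s).1.trans (hd s hs).le)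
  · conv_lhs => rw [h1, map_sum, Polynomial.finset_sum_coeff]
    conv_rhs => rw [h1, map_sum, map_sum]
    refine Finset.sum_congr rfl fun s hs => ?_
    rw [map_smul, Polynomial.coeff_smul, ← hd s hs, (h2 s).2, smul_eval, map_mul, Algebra.smul_def]

theorem int_lead {B R : Type*} [CommRing B] [CommRing R] [Algebra k B] [Algebra k R] (ψ : B →ₐ[k] R) {D m : ℕ} (τ : Fin D → B) (a : Fin D → k) {F : Pol k D}
    (hF : F.IsHomogeneous m) (ha : MvPolynomial.eval a F ≠ 0) (w : R) (h0 : aeval (fun j => ψ (τ j) + algebraMap k R (a j) * w) F = 0) :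
    ψ.toRingHom.IsIntegralElem w := by
  obtain ⟨h1, h2⟩ := lead_homog (B := B) τ a hF
  set G := aeval (fun j => Polynomial.C (τ j) + Polynomial.C (algebraMap k B (a j)) * Polynomial.X) F with hG
  refine ⟨Polynomial.C (algebraMap k B (MvPolynomial.eval a F)⁻¹) * G, ?_, ?_⟩
  · refine Polynomial.monic_of_natDegree_le_of_coeff_eq_one m ((Polynomial.natDegree_C_mul_le _ _).trans h1) ?_
    rw [Polynomial.coeff_C_mul, h2, ← map_mul, inv_mul_cancel₀ ha, map_one]
  · rw [Polynomial.eval₂_mul]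
    have : Polynomial.eval₂ ψ.toRingHom w G = 0 := by
      rw [← h0]
      let E : Polynomial B →ₐ[k] R := { Polynomial.eval₂RingHom ψ.toRingHom w with
        commutes' := fun r => by
          change Polynomial.eval₂ _ _ (algebraMap k (Polynomial B) r) = _
          rw [Polynomial.algebraMap_apply, Polynomial.eval₂_C]; exact ψ.commutes r }
      have hE : ∀ q, E q = Polynomial.eval₂ ψ.toRingHom w q := fun q => rfl
      rw [← hE, hG, ← AlgHom.comp_apply, comp_aeval]
      congr 2
      funext j
      simp [hE]
    rw [this, mul_zero]

/-- Linear Noether normalization. -/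
theorem noether [Infinite k] {p : Ideal (Pol k N)} (hp : p.IsPrime) (hH : HI p) :
    ∃ (D : ℕ) (θ : Fin D → Vec k N), (∀ F, th θ F ∈ p → F = 0) ∧ (phq θ p).toRingHom.IsIntegral := by
  classical
  have hex : ∃ D, ∃ θ : Fin D → Vec k N, (phq θ p).toRingHom.IsIntegral := by
    refine ⟨N, fun i => Pi.single i 1, RingHom.isIntegral_of_surjective _ fun x => ?_⟩
    obtain ⟨f, rfl⟩ := Ideal.Quotient.mk_surjective x
    refine ⟨f, ?_⟩
    change Ideal.Quotient.mk p (th _ f) = _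
    congr 1
    have : th (fun i : Fin N => (Pi.single i 1 : Vec k N)) = AlgHom.id k _ := by
      apply algHom_ext; intro i; rw [th_X, lf_single]; rfl
    rw [this]; rfl
  obtain ⟨θ, hθ⟩ := Nat.find_spec hex
  have hmin := fun D => Nat.find_min hex (m := D)
  generalize Nat.find hex = D at θ hθ hmin
  refine ⟨D, θ, fun F hF => ?_, hθ⟩
  by_contra hF0
  obtain ⟨m, hm⟩ : ∃ m, homogeneousComponent m F ≠ 0 := by
    by_contra! h
    exact hF0 (by rw [← hcomp_sum F (Nat.lt_succ_self _)]; exact Finset.sum_eq_zero fun i _ => h i)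
  have hFm : th θ (homogeneousComponent m F) ∈ p := by rw [← hcomp_th]; exact hH _ hF m
  have hhom := homogeneousComponent_isHomogeneous m F
  generalize homogeneousComponent m F = F' at hm hFm hhom
  have : ∃ a : Fin D → k, MvPolynomial.eval a F' ≠ 0 := by
    by_contra! h
    exact hm (MvPolynomial.funext fun a => by rw [h a, map_zero])
  obtain ⟨a, ha⟩ := this
  by_cases ha0 : a = 0
  · subst ha0
    have hm0 : m = 0 := by
      by_contra h
      apply ha
      rw [MvPolynomial.eval_zero, constantCoeff_eq]
      exact hhom.coeff_eq_zero (by simpa using Ne.symm h)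
    subst hm0
    obtain ⟨c, hc⟩ := ((MvPolynomial.totalDegree_zero_iff_isHomogeneous _).2 hhom |> fun h => (⟨_, totalDegree_eq_zero_iff_eq_C.1 h⟩ : ∃ c, F' = C c))
    subst hc
    rw [th_C] at hFm
    have hc0 : c ≠ 0 := fun h => hm (by rw [h, map_zero])
    exact hp.ne_top (Ideal.eq_top_of_isUnit_mem _ hFm ((isUnit_iff_ne_zero.2 hc0).map C))
  · obtain ⟨i0, hi0⟩ := Function.ne_iff.1 ha0
    rw [Pi.zero_apply] at hi0
    obtain _ | D := D
    · exact i0.elim0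
    let η : Fin (D + 1) → Vec k N := fun j => θ j - (a j / a i0) • θ i0
    let η' : Fin D → Vec k N := fun j => η (i0.succAbove j)
    apply hmin D (Nat.lt_succ_self D)
    refine ⟨η', ?_⟩
    let τ : Fin (D + 1) → Pol k D := i0.insertNth (α := fun _ => Pol k D) 0 (fun j => X j)
    have hτ : ∀ j, th η' (τ j) = lf (η j) := by
      intro j
      refine Fin.succAboveCases i0 ?_ (fun j => ?_) j
      · simp [τ, η, hi0]
      · simp [τ, th_X, η']
    have hw : (phq η' p).toRingHom.IsIntegralElem (Ideal.Quotient.mk p (lf ((a i0)⁻¹ • θ i0))) := by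
      refine int_lead (phq η' p) τ a hhom ha _ ?_
      have h1 : ∀ j, phq η' p (τ j) + algebraMap k (Pol k N ⧸ p) (a j) * Ideal.Quotient.mk p (lf ((a i0)⁻¹ • θ i0)) = Ideal.Quotient.mkₐ k p (lf (θ j)) := by
        intro j
        rw [phq_apply, hτ]
        change Ideal.Quotient.mk p _ + Ideal.Quotient.mk p (C (a j)) * _ = Ideal.Quotient.mk p _
        rw [← map_mul, ← map_add]
        congr 1
        rw [← smul_eq_C_mul, ← map_smul, ← map_add]
        congr 1
        simp [η, smul_smul, div_eq_mul_inv]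
      simp only [h1]
      rw [← Ideal.Quotient.eq_zero_iff_mem] at hFm
      rw [← hFm]
      change _ = Ideal.Quotient.mkₐ k p (aeval _ F')
      rw [← AlgHom.comp_apply, comp_aeval]
    have hb : ∀ c : k, (phq η' p).toRingHom.IsIntegralElem (Ideal.Quotient.mk p (C c)) := fun c => by
      have : Ideal.Quotient.mk p (C c) = (phq η' p).toRingHom (C c) := by
        change _ = Ideal.Quotient.mk p (th η' (C c))
        rw [th_C]
      rw [this]; exact RingHom.isIntegralElem_map _
    have hθj : ∀ j, (phq η' p).toRingHom.IsIntegralElem (Ideal.Quotient.mk p (lf (θ j))) := fun j => by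
      have : lf (θ j) = th η' (τ j) + C (a j) * lf ((a i0)⁻¹ • θ i0) := by
        rw [hτ, ← smul_eq_C_mul, ← map_smul, ← map_add]
        congr 1
        simp [η, smul_smul, div_eq_mul_inv]
      rw [this, map_add, map_mul]
      exact RingHom.IsIntegralElem.add _ (RingHom.isIntegralElem_map _ (x := τ j)) (RingHom.IsIntegralElem.mul _ (hb _) hw)
    refine integral_trans' _ (phq θ p).toRingHom hθ fun b => ?_
    change (phq η' p).toRingHom.IsIntegralElem (phq θ p b)
    induction b using MvPolynomial.induction_on with
    | C c => rw [phq_apply, th_C]; exact hb c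
    | add f g hf hg => rw [map_add]; exact RingHom.IsIntegralElem.add _ hf hg
    | mul_X f i hf => rw [map_mul]; refine RingHom.IsIntegralElem.mul _ hf ?_; rw [phq_apply, th_X]; exact hθj i
end field
end QPD

namespace QPD
open MvPolynomial

theorem height_prime {R : Type u} [CommRing R] {p : Ideal R} (hp : p.IsPrime) : p.heightENat = Order.height (⟨p, hp⟩ : PrimeSpectrum R) := by
  refine le_antisymm (iInf₂_le (⟨p, hp⟩ : PrimeSpectrum R) le_rfl) (le_iInf₂ fun q hq => Order.height_mono hq)

theorem chain_three {R : Type u} [CommRing R] {p : Ideal R} (hp : p.IsPrime) (h3 : p.heightENat = 3) {P0 P1 P2 P3 : Ideal R}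
    (h0 : P0.IsPrime) (h1 : P1.IsPrime) (h2 : P2.IsPrime) (hP3 : P3.IsPrime) (h01 : P0 < P1) (h12 : P1 < P2) (h23 : P2 < P3) (hle : P3 ≤ p) : P3 = p := by
  rw [height_prime hp] at h3
  by_contra hne
  have a1 := Order.height_add_one_le (a := (⟨P0, h0⟩ : PrimeSpectrum R)) (b := ⟨P1, h1⟩) h01
  have a2 := Order.height_add_one_le (a := (⟨P1, h1⟩ : PrimeSpectrum R)) (b := ⟨P2, h2⟩) h12
  have a3 := Order.height_add_one_le (a := (⟨P2, h2⟩ : PrimeSpectrum R)) (b := ⟨P3, hP3⟩) h23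
  have a4 := Order.height_add_one_le (a := (⟨P3, hP3⟩ : PrimeSpectrum R)) (b := ⟨p, hp⟩) (show P3 < p from lt_of_le_of_ne hle hne)
  rw [h3] at a4
  generalize Order.height (⟨P0, h0⟩ : PrimeSpectrum R) = x0 at *
  generalize Order.height (⟨P1, h1⟩ : PrimeSpectrum R) = x1 at *
  generalize Order.height (⟨P2, h2⟩ : PrimeSpectrum R) = x2 at *
  generalize Order.height (⟨P3, hP3⟩ : PrimeSpectrum R) = x3 at *
  have : (4 : ℕ∞) ≤ 3 := calc
    (4 : ℕ∞) = 0 + 1 + 1 + 1 + 1 := by norm_num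
    _ ≤ x0 + 1 + 1 + 1 + 1 := by gcongr; exact bot_le
    _ ≤ x1 + 1 + 1 + 1 := by gcongr
    _ ≤ x2 + 1 + 1 := by gcongr
    _ ≤ x3 + 1 := by gcongr
    _ ≤ 3 := a4
  exact absurd this (by decide)

theorem height_series {α : Type*} [Preorder α] (l : LTSeries α) : ∀ i : ℕ, ∀ h : i ≤ l.length, Order.height (l 0) + i ≤ Order.height (l ⟨i, Nat.lt_succ_of_le h⟩) := by
  intro i
  induction i with
  | zero => intro h; simp
  | succ i ih =>
    intro h
    have h1 := ih (by omega)
    have h2 : l ⟨i, by omega⟩ < l ⟨i + 1, by omega⟩ := l.strictMono (by simp)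
    have h3 := Order.height_add_one_le h2
    refine le_trans ?_ h3
    push_cast
    rw [← add_assoc]
    gcongr

theorem series_up {A R : Type*} [CommRing A] [CommRing R] [IsDomain R] (φ : A →+* R) (hi : Function.Injective φ) (hIntg : φ.IsIntegral) (l : LTSeries (PrimeSpectrum A)) :
    ∃ L : LTSeries (PrimeSpectrum R), L.length = l.length := by
  letI := φ.toAlgebra
  have : Algebra.IsIntegral A R := ⟨hIntg⟩
  obtain ⟨P, hP, hc⟩ := Ideal.exists_ideal_over_prime_of_isIntegral_of_isDomain (S := R) l.head.asIdeal (by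
    rw [(RingHom.injective_iff_ker_eq_bot _).1 (show Function.Injective (algebraMap A R) from hi)]; exact bot_le)
  have : P.LiesOver l.head.asIdeal := ⟨hc.symm⟩
  obtain ⟨L, hL, -⟩ := Ideal.exists_ltSeries_of_hasGoingUp (S := R) l P
  exact ⟨L, hL⟩

section field
variable {k : Type u} [Field k] {N : ℕ}

theorem krull_pol : ringKrullDim (Pol k N) = (N : ℕ) := by
  rw [MvPolynomial.ringKrullDim_of_isNoetherianRing]
  simp

theorem dim_le {p : Ideal (Pol k N)} (hp : p.IsPrime) (h3 : p.heightENat = 3) {D : ℕ} (θ : Fin D → Vec k N) (hinj : ∀ F, th θ F ∈ p → F = 0)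
    (hIntg : (phq θ p).toRingHom.IsIntegral) : D + 3 ≤ N := by
  rw [height_prime hp] at h3
  obtain ⟨l, hl⟩ := Order.le_krullDim_iff.1 (krull_pol (k := k) (N := D)).ge
  obtain ⟨L, hL⟩ := series_up (phq θ p).toRingHom (by
    rw [injective_iff_map_eq_zero]
    intro F hF
    exact hinj F (Ideal.Quotient.eq_zero_iff_mem.1 hF)) hIntg l
  let L' : LTSeries (PrimeSpectrum (Pol k N)) := L.map (PrimeSpectrum.comap (Ideal.Quotient.mk p)) (by
    intro a b hab
    refine lt_of_le_of_ne (fun x hx => hab.le hx) fun h => hab.ne ?_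
    exact PrimeSpectrum.comap_injective_of_surjective _ Ideal.Quotient.mk_surjective h)
  have hlen : L'.length = D := hL.trans hl
  have h1 := height_series L' D hlen.ge
  have h2 : Order.height (⟨p, hp⟩ : PrimeSpectrum (Pol k N)) ≤ Order.height (L' 0) := by
    apply Order.height_mono
    intro x hx
    change Ideal.Quotient.mk p x ∈ (L 0).asIdeal
    rw [Ideal.Quotient.eq_zero_iff_mem.2 hx]
    exact zero_mem _
  rw [h3] at h2
  have h4 := Order.height_le_krullDim (L' ⟨D, Nat.lt_succ_of_le hlen.ge⟩)
  have h5 := krull_pol (k := k) (N := N)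
  unfold ringKrullDim at h5
  rw [h5] at h4
  have h6 : ((3 + D : ℕ) : ℕ∞) ≤ Order.height (L' ⟨D, Nat.lt_succ_of_le hlen.ge⟩) := by
    refine le_trans ?_ h1
    push_cast; gcongr
  have h7 : ((3 + D : ℕ) : ℕ∞) ≤ (N : ℕ∞) := h6.trans (by exact_mod_cast h4)
  have := Nat.cast_le.1 h7
  omega

end field
end QPD

namespace QPD
open MvPolynomial

section field
variable {k : Type u} [Field k] {N : ℕ}

theorem mult_lid (W : Submodule k (Vec k N)) (hH : HI (lid W)) (h2 : hilbertSamuelMultiplicity k (lid W) = 2) : False := by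
  obtain ⟨π, hπ⟩ := exists_pr' W
  let U := LinearMap.range π
  let b := Module.finBasis k U
  let θ : Fin (Module.finrank k U) → Vec k N := fun i => b i
  let g : Vec k N →ₗ[k] Vec k (Module.finrank k U) := b.equivFun.toLinearMap ∘ₗ π.rangeRestrict
  let θ' : Fin N → Vec k (Module.finrank k U) := fun j => g (Pi.single j 1)
  have hπθ : ∀ i, π (θ i) = θ i := fun i => by
    obtain ⟨v, hv⟩ := (b i).2
    change π (b i : Vec k N) = b i
    rw [← hv, hπ.idem]
  have h1 : ∀ f, th θ (th θ' f) = lsub π f := by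
    intro f
    have : (th θ).comp (th θ') = lsub π := by
      apply algHom_ext
      intro j
      rw [AlgHom.comp_apply, th_X, th_lf, lsub, aeval_X]
      congr 1
      have := b.sum_equivFun (π.rangeRestrict (Pi.single j 1))
      have := congrArg Subtype.val this
      rw [Submodule.coe_sum] at this
      exact this
    rw [← this]; rfl
  have hg : ∀ i, g (θ i) = Pi.single i 1 := by
    intro i
    have : π.rangeRestrict (θ i) = b i := Subtype.ext (hπθ i)
    change b.equivFun (π.rangeRestrict (θ i)) = _
    classical
    rw [this]
    funext j
    rw [Module.Basis.equivFun_self]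
    simp [Pi.single_apply, eq_comm]
  have h3 : ∀ a, th θ' (th θ a) = a := by
    intro a
    have : (th θ').comp (th θ) = AlgHom.id k _ := by
      apply algHom_ext
      intro j
      rw [AlgHom.comp_apply, th_X, th_lf]
      have : ∑ i, θ j i • θ' i = g (θ j) := by
        conv_rhs => rw [← Finset.univ_sum_single (θ j), map_sum]
        refine Finset.sum_congr rfl fun i _ => ?_
        rw [← map_smul]
        congr 1
        rw [← Pi.single_smul, smul_eq_mul, mul_one]
      rw [this, hg, lf_single]; rfl
    rw [← AlgHom.comp_apply, this]; rfl
  have h4 : ∀ a, lsub π (th θ a) = th θ a := by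
    intro a
    have : (lsub π).comp (th θ) = th θ := by
      apply algHom_ext
      intro j
      rw [AlgHom.comp_apply, th_X, lsub_lf, hπθ]
    rw [← AlgHom.comp_apply, this]
  have := (mult_le h2 (D := Module.finrank k U) (m := 1) (C := 1) (E := 0) (E2 := 1) le_rfl ?_ ?_).2
  · omega
  · refine hilb_lower θ (fun _ => 1) (fun i => isHomogeneous_one _ _) fun a ha => ?_
    simp only [Finset.univ_unique, Fin.default_eq_zero, Fin.isValue, mul_one, Finset.sum_singleton] at ha
    have h5 := lsub_eq_zero hπ.zero ha
    rw [h4] at h5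
    funext i
    rw [Subsingleton.elim i 0, ← h3 (a 0), h5, map_zero, Pi.zero_apply]
  · intro d hd
    have := hilb_upper θ hH (ι := Unit) (fun _ => 1) (fun _ => 0) (fun i => isHomogeneous_one _ _) (fun f => ⟨fun _ => th θ' f, by
      simpa [h1] using sub_lsub_mem hπ.sub f⟩) (d := d) (by simp; omega)
    simpa using this

/-- linear part. -/
noncomputable def lpart (p : Ideal (Pol k N)) : Submodule k (Vec k N) := (p.restrictScalars k).comap lf

theorem mem_lpart {p : Ideal (Pol k N)} {v : Vec k N} : v ∈ lpart p ↔ lf v ∈ p := Iff.rfl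

theorem lid_le_of {p : Ideal (Pol k N)} {W : Submodule k (Vec k N)} (h : W ≤ lpart p) : lid W ≤ p := by
  rw [lid, Ideal.span_le]
  rintro _ ⟨v, hv, rfl⟩
  exact h hv

theorem lid_lt {W W' : Submodule k (Vec k N)} (h : W < W') : lid W < lid W' := by
  refine lt_of_le_of_ne (lid_mono h.le) fun he => h.not_ge fun v hv => ?_
  rw [← lf_mem_lid_iff, he]
  exact lf_mem_lid hv

theorem span_lt {s : Set (Vec k N)} {v : Vec k N} (h : v ∉ Submodule.span k s) : Submodule.span k s < Submodule.span k (insert v s) :=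
  lt_of_le_of_ne (Submodule.span_mono (Set.subset_insert _ _)) fun he => h (by rw [he]; exact Submodule.subset_span (Set.mem_insert _ _))

theorem case_three {p : Ideal (Pol k N)} (hp : p.IsPrime) (hH : HI p) (h3 : p.heightENat = 3) (h2 : hilbertSamuelMultiplicity k p = 2)
    {x y z : Vec k N} (hx : x ≠ 0) (hy : y ∉ Submodule.span k {x}) (hz : z ∉ Submodule.span k {y, x}) (hxp : lf x ∈ p) (hyp : lf y ∈ p) (hzp : lf z ∈ p) : False := by
  have h := chain_three hp h3 (lid_prime ⊥) (lid_prime _) (lid_prime _) (lid_prime (Submodule.span k {z, y, x})) (lid_lt (W' := Submodule.span k {x}) (bot_lt_iff_ne_bot.2 (by simpa using hx)))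
    (lid_lt (span_lt hy)) (lid_lt (span_lt hz)) (lid_le_of (by
      rw [Submodule.span_le]
      rintro v (rfl | rfl | rfl) <;> assumption))
  subst h
  exact mult_lid _ hH h2

theorem case_two {p : Ideal (Pol k N)} (hp : p.IsPrime) (hH : HI p) (h3 : p.heightENat = 3)
    {x y : Vec k N} (hx : x ≠ 0) (hy : y ∉ Submodule.span k {x}) (hxy : lpart p = Submodule.span k {y, x}) {f h : Pol k N} (hf : f.IsHomogeneous 2) (hh : h.IsHomogeneous 2)
    (hfp : f ∈ p) (hhp : h ∈ p) (hfl : f ∉ lid (Submodule.span k {y, x})) : ∃ c : k, h - C c * f ∈ lid (Submodule.span k {y, x}) := by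
  set W := Submodule.span k {y, x} with hW
  obtain ⟨π, hπ⟩ := exists_pr' W
  have hWp : lid W ≤ p := lid_le_of hxy.ge
  have hmem : ∀ g, lsub π g ∈ p ↔ g ∈ p := fun g => by
    have := hWp (sub_lsub_mem hπ.sub g)
    exact ⟨fun h => by simpa using add_mem this h, fun h => by simpa using sub_mem h this⟩
  set q := lsub π f with hq
  have hqf : q.IsHomogeneous 2 := lsub_homog π hf
  have hqp : q ∈ p := (hmem f).2 hfp
  have hq0 : q ≠ 0 := fun h => hfl (hπ.mem_iff.2 h)
  have hqW : q ∉ lid W := fun h => hq0 (by rw [hq, ← hπ.lsub_idem]; exact hπ.mem_iff.1 h)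
  have key : ∀ a b : Pol k N, q = a * b → a ∈ p → IsUnit b := by
    intro a b hab ha
    have ha0 : a ≠ 0 := by rintro rfl; exact hq0 (by rw [hab, zero_mul])
    have hb0 : b ≠ 0 := by rintro rfl; exact hq0 (by rw [hab, mul_zero])
    have hdeg : a.totalDegree + b.totalDegree = 2 := by
      rw [← totalDegree_mul_of_isDomain ha0 hb0, ← hab]; exact hqf.totalDegree hq0
    have hc0 : homogeneousComponent 0 a = 0 := by
      have h1 := hH a ha 0
      rw [homogeneousComponent_zero] at h1 ⊢
      by_contra hne
      have : coeff 0 a ≠ 0 := fun h => hne (by rw [h, map_zero])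
      exact hp.ne_top (Ideal.eq_top_of_isUnit_mem _ h1 ((isUnit_iff_ne_zero.2 this).map C))
    have hsum : ∀ n, a.totalDegree < n + 1 → a = ∑ i ∈ Finset.range (n + 1), homogeneousComponent i a := fun n hn => (hcomp_sum a hn).symm
    obtain h0 | h1 | h2 : a.totalDegree = 0 ∨ a.totalDegree = 1 ∨ b.totalDegree = 0 := by omega
    · have := hsum 0 (by omega)
      simp [hc0] at this
      exact absurd this ha0
    · have := hsum 1 (by omega)
      rw [Finset.sum_range_succ, Finset.sum_range_one, hc0, zero_add] at this
      obtain ⟨v, hv⟩ := homog_one_eq (homogeneousComponent_isHomogeneous 1 a)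
      rw [hv] at this
      have hvW : v ∈ W := by rw [← hxy, mem_lpart, ← this]; exact ha
      exact absurd (by rw [hab, this]; exact Ideal.mul_mem_right _ _ (lf_mem_lid hvW)) hqW
    · rw [totalDegree_eq_zero_iff_eq_C] at h2
      rw [h2]
      have : coeff 0 b ≠ 0 := fun h => hb0 (by rw [h2, h, map_zero])
      exact (isUnit_iff_ne_zero.2 this).map C
  have hirr : Irreducible q := by
    refine ⟨fun hu => hp.ne_top (Ideal.eq_top_of_isUnit_mem _ hqp hu), fun a b hab => ?_⟩
    rcases hp.mem_or_mem (hab ▸ hqp) with ha | hb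
    · exact Or.inr (key a b hab ha)
    · exact Or.inl (key b a (by rw [hab, mul_comm]) hb)
  have hprime : (Ideal.span {q}).IsPrime := (Ideal.span_singleton_prime hq0).2 hirr.prime
  have hQ : ((Ideal.span {q}).comap (lsub π)).IsPrime := Ideal.comap_isPrime _ _
  have hpe := chain_three hp h3 (lid_prime ⊥) (lid_prime _) (lid_prime W) hQ (lid_lt (W' := Submodule.span k {x}) (bot_lt_iff_ne_bot.2 (by simpa using hx)))
    (lid_lt (span_lt hy)) (lt_of_le_of_ne (fun g hg => by
      rw [Ideal.mem_comap, hπ.mem_iff.1 hg]; exact zero_mem _) (fun he => hfl (by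
        rw [he, Ideal.mem_comap]; exact Ideal.mem_span_singleton_self _))) (fun g hg => by
      rw [← hmem]
      exact (Ideal.span_singleton_le_iff_mem _).2 hqp hg)
  rw [← hpe, Ideal.mem_comap, Ideal.mem_span_singleton] at hhp
  obtain ⟨c, hc⟩ := hhp
  have h5 := congrArg (homogeneousComponent 2) hc
  rw [hcomp_self (lsub_homog π hh), hcomp_mul' hqf le_rfl, Nat.sub_self, homogeneousComponent_zero] at h5
  refine ⟨coeff 0 c, hπ.mem_iff.2 ?_⟩
  rw [map_sub, map_mul, h5]
  have : lsub π (C (coeff 0 c)) = C (coeff 0 c) := by simp [lsub]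
  rw [this]; ring
end field
end QPD

namespace QPD
open MvPolynomial

section field
variable {k : Type u} [Field k] {N : ℕ}

theorem sq_of_pderiv [IsAlgClosed k] (h2 : (2 : k) = 0) (r : Pol k N) (hr : ∀ i, pderiv i r = 0) : ∃ s, r = s ^ 2 := by
  have : CharP k 2 := CharTwo.of_one_ne_zero_of_two_eq_zero one_ne_zero h2
  have hev : ∀ m ∈ r.support, ∀ i, 2 ∣ m i := by
    intro m hm i
    by_contra hodd
    have h1 := congrArg (coeff (m - Finsupp.single i 1)) (hr i)
    have hle : Finsupp.single i 1 ≤ m := by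
      rw [Finsupp.single_le_iff]; omega
    rw [coeff_pderiv, tsub_add_cancel_of_le hle, coeff_zero, mul_eq_zero] at h1
    rcases h1 with h1 | h1
    · exact (mem_support_iff.1 hm) h1
    · simp only [Finsupp.tsub_apply, Finsupp.single_eq_same] at h1
      have h3 : ((m i : ℕ) : k) = 0 := by
        have : m i = (m i - 1) + 1 := by omega
        rw [this]; push_cast; push_cast at h1; exact h1
      exact hodd ((CharP.cast_eq_zero_iff k 2 _).1 h3)
  choose q hq using fun c : k => IsAlgClosed.exists_pow_nat_eq c (n := 2) (by norm_num)
  refine ⟨∑ m ∈ r.support, monomial (m.mapRange (fun n => n / 2) rfl) (q (coeff m r)), ?_⟩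
  rw [sum_pow_char 2]
  conv_lhs => rw [r.as_sum]
  refine Finset.sum_congr rfl fun m hm => ?_
  have e : 2 • (m.mapRange (fun n => n / 2) rfl : Fin N →₀ ℕ) = m := by
    ext i
    have := hev m hm i
    simp
    omega
  rw [monomial_pow, hq, e]

theorem tdeg_sq (f : Pol k N) : (f ^ 2).totalDegree = 2 * f.totalDegree := by
  by_cases h : f = 0
  · simp [h]
  rw [pow_two, totalDegree_mul_of_isDomain h h]; omega

theorem tdeg_pos {π : Pol k N} (hπ : Prime π) : 1 ≤ π.totalDegree := by
  by_contra h
  have h0 : π.totalDegree = 0 := by omega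
  rw [totalDegree_eq_zero_iff_eq_C] at h0
  have : coeff 0 π ≠ 0 := fun h => hπ.ne_zero (by rw [h0, h, map_zero])
  exact hπ.not_isUnit (by rw [h0]; exact (isUnit_iff_ne_zero.2 this).map C)

theorem no_prime [IsAlgClosed k] {l r a b π : Pol k N} (hl : l.IsHomogeneous 1) (hr : r.IsHomogeneous 2) (hroot : ∀ s, s ^ 2 + l * s + r ≠ 0)
    (hπ : Prime π) (hb : ¬ π ∣ b) (h1 : π ∣ 2 * a - b * l) (h2 : π ^ 2 ∣ a ^ 2 - a * b * l + b ^ 2 * r) : False := by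
  have hπ1 := tdeg_pos hπ
  have hb2 : ¬ π ∣ b ^ 2 := fun h => hb (hπ.dvd_of_dvd_pow h)
  by_cases hk : (2 : k) = 0
  · have hk2 : (2 : Pol k N) = 0 := by
      have := congrArg (C (σ := Fin N)) hk
      rwa [map_zero, map_ofNat] at this
    by_cases hl0 : l = 0
    · subst hl0
      obtain ⟨h, hh⟩ := h2
      have hd : ∀ i, pderiv i r = 0 := by
        intro i
        have h3 := congrArg (pderiv i) hh
        simp only [map_add, map_sub, Derivation.leibniz, pow_two, smul_eq_mul, mul_zero, map_zero] at h3
        have h4 : π ^ 2 ∣ b ^ 2 * pderiv i r := ⟨pderiv i h, by linear_combination h3 + (-a * pderiv i a - b * pderiv i b * r + π * pderiv i π * h) * hk2⟩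
        have h5 := hπ.pow_dvd_of_dvd_mul_left 2 hb2 h4
        by_contra hne
        obtain ⟨c, hc⟩ := h5
        have hc0 : c ≠ 0 := by rintro rfl; exact hne (by rw [hc, mul_zero])
        have h6 : (pderiv i r).IsHomogeneous 1 := hr.pderiv
        have h7 := h6.totalDegree hne
        rw [hc, totalDegree_mul_of_isDomain (pow_ne_zero 2 hπ.ne_zero) hc0, tdeg_sq] at h7
        omega
      obtain ⟨s, hs⟩ := sq_of_pderiv hk r hd
      exact hroot s (by rw [← hs]; linear_combination r * hk2)
    · have hπl : π ∣ l := by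
        have : π ∣ b * l := by
          have h3 : b * l = -(2 * a - b * l) := by linear_combination (a) * hk2
          rw [h3]; exact (dvd_neg).2 h1
        exact (hπ.dvd_or_dvd this).resolve_left hb
      obtain ⟨u, hu⟩ := hπl
      have hu0 : u ≠ 0 := by rintro rfl; exact hl0 (by rw [hu, mul_zero])
      have hud := hl.totalDegree hl0
      rw [hu, totalDegree_mul_of_isDomain hπ.ne_zero hu0] at hud
      have huC := totalDegree_eq_zero_iff_eq_C.1 (show u.totalDegree = 0 by omega)
      have hunit : IsUnit u := by
        have : coeff 0 u ≠ 0 := fun h => hu0 (by rw [huC, h, map_zero])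
        rw [huC]; exact (isUnit_iff_ne_zero.2 this).map C
      have hass : Associated π l := ⟨hunit.unit, by rw [hu]; rfl⟩
      have hlp : Prime l := hass.prime hπ
      have hlb : ¬ l ∣ b := fun h => hb (hass.dvd.trans h)
      have hlb2 : ¬ l ∣ b ^ 2 := fun h => hlb (hlp.dvd_of_dvd_pow h)
      have h2' : l ^ 2 ∣ a ^ 2 - a * b * l + b ^ 2 * r := (hass.symm.pow_pow (n := 2)).dvd.trans h2
      clear h2 h1 hb hb2 hass hunit huC hud hu0 hu hπ1 hπ π u
      obtain ⟨v, hv⟩ := homog_one_eq hl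
      obtain ⟨ρ, hρ⟩ := exists_pr' (Submodule.span k {v})
      have hlid : ∀ f, f ∈ lid (Submodule.span k {v}) ↔ l ∣ f := by
        intro f
        rw [lid_span, Set.image_singleton, Ideal.mem_span_singleton, hv]
      have hρ0 : ∀ f, lsub ρ f = 0 ↔ l ∣ f := fun f => by rw [← hρ.mem_iff, hlid]
      have hρs : ∀ f, l ∣ f - lsub ρ f := fun f => (hlid _).1 (sub_lsub_mem hρ.sub f)
      have hl1 : lsub ρ l = 0 := (hρ0 l).2 dvd_rfl
      have e1 : lsub ρ a ^ 2 + lsub ρ b ^ 2 * lsub ρ r = 0 := by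
        have := (hρ0 _).2 ((dvd_pow_self l two_ne_zero).trans h2')
        simpa [hl1] using this
      have hbb : lsub ρ b ≠ 0 := fun h => hlb ((hρ0 b).1 h)
      have hdvd : lsub ρ b ∣ lsub ρ a := by
        rw [← IsIntegrallyClosed.pow_dvd_pow_iff (n := 2) two_ne_zero]
        exact ⟨-lsub ρ r, by linear_combination e1⟩
      obtain ⟨s, hs⟩ := hdvd
      have hrs : lsub ρ r = s ^ 2 := by
        have : lsub ρ b ^ 2 * (lsub ρ r - s ^ 2) = 0 := by
          rw [hs] at e1
          linear_combination e1 - (lsub ρ b ^ 2 * s ^ 2) * hk2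
        rcases mul_eq_zero.1 this with h | h
        · exact absurd h (pow_ne_zero 2 hbb)
        · exact sub_eq_zero.1 h
      obtain ⟨m, hm⟩ := hρs r
      rw [hrs] at hm
      have hrm : r = s ^ 2 + l * m := by linear_combination hm
      have e2 : l ∣ (a + b * s) ^ 2 := by
        obtain ⟨w, hw⟩ := h2'
        refine ⟨l * w + a * b - b ^ 2 * m, ?_⟩
        rw [hrm] at hw
        linear_combination hw + (a * b * s) * hk2
      obtain ⟨a', ha'⟩ := hlp.dvd_of_dvd_pow e2
      have e3 : l ∣ s + m := by
        obtain ⟨w, hw⟩ := h2'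
        rw [hrm] at hw
        have : l * (b ^ 2 * (s + m)) = l * (l * (w + a' * b - a' ^ 2)) := by
          have ha : a = l * a' - b * s := by linear_combination ha'
          rw [ha] at hw
          linear_combination hw + (l * a' * b * s - b ^ 2 * s ^ 2 ) * hk2
        have := mul_left_cancel₀ hl0 this
        have h3 : l ∣ b ^ 2 * (s + m) := ⟨_, this⟩
        exact (hlp.dvd_or_dvd h3).resolve_left hlb2
      obtain ⟨n, hn⟩ := e3
      have hrn : r = s ^ 2 - l * s + l ^ 2 * n := by rw [hrm]; linear_combination l * hn
      have hsd : s.totalDegree ≤ 1 := by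
        by_cases hs0 : s = 0
        · simp [hs0]
        have := (lsub_homog ρ hr).totalDegree_le
        rw [hrs, tdeg_sq] at this
        omega
      have hnd : n.totalDegree = 0 := by
        by_cases hn0 : n = 0
        · simp [hn0]
        have h3 : l ^ 2 * n = r - s ^ 2 + l * s := by rw [hrn]; ring
        have h4 : (l ^ 2 * n).totalDegree ≤ 2 := by
          rw [h3]
          refine (totalDegree_add _ _).trans (max_le ((totalDegree_sub _ _).trans (max_le hr.totalDegree_le ?_)) ?_)
          · rw [tdeg_sq]; omega
          · refine (totalDegree_mul _ _).trans ?_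
            have := hl.totalDegree_le
            omega
        rw [totalDegree_mul_of_isDomain (pow_ne_zero 2 hl0) hn0, tdeg_sq, hl.totalDegree hl0] at h4
        omega
      obtain ⟨e, he⟩ : ∃ e : k, e ^ 2 + e + coeff 0 n = 0 := by
        obtain ⟨e, he⟩ := IsAlgClosed.exists_root (Polynomial.X ^ 2 + Polynomial.X + Polynomial.C (coeff 0 n)) (by
          have : (Polynomial.X ^ 2 + Polynomial.X + Polynomial.C (coeff 0 n)).degree = 2 := by compute_degree!
          rw [this]; decide)
        exact ⟨e, by simpa [Polynomial.IsRoot] using he⟩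
      have he' : C (σ := Fin N) e ^ 2 + C e + n = 0 := by
        rw [totalDegree_eq_zero_iff_eq_C.1 hnd, ← map_pow, ← map_add, ← map_add, he, map_zero]
      refine hroot (s + l * C e) ?_
      rw [hrn]
      linear_combination l ^ 2 * he' + (s ^ 2 + l * s * C e) * hk2
  · have h2u : C (σ := Fin N) (2 : k)⁻¹ * 2 = 1 := by
      have : (2 : Pol k N) = C 2 := by rw [map_ofNat]
      rw [this, ← map_mul, inv_mul_cancel₀ hk, map_one]
    have hΔ : π ^ 2 ∣ b ^ 2 * (l ^ 2 - 4 * r) := by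
      have h3 : b ^ 2 * (l ^ 2 - 4 * r) = (2 * a - b * l) ^ 2 - 4 * (a ^ 2 - a * b * l + b ^ 2 * r) := by ring
      rw [h3]
      exact dvd_sub (pow_dvd_pow_of_dvd h1 2) (h2.mul_left 4)
    obtain ⟨h, hh⟩ := hπ.pow_dvd_of_dvd_mul_left 2 hb2 hΔ
    have hsq : ∃ s, l ^ 2 - 4 * r = s ^ 2 := by
      by_cases h0 : h = 0
      · exact ⟨0, by rw [hh, h0]; ring⟩
      have hd : (l ^ 2 - 4 * r).totalDegree ≤ 2 := by
        refine (totalDegree_sub _ _).trans (max_le ?_ ?_)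
        · have := (hl.pow 2).totalDegree_le; simpa using this
        · have : (4 : Pol k N) = C 4 := by rw [map_ofNat]
          rw [this, ← smul_eq_C_mul]
          exact (totalDegree_smul_le _ _).trans hr.totalDegree_le
      rw [hh, totalDegree_mul_of_isDomain (pow_ne_zero 2 hπ.ne_zero) h0, tdeg_sq] at hd
      have hC := totalDegree_eq_zero_iff_eq_C.1 (show h.totalDegree = 0 by omega)
      obtain ⟨q, hq⟩ := IsAlgClosed.exists_pow_nat_eq (coeff 0 h) (n := 2) (by norm_num)
      exact ⟨π * C q, by rw [hh, mul_pow, ← map_pow, hq, ← hC]⟩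
    obtain ⟨s, hs⟩ := hsq
    refine hroot (C (2 : k)⁻¹ * (s - l)) ?_
    generalize C (σ := Fin N) (2 : k)⁻¹ = c at h2u
    linear_combination (-(c ^ 2)) * hs + (- (c * 2 + 1) * r  + (c * (l ^ 2 - s * l))) * h2u
end field
end QPD

namespace QPD
open MvPolynomial

theorem monic_of {A R : Type*} [CommRing A] [IsDomain A] [IsIntegrallyClosed A] [CommRing R] [IsDomain R] (φ : A →+* R) (hφ : Function.Injective φ) {y : R}
    (hy : φ.IsIntegralElem y) (P : Polynomial A) (hP : P ≠ 0) (hPy : P.eval₂ φ y = 0) : ∃ Q : Polynomial A, Q.Monic ∧ Q.natDegree = P.natDegree ∧ Q.eval₂ φ y = 0 := by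
  let _ := φ.toAlgebra
  have : FaithfulSMul A R := (faithfulSMul_iff_algebraMap_injective A R).2 hφ
  have : Module.IsTorsionFree A R := inferInstance
  have hIntg : IsIntegral A y := hy
  have hd : minpoly A y ∣ P := minpoly.isIntegrallyClosed_dvd hIntg hPy
  have hm := minpoly.monic hIntg
  have hle := Polynomial.natDegree_le_of_dvd hd hP
  refine ⟨minpoly A y * Polynomial.X ^ (P.natDegree - (minpoly A y).natDegree), hm.mul (Polynomial.monic_X_pow _), ?_, ?_⟩
  · rw [hm.natDegree_mul (Polynomial.monic_X_pow _), Polynomial.natDegree_X_pow]; omega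
  · rw [Polynomial.eval₂_mul]
    have : Polynomial.eval₂ φ y (minpoly A y) = 0 := minpoly.aeval A y
    rw [this, zero_mul]

section field
variable {k : Type u} [Field k] {N : ℕ}

theorem monic_one {D : ℕ} {R : Type*} [CommRing R] [IsDomain R] (φ : Pol k D →+* R) (hφ : Function.Injective φ) {y : R}
    (hy : φ.IsIntegralElem y) {a b : Pol k D} (hb : b ≠ 0) (h : φ b * y = φ a) : ∃ c, y = φ c := by
  have hdeg : (Polynomial.C b * Polynomial.X + Polynomial.C (-a)).natDegree = 1 := Polynomial.natDegree_linear hb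
  obtain ⟨Q, hQ, hQd, hQy⟩ := monic_of φ hφ hy (Polynomial.C b * Polynomial.X + Polynomial.C (-a)) (fun h0 => by rw [h0] at hdeg; simp at hdeg) (by
    simp [h])
  rw [hdeg] at hQd
  have hQ1 : Q.coeff 1 = 1 := by rw [← hQd]; exact hQ
  rw [Polynomial.eval₂_eq_sum_range, hQd, Finset.sum_range_succ, Finset.sum_range_one, hQ1] at hQy
  refine ⟨-Q.coeff 0, ?_⟩
  rw [map_neg]
  simp at hQy
  linear_combination hQy

theorem monic_two {D : ℕ} {R : Type*} [CommRing R] [IsDomain R] (φ : Pol k D →+* R) (hφ : Function.Injective φ) {y : R}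
    (hy : φ.IsIntegralElem y) {a : Fin 3 → Pol k D} (ha : a ≠ 0) (h : φ (a 0) + φ (a 1) * y + φ (a 2) * y ^ 2 = 0) (hna : ∀ c, y ≠ φ c) : ∃ l r, y ^ 2 + φ l * y + φ r = 0 := by
  have h2 : a 2 ≠ 0 := by
    intro h2
    have h1 : a 1 = 0 := by
      by_contra h1
      obtain ⟨c, hc⟩ := monic_one φ hφ hy (a := - a 0) h1 (by rw [h2] at h; rw [map_neg]; simp at h; linear_combination h)
      exact hna c hc
    have h0 : a 0 = 0 := by
      apply hφ; simpa [h1, h2] using h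
    exact ha (by funext i; fin_cases i <;> assumption)
  have hdeg : (Polynomial.C (a 2) * Polynomial.X ^ 2 + Polynomial.C (a 1) * Polynomial.X + Polynomial.C (a 0)).natDegree = 2 := Polynomial.natDegree_quadratic h2
  obtain ⟨Q, hQ, hQd, hQy⟩ := monic_of φ hφ hy _ (fun h0 => by rw [h0] at hdeg; simp at hdeg) (show Polynomial.eval₂ φ y (Polynomial.C (a 2) * Polynomial.X ^ 2 + Polynomial.C (a 1) * Polynomial.X + Polynomial.C (a 0)) = 0 by
    simp; linear_combination h)
  rw [hdeg] at hQd
  have hQ1 : Q.coeff 2 = 1 := by rw [← hQd]; exact hQ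
  rw [Polynomial.eval₂_eq_sum_range, hQd, Finset.sum_range_succ, Finset.sum_range_succ, Finset.sum_range_one, hQ1] at hQy
  refine ⟨Q.coeff 1, Q.coeff 0, ?_⟩
  simp at hQy
  linear_combination hQy

theorem lin_dep [IsAlgClosed k] {D : ℕ} {R : Type*} [CommRing R] [IsDomain R] (φ : Pol k D →+* R) (hφ : Function.Injective φ) {y1 y2 : R}
    (i1 : φ.IsIntegralElem y1) (i2 : φ.IsIntegralElem y2) (H1 : ∀ c, y1 ≠ φ c) (H2 : ∀ c, y2 ≠ φ c) {l r l2 r2 : Pol k D} (hl : l.IsHomogeneous 1) (hr : r.IsHomogeneous 2)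
    (Q1 : y1 ^ 2 + φ l * y1 + φ r = 0) (Q2 : y2 ^ 2 + φ l2 * y2 + φ r2 = 0) {a : Fin 3 → Pol k D} (ha : a ≠ 0)
    (dep : φ (a 0) + φ (a 1) * y1 + φ (a 2) * y2 = 0) : ∃ a b, y2 = φ a + φ b * y1 := by
  have ind : ∀ a b, φ a + φ b * y1 = 0 → a = 0 ∧ b = 0 := by
    intro a b h
    have hb : b = 0 := by
      by_contra hb
      obtain ⟨c, hc⟩ := monic_one φ hφ i1 (a := -a) hb (by rw [map_neg]; linear_combination h)
      exact H1 c hc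
    subst hb
    refine ⟨hφ ?_, rfl⟩
    simpa using h
  have hex : ∃ n, ∃ c a b : Pol k D, c ≠ 0 ∧ c.totalDegree = n ∧ φ c * y2 = φ a + φ b * y1 := by
    refine ⟨_, a 2, - a 0, - a 1, fun h2 => ?_, rfl, by rw [map_neg, map_neg]; linear_combination dep⟩
    rw [h2, map_zero, zero_mul, add_zero] at dep
    have := ind _ _ dep
    exact ha (by funext i; fin_cases i; exacts [this.1, this.2, h2])
  classical
  obtain ⟨c, a, b, hc0, hcd, hrel⟩ := Nat.find_spec hex
  have hmin := fun m => Nat.find_min hex (m := m)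
  rw [← hcd] at hmin
  have hb0 : b ≠ 0 := by
    rintro rfl
    obtain ⟨d, hd⟩ := monic_one φ hφ i2 hc0 (a := a) (by simpa using hrel)
    exact H2 d hd
  have hE := ind (a ^ 2 - b ^ 2 * r + l2 * c * a + r2 * c ^ 2) (b * (2 * a - b * l + l2 * c)) (by
    simp only [map_add, map_sub, map_mul, map_pow, map_ofNat]
    linear_combination (φ c ^ 2) * Q2 - (φ b ^ 2) * Q1 + (-(φ c * y2) - (φ a + φ b * y1) - φ l2 * φ c) * hrel)
  have e1 := (mul_eq_zero.1 hE.2).resolve_left hb0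
  have e2 : a ^ 2 - a * b * l + b ^ 2 * r = c ^ 2 * r2 := by linear_combination a * e1 - hE.1
  by_cases hcu : IsUnit c
  · obtain ⟨u, hu⟩ := hcu.exists_left_inv
    refine ⟨u * a, u * b, ?_⟩
    have := congrArg φ hu
    rw [map_mul, map_one] at this
    rw [map_mul, map_mul]
    linear_combination (- y2) * this + φ u * hrel
  · exfalso
    obtain ⟨π, hπi, hπc⟩ := WfDvdMonoid.exists_irreducible_factor hcu hc0
    have hπ := hπi.prime
    refine no_prime (a := a) (b := b) hl hr ?_ hπ ?_ ?_ ?_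
    · intro s hs
      have h1 : (y1 - φ s) * (y1 + φ s + φ l) = 0 := by
        have := congrArg φ hs
        simp only [map_add, map_mul, map_pow, map_zero] at this
        linear_combination Q1 - this
      rcases mul_eq_zero.1 h1 with h | h
      · exact H1 s (sub_eq_zero.1 h)
      · refine H1 (-s - l) ?_
        rw [map_sub, map_neg]; linear_combination h
    · intro hπb
      have hπa : π ∣ a := by
        apply hπ.dvd_of_dvd_pow (n := 2)
        have : a ^ 2 = c ^ 2 * r2 + b * (a * l - b * r) := by linear_combination e2
        rw [this]
        exact dvd_add (((dvd_pow hπc two_ne_zero)).mul_right _) (hπb.mul_right _)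
      obtain ⟨c', rfl⟩ := hπc
      obtain ⟨a', rfl⟩ := hπa
      obtain ⟨b', rfl⟩ := hπb
      have hc' : c' ≠ 0 := right_ne_zero_of_mul hc0
      refine hmin c'.totalDegree ?_ ⟨c', a', b', hc', rfl, ?_⟩
      · rw [totalDegree_mul_of_isDomain hπ.ne_zero hc']
        have := tdeg_pos hπ
        omega
      · have h0 : φ π ≠ 0 := fun h => hπ.ne_zero (hφ (by rw [h, map_zero]))
        apply mul_left_cancel₀ h0
        simp only [map_mul] at hrel
        linear_combination hrel
    · exact hπc.trans ⟨-l2, by linear_combination e1⟩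
    · rw [e2]; exact (pow_dvd_pow_of_dvd hπc 2).mul_right _

end field
end QPD

namespace QPD
open MvPolynomial

section field
variable {k : Type u} [Field k] {N : ℕ}

theorem dep {p : Ideal (Pol k N)} (hH : HI p) (h2 : hilbertSamuelMultiplicity k p = 2) {D : ℕ} (θ : Fin D → Vec k N)
    (hinj : ∀ F, th θ F ∈ p → F = 0) (hIntg : (phq θ p).toRingHom.IsIntegral) (z : Fin 3 → Pol k N) (e : Fin 3 → ℕ) (hz : ∀ i, (z i).IsHomogeneous (e i)) :
    ∃ a : Fin 3 → Pol k D, a ≠ 0 ∧ ∑ i, th θ (a i) * z i ∈ p := by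
  obtain ⟨C0, E2, hC⟩ := hilb_upper' θ hH hIntg
  obtain _ | D := D
  · exfalso
    have := (mult_le h2 (D := 0) (m := 1) (C := 0) (E := 0) (E2 := max 1 E2) le_rfl ?_ ?_).2
    · omega
    · refine hilb_lower θ (fun _ => 1) (fun i => isHomogeneous_one _ _) fun a ha => ?_
      simp only [Finset.univ_unique, Fin.default_eq_zero, Fin.isValue, mul_one, Finset.sum_singleton] at ha
      funext i
      rw [Subsingleton.elim i 0, hinj _ ha, Pi.zero_apply]
    · intro d hd
      have h1 := hC d (by omega)
      obtain ⟨d, rfl⟩ : ∃ d', d = d' + 1 := ⟨d - 1, by omega⟩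
      simpa using h1
  · by_contra! hno
    let E := ∑ i, e i
    have he : ∀ i, e i ≤ E := fun i => Finset.single_le_sum (fun i _ => Nat.zero_le (e i)) (Finset.mem_univ i)
    have := (mult_le h2 (D := D + 1) (m := 3) (E := E) (by norm_num) (hilb_lower θ (fun i => th θ (X 0 ^ (E - e i)) * z i) (fun i => ?_) fun a ha => ?_) hC).1
    · omega
    · have h3 : (X 0 ^ (E - e i) : Pol k (D + 1)).IsHomogeneous (E - e i) := by
        have := (isHomogeneous_X k (0 : Fin (D + 1))).pow (E - e i)
        rwa [one_mul] at this
      have := (th_homog θ h3).mul (hz i)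
      rwa [Nat.sub_add_cancel (he i)] at this
    · have h4 : (fun i => a i * X 0 ^ (E - e i)) = 0 := by
        by_contra hne
        refine hno _ hne ?_
        simpa only [map_mul, mul_assoc] using ha
      funext i
      exact (mul_eq_zero.1 (congrFun h4 i)).resolve_right (pow_ne_zero _ (X_ne_zero 0))

theorem case_one [IsAlgClosed k] {p : Ideal (Pol k N)} (hp : p.IsPrime) (hH : HI p) (h3 : p.heightENat = 3) (h2 : hilbertSamuelMultiplicity k p = 2)
    (ht : Module.finrank k (lpart p) ≤ 1) : False := by
  have := IsAlgClosed.instInfinite (K := k)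
  obtain ⟨D, θ, hinj, hIntg⟩ := noether hp hH
  have hD := dim_le hp h3 θ hinj hIntg
  let W0 := Submodule.span k (Set.range θ) ⊔ lpart p
  have hW0 : Module.finrank k W0 ≤ D + 1 := by
    refine (Submodule.finrank_add_le_finrank_add_finrank _ _).trans (add_le_add ?_ ht)
    exact (finrank_range_le_card θ).trans (by simp)
  have hsmall : ∀ W : Submodule k (Vec k N), Module.finrank k W < N → ∃ y, y ∉ W := by
    intro W hW
    by_contra! h
    have : W = ⊤ := eq_top_iff.2 fun y _ => h y
    rw [this, finrank_top, Module.finrank_fin_fun] at hW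
    omega
  obtain ⟨y1, hy1⟩ := hsmall W0 (by omega)
  obtain ⟨y2, hy2⟩ := hsmall (W0 ⊔ Submodule.span k {y1}) (by
    have a1 := Submodule.finrank_add_le_finrank_add_finrank W0 (Submodule.span k {y1})
    have a2 : Module.finrank k (Submodule.span k {y1}) ≤ 1 := by
      have := finrank_span_le_card (R := k) ({y1} : Set (Vec k N))
      simpa using this
    omega)
  have hy2' : y2 ∉ W0 := fun h => hy2 (Submodule.mem_sup_left h)
  have hthW : ∀ a : Pol k D, ∃ w ∈ W0, homogeneousComponent 1 (th θ a) = lf w := by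
    intro a
    obtain ⟨v, hv⟩ := homog_one_eq (homogeneousComponent_isHomogeneous 1 a)
    refine ⟨∑ i, v i • θ i, Submodule.mem_sup_left (sum_mem fun i _ => Submodule.smul_mem _ _ (Submodule.subset_span ⟨i, rfl⟩)), ?_⟩
    rw [hcomp_th, hv, th_lf]
  have nota : ∀ y, y ∉ W0 → ∀ c, Ideal.Quotient.mk p (lf y) ≠ (phq θ p).toRingHom c := by
    intro y hy c hc
    have h1 := (Ideal.Quotient.eq.1 (show Ideal.Quotient.mk p (lf y) = Ideal.Quotient.mk p (th θ c) from hc))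
    have h1 := hH _ h1 1
    obtain ⟨w, hw, hwe⟩ := hthW c
    rw [map_sub, hwe, hcomp_self (lf_homog y), ← map_sub] at h1
    have h2 : y = w + (y - w) := by abel
    exact hy (by rw [h2]; exact add_mem hw (Submodule.mem_sup_right h1))
  have hφ : Function.Injective (phq θ p).toRingHom := by
    rw [injective_iff_map_eq_zero]
    intro F hF
    exact hinj F (Ideal.Quotient.eq_zero_iff_mem.1 hF)
  have quad : ∀ y, y ∉ W0 → ∃ l r : Pol k D, l.IsHomogeneous 1 ∧ r.IsHomogeneous 2 ∧
      Ideal.Quotient.mk p (lf y) ^ 2 + (phq θ p).toRingHom l * Ideal.Quotient.mk p (lf y) + (phq θ p).toRingHom r = 0 := by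
    intro y hy
    obtain ⟨a, ha, hs⟩ := dep hH h2 θ hinj hIntg ![1, lf y, lf y ^ 2] ![0, 1, 2] (by
      intro i; fin_cases i
      · exact isHomogeneous_one _ _
      · exact lf_homog y
      · exact (lf_homog y).pow 2)
    rw [← Ideal.Quotient.eq_zero_iff_mem] at hs
    obtain ⟨l, r, hlr⟩ := monic_two (phq θ p).toRingHom hφ (hIntg (Ideal.Quotient.mk p (lf y))) ha (by
      simp only [Fin.sum_univ_three, map_add, map_mul, Matrix.cons_val_zero, Matrix.cons_val_one, Matrix.cons_val_two, Matrix.cons_val, map_one, mul_one, map_pow] at hs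
      exact hs) (nota y hy)
    refine ⟨homogeneousComponent 1 l, homogeneousComponent 2 r, homogeneousComponent_isHomogeneous _ _, homogeneousComponent_isHomogeneous _ _, ?_⟩
    have h4 : lf y ^ 2 + lf y * th θ l + th θ r ∈ p := by
      rw [← Ideal.Quotient.eq_zero_iff_mem, map_add, map_add, map_mul, map_pow, mul_comm (Ideal.Quotient.mk p (lf y))]
      exact hlr
    have h5 := hH _ h4 2
    have hsq : (lf y ^ 2).IsHomogeneous 2 := (lf_homog y).pow 2
    rw [map_add, map_add, hcomp_self hsq, hcomp_mul' (lf_homog y) (by norm_num), hcomp_th, hcomp_th,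
      ← Ideal.Quotient.eq_zero_iff_mem, map_add, map_add, map_mul, map_pow, mul_comm (Ideal.Quotient.mk p (lf y))] at h5
    exact h5
  obtain ⟨l, r, hl, hr, hq1⟩ := quad y1 hy1
  obtain ⟨l2, r2, hl2, hr2, hq2⟩ := quad y2 hy2'
  obtain ⟨a, ha, hs⟩ := dep hH h2 θ hinj hIntg ![1, lf y1, lf y2] ![0, 1, 1] (by
      intro i; fin_cases i
      · exact isHomogeneous_one _ _
      · exact lf_homog y1
      · exact lf_homog y2)
  rw [← Ideal.Quotient.eq_zero_iff_mem] at hs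
  obtain ⟨a, b, hab⟩ := lin_dep (phq θ p).toRingHom hφ (hIntg _) (hIntg _) (nota y1 hy1) (nota y2 hy2') hl hr hq1 hq2 ha (by
      simp only [Fin.sum_univ_three, map_add, map_mul, Matrix.cons_val_zero, Matrix.cons_val_one, Matrix.cons_val_two, Matrix.cons_val, map_one, mul_one] at hs
      exact hs)
  have h4 : lf y2 - (th θ a + lf y1 * th θ b) ∈ p := by
    rw [← Ideal.Quotient.eq, map_add, map_mul, mul_comm (Ideal.Quotient.mk p (lf y1))]
    exact hab
  have h5 := hH _ h4 1
  obtain ⟨w, hw, hwe⟩ := hthW a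
  rw [map_sub, map_add, hcomp_self (lf_homog y2), hwe, hcomp_mul' (lf_homog y1) le_rfl, Nat.sub_self, hcomp_th, homogeneousComponent_zero, th_C,
    mul_comm, ← smul_eq_C_mul, ← map_smul, ← map_add, ← map_sub] at h5
  have h6 : y2 = w + (y2 - (w + coeff 0 b • y1)) + coeff 0 b • y1 := by abel
  apply hy2
  rw [h6]
  exact add_mem (Submodule.mem_sup_left (add_mem hw (Submodule.mem_sup_right h5))) (Submodule.mem_sup_right (Submodule.smul_mem _ _ (Submodule.mem_span_singleton_self _)))

theorem final [IsAlgClosed k] {n : ℕ} (f : Fin n → Pol k N) (hf : ∀ i, (f i).IsHomogeneous 2) {p : Ideal (Pol k N)}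
    (hp : IsAssociatedPrime p (Pol k N ⧸ Ideal.span (Set.range f))) (h3 : p.heightENat = 3) (h2 : hilbertSamuelMultiplicity k p = 2) :
    PD (Pol k N) (Pol k N ⧸ Ideal.span (Set.range f)) (max (3 * n - 4) (4 * n - 10)) := by
  obtain ⟨hpr, hH, g, hg, hgp⟩ := assoc_data (HI_span f (fun _ => 2) hf) hp
  have ht : ¬ Module.finrank k (lpart p) ≤ 1 := fun h => case_one hpr hH h3 h2 h
  have hne : ∃ x ∈ lpart p, x ≠ 0 := by
    by_contra! h
    have : lpart p = ⊥ := by rw [eq_bot_iff]; intro x hx; exact h x hx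
    rw [this] at ht; simp at ht
  obtain ⟨x, hxp, hx⟩ := hne
  have hne : ∃ y ∈ lpart p, y ∉ Submodule.span k {x} := by
    by_contra! h
    have h1 := Submodule.finrank_mono (show lpart p ≤ Submodule.span k {x} from h)
    rw [finrank_span_singleton hx] at h1
    exact ht h1
  obtain ⟨y, hyp, hy⟩ := hne
  have hW : lpart p = Submodule.span k {y, x} := by
    refine le_antisymm (fun z hz => ?_) (by rw [Submodule.span_le]; rintro v (rfl | rfl) <;> assumption)
    by_contra hzn
    exact case_three hpr hH h3 h2 hx hy hzn hxp hyp hz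
  have hfp : ∀ i, f i ∈ p := fun i => (hgp _).2 (Ideal.mul_mem_right _ _ (Ideal.subset_span ⟨i, rfl⟩))
  refine reduction f hf hx hy hg ((hgp _).1 hxp) ((hgp _).1 hyp) ?_
  rw [Set.pair_comm]
  intro i hi j
  exact case_two hpr hH h3 hx hy hW (hf i) (hf j) (hfp i) (hfp j) hi
end field
end QPD

/-- If `I` is a homogeneous ideal generated by `n` quadrics in a polynomial ring over an
algebraically closed field, and `I` has an associated prime `p` with `height p = 3` and
Hilbert–Samuel multiplicity `e(S/p) = 2`, then the stated bound on `pd_S(S/I)` holds. -/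
theorem pd_le_of_assoc_prime_mult_two (k : Type u) [Field k] [IsAlgClosed k] (N : ℕ) (n : ℕ)
    (f : Fin n → MvPolynomial (Fin N) k)
    (hf : ∀ i, (f i).IsHomogeneous 2)
    (I : Ideal (MvPolynomial (Fin N) k))
    (hI : I = Ideal.span (Set.range f))
    (p : Ideal (MvPolynomial (Fin N) k))
    (hp : IsAssociatedPrime p (MvPolynomial (Fin N) k ⧸ I))
    (hpht : p.heightENat = 3)
    (hpe : hilbertSamuelMultiplicity k p = 2) :
    projDim (MvPolynomial (Fin N) k) (MvPolynomial (Fin N) k ⧸ I) ≤ (max (3 * n - 4) (4 * n - 10) : ℕ) := by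
  subst hI
  exact QPD.projDim_le (QPD.final f hf hp hpht hpe)
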